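/- arXiv:1806.02083 — 2 statements merged into one kernel-verified Lean document; each statement's English description precedes it below -/
import Mathlib

section
/- For every u ≥ 0 and every t > 0: ∫_0^∞ W^{(u)}(z) (z/t) P{X_t ∈ dz} = e^{ut}. -/
open MeasureTheory Real Set Filter

noncomputable section

/-- A spectrally negative Lévy process: a Lévy process `X` with no positive jumps and
non-monotone paths, together with the family of laws `P y x` under which the process
starts at `x` with past maximum `y`, its Laplace exponent `psi`
(`E[exp (lam * X t)] = exp (psi lam * t)` for `lam ≥ 0`), the right-continuous inverse
`Phi` of `psi`, and for each `u ≥ 0` the `u`-scale function `W u` (vanishing on `(-∞,0)`,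
continuous on `[0,∞)`, with Laplace transform `1/(psi lam - u)` for `lam > Phi u`). -/
structure SNLevy where
  /-- the sample space -/
  Ω : Type
  /-- the σ-algebra on the sample space -/
  [mΩ : MeasurableSpace Ω]
  /-- the process -/
  X : ℝ → Ω → ℝ
  /-- `P y x` is the law of the process started at `x` with past maximum `y` -/
  P : ℝ → ℝ → Measure Ω
  prob : ∀ y x, IsProbabilityMeasure (P y x)
  meas : ∀ t, Measurable (X t)
  start : ∀ y x, ∀ᵐ ω ∂ P y x, X 0 ω = x
  /-- spatial homogeneity: shifting paths by `c` carries `P y x` to `P (y+c) (x+c)` -/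
  homog : ∀ y x c, Measure.map (fun ω t => X t ω + c) (P y x)
      = Measure.map (fun ω t => X t ω) (P (y + c) (x + c))
  /-- càdlàg paths (right-continuity) -/
  cadlag : ∀ y x, ∀ᵐ ω ∂ P y x, ∀ t ≥ (0:ℝ),
      ContinuousWithinAt (fun s => X s ω) (Ici t) t
  /-- stationary increments -/
  stat : ∀ y x s t, 0 ≤ s → s ≤ t →
      Measure.map (fun ω => X t ω - X s ω) (P y x)
        = Measure.map (fun ω => X (t - s) ω - X 0 ω) (P y x)
  /-- independent increments -/
  indep : ∀ y x s t, 0 ≤ s → s ≤ t →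
      ProbabilityTheory.IndepFun (fun ω => X t ω - X s ω) (fun ω => X s ω) (P y x)
  /-- spectral negativity: no positive jumps -/
  noPosJumps : ∀ y x, ∀ᵐ ω ∂ P y x, ∀ t > (0:ℝ),
      X t ω ≤ Filter.limsup (fun s => X s ω) (nhdsWithin t (Iio t))
  /-- the paths are not monotone -/
  nonMonotone : ∀ y x,
      ¬ (∀ᵐ ω ∂ P y x, MonotoneOn (fun t => X t ω) (Ici 0)) ∧
      ¬ (∀ᵐ ω ∂ P y x, AntitoneOn (fun t => X t ω) (Ici 0))
  /-- the Laplace exponent of the process -/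
  psi : ℝ → ℝ
  psi_def : ∀ lam t : ℝ, 0 ≤ lam → 0 < t →
      ∫ ω, Real.exp (lam * X t ω) ∂ P 0 0 = Real.exp (psi lam * t)
  /-- the right-continuous inverse of the Laplace exponent -/
  Phi : ℝ → ℝ
  Phi_def : ∀ θ, Phi θ = sSup {p | 0 < p ∧ psi p = θ}
  /-- the family of scale functions -/
  W : ℝ → ℝ → ℝ
  W_nonneg : ∀ u x, 0 ≤ W u x
  W_neg : ∀ u x, x < 0 → W u x = 0
  W_cont : ∀ u, 0 ≤ u → ContinuousOn (W u) (Ici 0)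
  W_LT : ∀ u, 0 ≤ u → ∀ lam, Phi u < lam →
      ∫ x in Ioi (0:ℝ), Real.exp (-lam * x) * W u x = 1 / (psi lam - u)

attribute [instance] SNLevy.mΩ

namespace SNLevy

variable (L : SNLevy)

/-- The last record maximum `(sup_{s ≤ t} X_s) ∨ y`. -/
def M (y t : ℝ) (ω : L.Ω) : ℝ := max (sSup ((fun s => L.X s ω) '' Icc 0 t)) y

/-- The drawdown process `Y_t = (sup_{s ≤ t} X_s) ∨ y - X_t`. -/
def Y (y t : ℝ) (ω : L.Ω) : ℝ := L.M y t ω - L.X t ω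

/-- First passage time of the drawdown above level `a`. -/
def tauPlus (y a : ℝ) (ω : L.Ω) : ℝ := sInf {t | 0 < t ∧ a < L.Y y t ω}

/-- The event `{τ_a^+ < ∞}`. -/
def hitPlus (y a : ℝ) : Set L.Ω := {ω | {t | 0 < t ∧ a < L.Y y t ω}.Nonempty}

/-- First passage time of the drawdown below level `a`. -/
def tauMinus (y a : ℝ) (ω : L.Ω) : ℝ := sInf {t | 0 < t ∧ L.Y y t ω < a}

/-- The event `{τ_a^- < ∞}`. -/
def hitMinus (y a : ℝ) : Set L.Ω := {ω | {t | 0 < t ∧ L.Y y t ω < a}.Nonempty}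

/-- `g_t = sup {0 ≤ s ≤ t : Y_s ≤ a}`. -/
def g (y a t : ℝ) (ω : L.Ω) : ℝ := sSup {s | 0 ≤ s ∧ s ≤ t ∧ L.Y y s ω ≤ a}

/-- The Parisian ruin time `τ_r = inf {t > r : t - g_t ≥ r}` of the drawdown. -/
def tauR (y a r : ℝ) (ω : L.Ω) : ℝ := sInf {t | r < t ∧ r ≤ t - L.g y a t ω}

/-- The event `{τ_r < ∞}`. -/
def ruins (y a r : ℝ) : Set L.Ω := {ω | {t | r < t ∧ r ≤ t - L.g y a t ω}.Nonempty}

/-- The law of `X_t` under `P` (start at `0`). -/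
def law (t : ℝ) : Measure ℝ := Measure.map (L.X t) (L.P 0 0)

/-- `Ω_ε^{(u)}(x,t) = ∫_ε^∞ W^{(u)}(z + x - ε) (z/t) P{X_t ∈ dz}`. -/
def Om (ε u x t : ℝ) : ℝ := ∫ z in Ici ε, L.W u (z + x - ε) * (z / t) ∂ L.law t

/-- `Λ_ε^{(u)}(x,t) = ∫_ε^∞ W^{(u)′}(z + x - ε) (z/t) P{X_t ∈ dz}`. -/
def Lam (ε u x t : ℝ) : ℝ := ∫ z in Ici ε, deriv (L.W u) (z + x - ε) * (z / t) ∂ L.law t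

/-- `W̄^{(u)}(x) = ∫_0^x W^{(u)}(y) dy`. -/
def Wbar (u x : ℝ) : ℝ := ∫ s in (0:ℝ)..x, L.W u s

/-- `Γ(w,t) = ∫_w^∞ (z/t) P{X_t ∈ dz}`. -/
def Gam (w t : ℝ) : ℝ := ∫ z in Ici w, z / t ∂ L.law t

/-- `P_{|w}{τ_a^- ≤ r}`: probability that the drawdown started at level `w`
passes below `a` by time `r`. -/
def probMinusLe (w a r : ℝ) : ℝ :=
  (L.P w 0 {ω | ω ∈ L.hitMinus w a ∧ L.tauMinus w a ω ≤ r}).toReal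

/-- `E_{|w}[exp (-u τ_a^-) 1_{τ_a^- ≤ r}]`. -/
def expMinus (w a u r : ℝ) : ℝ :=
  ∫ ω in {ω | ω ∈ L.hitMinus w a ∧ L.tauMinus w a ω ≤ r},
    Real.exp (-u * L.tauMinus w a ω) ∂ L.P w 0

/-- Laplace exponent `ψ_ν(λ) = ψ(λ + ν) - ψ(ν)` of `X` under the Esscher transform `P^ν`. -/
def psiNu (ν lam : ℝ) : ℝ := L.psi (lam + ν) - L.psi ν

/-- Right-continuous inverse of `ψ_ν`. -/
def PhiNu (ν θ : ℝ) : ℝ := sSup {p | 0 < p ∧ L.psiNu ν p = θ}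

/-- The law of `X_t` under the Esscher transform
`dP^ν/dP|_{F_t} = exp (ν X_t - ψ(ν) t)`. -/
def lawNu (ν t : ℝ) : Measure ℝ :=
  (L.law t).withDensity fun z => ENNReal.ofReal (Real.exp (ν * z - L.psi ν * t))

/-- `Ω_ν`-type functional built from an arbitrary scale function `Wf` of the tilted
process: `∫_0^∞ Wf(z + x) (z/t) P^ν{X_t ∈ dz}`. -/
def OmW (Wf : ℝ → ℝ) (ν x t : ℝ) : ℝ := ∫ z in Ici (0:ℝ), Wf (z + x) * (z / t) ∂ L.lawNu ν t

/-- `Λ_ν`-type functional: `∫_0^∞ Wf′(z + x) (z/t) P^ν{X_t ∈ dz}`. -/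
def LamW (Wf : ℝ → ℝ) (ν x t : ℝ) : ℝ :=
  ∫ z in Ici (0:ℝ), deriv Wf (z + x) * (z / t) ∂ L.lawNu ν t

end SNLevy


namespace Kend
open ProbabilityTheory Complex
open scoped Topology ENNReal

lemma kernel_exists : ∃ (τ : Measure ℝ) (φ : ℝ → ℝ), IsFiniteMeasure τ ∧ Continuous φ ∧
    (∀ x, charFun τ x = (φ x : ℂ)) ∧ (∀ x, 0 < φ x) ∧ (∀ x, φ x ≤ 4 * (1 + x ^ 2)⁻¹) ∧
    (∀ᵐ θ ∂τ, θ ∈ Icc (-1:ℝ) 1) := by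
  set ρ : Measure ℝ := (volume.restrict (Icc (0:ℝ) 1)).withDensity
    (fun θ => ENNReal.ofReal (Real.exp (-θ))) with hρ
  have hfin : IsFiniteMeasure ρ := by
    rw [hρ]
    apply isFiniteMeasure_withDensity_ofReal
    exact ((by fun_prop : Continuous fun θ : ℝ => Real.exp (-θ)).integrableOn_Icc).2
  have hchar : ∀ x : ℝ, charFun ρ x = (1 - cexp (-1 + x * I)) / (1 - x * I) := by
    intro x
    rw [charFun_apply_real, hρ, integral_withDensity_eq_integral_toReal_smul (by fun_prop)
      (by simp)]
    have h1 : ∀ θ : ℝ, (ENNReal.ofReal (Real.exp (-θ))).toReal • cexp (x * θ * I)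
        = cexp ((-1 + x * I) * θ) := by
      intro θ
      rw [ENNReal.toReal_ofReal (Real.exp_pos _).le, Complex.real_smul, Complex.ofReal_exp,
        ← Complex.exp_add]
      congr 1
      push_cast
      ring
    simp_rw [h1]
    rw [integral_Icc_eq_integral_Ioc, ← intervalIntegral.integral_of_le zero_le_one]
    have hne : (-1 + x * I : ℂ) ≠ 0 := by
      intro h
      have := congrArg Complex.re h
      simp at this
    rw [integral_exp_mul_complex hne]
    have hne' : (1 - x * I : ℂ) ≠ 0 := by
      intro h; apply hne; linear_combination -h
    simp
    field_simp
    ring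
  have hsupp : ∀ᵐ θ ∂ρ, θ ∈ Icc (0:ℝ) 1 := by
    rw [hρ]
    exact (withDensity_absolutelyContinuous _ _).ae_le (ae_restrict_mem measurableSet_Icc)
  have hden : ∀ x : ℝ, Complex.normSq (1 - x * I) = 1 + x ^ 2 := by
    intro x; simp [Complex.normSq_apply]; ring
  refine ⟨Measure.conv ρ (ρ.map (fun θ => -θ)), fun x => Complex.normSq (charFun ρ x), ?_, ?_, ?_, ?_, ?_, ?_⟩
  · have : IsFiniteMeasure (ρ.map (fun θ => -θ)) := by infer_instance
    infer_instance
  · simp_rw [hchar]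
    refine Complex.continuous_normSq.comp (Continuous.div (by fun_prop) (by fun_prop) ?_)
    intro x h
    have := congrArg Complex.re h
    simp at this
  · intro x
    rw [charFun_conv]
    have : charFun (ρ.map (fun θ => -θ)) x = (starRingEnd ℂ) (charFun ρ x) := by
      rw [← charFun_neg, charFun_apply_real, charFun_apply_real, integral_map (by fun_prop) (by fun_prop)]
      simp
    rw [this, Complex.mul_conj]
  · intro x
    rw [Complex.normSq_pos, hchar]
    refine div_ne_zero ?_ ?_
    · intro h
      have h2 : cexp (-1 + x * I) = 1 := by linear_combination -h
      have := congrArg norm h2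
      rw [Complex.norm_exp] at this
      simp at this
    · intro h
      have := congrArg Complex.re h
      simp at this
  · intro x
    simp only
    rw [hchar, Complex.normSq_div, hden, div_eq_mul_inv]
    gcongr
    rw [Complex.normSq_eq_norm_sq]
    have : ‖1 - cexp (-1 + x * I)‖ ≤ 2 := by
      refine (norm_sub_le _ _).trans ?_
      rw [Complex.norm_exp]
      simp
      linarith [Real.exp_le_one_iff.mpr (by norm_num : (-1:ℝ) ≤ 0)]
    nlinarith [norm_nonneg (1 - cexp (-1 + x * I))]
  · have hs2 : ∀ᵐ θ ∂(ρ.map (fun θ => -θ)), θ ∈ Icc (-1:ℝ) 0 := by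
      rw [ae_map_iff (by fun_prop) (by exact measurableSet_Icc)]
      filter_upwards [hsupp] with θ h
      simp only [mem_Icc] at *
      constructor <;> linarith
    unfold Measure.conv
    rw [ae_map_iff (by fun_prop) (by exact measurableSet_Icc)]
    have ha := Measure.quasiMeasurePreserving_fst (μ := ρ) (ν := ρ.map (fun θ => -θ)) |>.ae hsupp
    have hb := Measure.quasiMeasurePreserving_snd (μ := ρ) (ν := ρ.map (fun θ => -θ)) |>.ae hs2
    filter_upwards [ha, hb] with p h1 h2
    simp only [mem_Icc] at *
    constructor <;> linarith

lemma strip_eq {f g : ℂ → ℂ} {l r : ℝ}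
    (hf : AnalyticOnNhd ℂ f {z | z.re ∈ Ioo l r}) (hg : AnalyticOnNhd ℂ g {z | z.re ∈ Ioo l r})
    (h : ∀ x ∈ Ioo l r, f (x:ℝ) = g (x:ℝ)) : EqOn f g {z | z.re ∈ Ioo l r} := by
  rcases le_or_gt r l with hlr | hlr
  · intro z hz
    simp [Ioo_eq_empty (not_lt.mpr hlr)] at hz
  set t := (l + r) / 2
  have ht : t ∈ Ioo l r := ⟨by simp only [t]; linarith, by simp only [t]; linarith⟩
  refine AnalyticOnNhd.eqOn_of_preconnected_of_frequently_eq hf hg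
    ((convex_Ioo l r).linear_preimage reLm).isPreconnected
    (z₀ := (t : ℂ)) (by simpa using ht) ?_
  have h_real : ∃ᶠ (x : ℝ) in 𝓝[≠] t, f x = g x := by
    apply Filter.Eventually.frequently
    filter_upwards [nhdsWithin_le_nhds (Ioo_mem_nhds ht.1 ht.2)] with x hx using h x hx
  rw [frequently_iff_seq_forall] at h_real ⊢
  obtain ⟨xs, hx_tendsto, hx_eq⟩ := h_real
  refine ⟨fun n ↦ xs n, ?_, fun n ↦ ?_⟩
  · rw [tendsto_nhdsWithin_iff] at hx_tendsto ⊢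
    constructor
    · rw [tendsto_ofReal_iff]
      exact hx_tendsto.1
    · simpa using hx_tendsto.2
  · simp [hx_eq]

lemma Ioo_sub_interior {ν : Measure ℝ} {l r : ℝ}
    (h : ∀ s ∈ Ioo l r, Integrable (fun x => Real.exp (s * x)) ν) :
    Ioo l r ⊆ interior (integrableExpSet id ν) :=
  interior_maximal (fun s hs => h s hs) isOpen_Ioo

lemma analytic_strip {ν : Measure ℝ} {l r : ℝ}
    (h : ∀ s ∈ Ioo l r, Integrable (fun x => Real.exp (s * x)) ν) :
    AnalyticOnNhd ℂ (complexMGF id ν) {z | z.re ∈ Ioo l r} :=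
  analyticOnNhd_complexMGF.mono (fun _ hz => Ioo_sub_interior h hz)

lemma ext_of_mgf {μ ν : Measure ℝ} [IsFiniteMeasure μ] [IsFiniteMeasure ν] {δ : ℝ} (hδ : 0 < δ)
    (hμ : ∀ s ∈ Ioo (-δ) δ, Integrable (fun x => Real.exp (s * x)) μ)
    (hν : ∀ s ∈ Ioo (-δ) δ, Integrable (fun x => Real.exp (s * x)) ν)
    (h : ∀ s ∈ Ioo (-δ) δ, ∫ x, Real.exp (s * x) ∂μ = ∫ x, Real.exp (s * x) ∂ν) : μ = ν := by
  have h1 := strip_eq (analytic_strip hμ) (analytic_strip hν) (fun x hx => by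
    rw [complexMGF_ofReal, complexMGF_ofReal]
    have := h x hx
    simp only [mgf, id]
    rw [this])
  apply Measure.ext_of_charFun
  ext θ
  rw [← complexMGF_id_mul_I, ← complexMGF_id_mul_I]
  apply h1
  simp [hδ]

/-- Fubini for the kernel. -/
lemma fubini_kernel (τ : Measure ℝ) [IsFiniteMeasure τ] (ν : Measure ℝ) [SFinite ν] (z : ℂ)
    (h : Integrable (fun x => Real.exp (z.re * x)) ν) :
    ∫ x, charFun τ x * cexp (z * x) ∂ν = ∫ θ, complexMGF id ν (z + θ * I) ∂τ := by
  simp_rw [charFun_apply_real, complexMGF, ← integral_mul_const]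
  rw [integral_integral_swap]
  · congr 1; ext θ; congr 1; ext x
    rw [← Complex.exp_add]; congr 1
    simp only [id]; ring
  · have : Integrable (fun p : ℝ × ℝ => Real.exp (z.re * p.1) * 1) (ν.prod τ) :=
      Integrable.mul_prod (f := fun x => Real.exp (z.re * x)) (g := fun _ => (1:ℝ)) h (integrable_const 1)
    refine this.mono' ?_ ?_
    · apply Measurable.aestronglyMeasurable
      unfold Function.uncurry
      fun_prop
    · refine Eventually.of_forall fun p => ?_
      simp only [Function.uncurry]
      rw [norm_mul, Complex.norm_exp, Complex.norm_exp]
      simp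

end Kend


namespace Kend
open ProbabilityTheory Complex
open scoped Topology ENNReal

lemma fubini_int (τ : Measure ℝ) [IsFiniteMeasure τ] (ν : Measure ℝ) [SFinite ν] (z : ℂ)
    (h : Integrable (fun x => Real.exp (z.re * x)) ν) :
    Integrable (fun θ : ℝ => complexMGF id ν (z + θ * I)) τ := by
  have h1 : Integrable (fun p : ℝ × ℝ => Real.exp (z.re * p.1) * 1) (ν.prod τ) :=
    Integrable.mul_prod (f := fun x => Real.exp (z.re * x)) (g := fun _ => (1:ℝ)) h (integrable_const 1)
  have h2 : Integrable (fun p : ℝ × ℝ => cexp ((z + p.2 * I) * p.1)) (ν.prod τ) := by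
    refine h1.mono' (by apply Measurable.aestronglyMeasurable; fun_prop) ?_
    refine Eventually.of_forall fun p => ?_
    rw [Complex.norm_exp]
    simp
  exact h2.integral_prod_right

lemma lim_T (φ : ℝ → ℝ) (hφc : Continuous φ) (hφ0 : ∀ x, 0 < φ x) (hφ4 : ∀ x, φ x ≤ 4)
    (ν : Measure ℝ) (c : ℕ → ℝ) (hc : Tendsto c atTop (𝓝 0)) (d : ℝ)
    (hd : Integrable (fun x => Real.exp (d * x)) ν) (hcd : ∀ n, c n ∈ uIcc 0 d)
    (hφν : Integrable φ ν) (η : ℝ) :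
    Tendsto (fun n => ∫ x, (φ x : ℂ) * cexp (((c n : ℝ) + η * I : ℂ) * x) ∂ν) atTop
      (𝓝 (∫ x, (φ x : ℂ) * cexp ((η * I) * x) ∂ν)) := by
  refine tendsto_integral_of_dominated_convergence (fun x => φ x + 4 * Real.exp (d * x))
    (fun n => ?_) (hφν.add (hd.const_mul 4)) (fun n => ?_) ?_
  · apply Continuous.aestronglyMeasurable; fun_prop
  · refine Eventually.of_forall fun x => ?_
    rw [norm_mul, Complex.norm_exp, Complex.norm_real, Real.norm_of_nonneg (hφ0 x).le]
    have : (((c n : ℝ) + η * I : ℂ) * x).re = c n * x := by simp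
    rw [this]
    have h1 : Real.exp (c n * x) ≤ 1 + Real.exp (d * x) := by
      have h2 : c n * x ≤ 0 ∨ c n * x ≤ d * x := by
        have := hcd n
        rw [mem_uIcc] at this
        rcases le_total 0 x with hx | hx <;> rcases this with ⟨a, b⟩ | ⟨a, b⟩
        · right; nlinarith
        · left; nlinarith
        · left; nlinarith
        · right; nlinarith
      rcases h2 with h2 | h2
      · have := Real.exp_le_one_iff.mpr h2
        linarith [Real.exp_pos (d * x)]
      · have := Real.exp_le_exp.mpr h2
        linarith
    have := Real.exp_pos (d * x)
    nlinarith [hφ0 x, hφ4 x]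
  · refine Eventually.of_forall fun x => ?_
    have : Tendsto (fun n => (φ x : ℂ) * cexp (((c n : ℝ) + η * I : ℂ) * x)) atTop
      (𝓝 ((φ x : ℂ) * cexp ((((0:ℝ):ℂ) + η * I : ℂ) * x))) := by
      refine Tendsto.const_mul _ ?_
      refine (Complex.continuous_exp.tendsto _).comp ?_
      refine Tendsto.mul_const _ (Tendsto.add_const _ ?_)
      exact (Complex.continuous_ofReal.tendsto _).comp hc
    simpa using this

lemma fatou_T (φ : ℝ → ℝ) (hφc : Continuous φ) (hφ0 : ∀ x, 0 < φ x)
    (ν : Measure ℝ) (c : ℕ → ℝ) (hc : Tendsto c atTop (𝓝 0))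
    (hi : ∀ n, Integrable (fun x => φ x * Real.exp (c n * x)) ν) (C : ℝ)
    (hC : ∀ n, ∫ x, φ x * Real.exp (c n * x) ∂ν ≤ C) : Integrable φ ν := by
  refine ⟨hφc.aestronglyMeasurable, ?_⟩
  rw [hasFiniteIntegral_iff_ofReal (Eventually.of_forall fun x => (hφ0 x).le)]
  have h1 : ∀ n, ∫⁻ x, ENNReal.ofReal (φ x * Real.exp (c n * x)) ∂ν ≤ ENNReal.ofReal C := by
    intro n
    rw [← ofReal_integral_eq_lintegral_ofReal (hi n)
      (Eventually.of_forall fun x => (mul_pos (hφ0 x) (Real.exp_pos _)).le)]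
    exact ENNReal.ofReal_le_ofReal (hC n)
  have h2 : ∀ x, liminf (fun n => ENNReal.ofReal (φ x * Real.exp (c n * x))) atTop
      = ENNReal.ofReal (φ x) := by
    intro x
    apply Tendsto.liminf_eq
    apply ENNReal.tendsto_ofReal
    have : Tendsto (fun n => φ x * Real.exp (c n * x)) atTop (𝓝 (φ x * Real.exp (0 * x))) :=
      Tendsto.const_mul _ ((Real.continuous_exp.tendsto _).comp (hc.mul_const _))
    simpa using this
  calc ∫⁻ x, ENNReal.ofReal (φ x) ∂ν
      = ∫⁻ x, liminf (fun n => ENNReal.ofReal (φ x * Real.exp (c n * x))) atTop ∂ν := by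
        simp_rw [h2]
    _ ≤ liminf (fun n => ∫⁻ x, ENNReal.ofReal (φ x * Real.exp (c n * x)) ∂ν) atTop :=
        lintegral_liminf_le (fun n => by fun_prop)
    _ ≤ ENNReal.ofReal C := by
        refine (liminf_le_liminf (Eventually.of_forall h1)).trans ?_
        simp
    _ < ∞ := ENNReal.ofReal_lt_top

lemma key2 (μ1 μ2 : Measure ℝ) [SFinite μ1] [SFinite μ2] (δ : ℝ) (hδ : 0 < δ) (a : ℝ) (ha : 0 ≤ a)
    (R : ℂ → ℂ) (hR : ContinuousOn R {z | z.re ∈ Ioo (-δ) δ})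
    (h1 : ∀ s ∈ Ioo (-δ) 0, Integrable (fun x => Real.exp (s * x)) μ1)
    (h2 : ∀ s ∈ Ioo 0 δ, Integrable (fun x => Real.exp (s * x)) μ2)
    (e1 : ∀ z : ℂ, z.re ∈ Ioo (-δ) 0 → complexMGF id μ1 z = R z - a / z)
    (e2 : ∀ z : ℂ, z.re ∈ Ioo 0 δ → complexMGF id μ2 z = - R z + a / z) :
    μ1 + μ2 = ENNReal.ofReal a • volume := by
  obtain ⟨τ, φ, hτ, hφc, hτφ, hφ0, hφ1, hτs⟩ := kernel_exists
  have hφ4 : ∀ x, φ x ≤ 4 := by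
    intro x
    refine (hφ1 x).trans ?_
    have : (1 + x ^ 2)⁻¹ ≤ 1 := inv_le_one_of_one_le₀ (by nlinarith)
    linarith
  have hφvol : Integrable φ volume := by
    refine (integrable_inv_one_add_sq.const_mul 4).mono' hφc.aestronglyMeasurable ?_
    refine Eventually.of_forall fun x => ?_
    rw [Real.norm_of_nonneg (hφ0 x).le]; exact hφ1 x
  set ε : ℕ → ℝ := fun n => (δ / 2) * (1 / ((n:ℝ) + 1)) with hε
  have hεlim : Tendsto ε atTop (𝓝 0) := by
    have := tendsto_one_div_add_atTop_nhds_zero_nat (𝕜 := ℝ)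
    have h5 := this.const_mul (δ / 2)
    rw [mul_zero] at h5
    exact h5
  have hεpos : ∀ n, 0 < ε n := fun n => by simp only [hε]; positivity
  have hεle : ∀ n, ε n ≤ δ / 2 := fun n => by
    simp only [hε]
    have : 1 / ((n:ℝ) + 1) ≤ 1 := by
      rw [div_le_one (by positivity)]; linarith [(Nat.cast_nonneg n : (0:ℝ) ≤ n)]
    nlinarith
  have hεlim' : Tendsto (fun n => - ε n) atTop (𝓝 0) := by simpa using hεlim.neg
  set v1 : Measure ℝ := volume.restrict (Ioi 0)
  set v2 : Measure ℝ := volume.restrict (Iic 0)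
  have hv1 : ∀ s < 0, Integrable (fun x => Real.exp (s * x)) v1 :=
    fun s hs => integrableOn_exp_mul_Ioi hs 0
  have hv2 : ∀ s > 0, Integrable (fun x => Real.exp (s * x)) v2 :=
    fun s hs => integrableOn_exp_mul_Iic hs 0
  have f1 : ∀ z : ℂ, z.re < 0 → complexMGF id v1 z = - 1 / z := by
    intro z hz
    simp only [complexMGF, id, v1]
    rw [integral_exp_mul_complex_Ioi hz]; simp
  have f2 : ∀ z : ℂ, 0 < z.re → complexMGF id v2 z = 1 / z := by
    intro z hz
    simp only [complexMGF, id, v2]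
    rw [integral_exp_mul_complex_Iic hz]; simp
  let T : Measure ℝ → ℝ → ℝ → ℂ := fun ν c η =>
    ∫ x, (φ x : ℂ) * cexp (((c : ℝ) + η * I : ℂ) * x) ∂ν
  -- the basic identity
  have hbasic : ∀ n η, T μ1 (-ε n) η + T μ2 (ε n) η - a * (T v1 (-ε n) η + T v2 (ε n) η)
      = ∫ θ : ℝ, (R (((-ε n : ℝ) + η * I : ℂ) + θ * I) - R (((ε n : ℝ) + η * I : ℂ) + θ * I)) ∂τ := by
    intro n η
    have hm1 : -ε n ∈ Ioo (-δ) 0 := ⟨by linarith [hεle n], by linarith [hεpos n]⟩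
    have hm2 : ε n ∈ Ioo 0 δ := ⟨hεpos n, by linarith [hεle n]⟩
    have r1 : (((-ε n : ℝ) + η * I : ℂ)).re = -ε n := by simp
    have r2 : (((ε n : ℝ) + η * I : ℂ)).re = ε n := by simp
    have i1 := h1 _ hm1
    have i2 := h2 _ hm2
    have i3 := hv1 _ hm1.2
    have i4 := hv2 _ hm2.1
    rw [← r1] at i1 i3
    rw [← r2] at i2 i4
    simp only [T, ← hτφ]
    rw [fubini_kernel τ μ1 _ i1, fubini_kernel τ μ2 _ i2, fubini_kernel τ v1 _ i3,
      fubini_kernel τ v2 _ i4]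
    have j1 := fubini_int τ μ1 _ i1
    have j2 := fubini_int τ μ2 _ i2
    have j3 := fubini_int τ v1 _ i3
    have j4 := fubini_int τ v2 _ i4
    have j12 := j1.add j2
    have j34 := (j3.add j4).const_mul (a:ℂ)
    rw [← integral_add j1 j2, ← integral_add j3 j4, ← integral_const_mul]
    refine (integral_sub j12 j34).symm.trans ?_
    congr 1; ext θ
    have s1 : ((((-ε n : ℝ) + η * I : ℂ)) + θ * I).re = -ε n := by simp
    have s2 : ((((ε n : ℝ) + η * I : ℂ)) + θ * I).re = ε n := by simp
    simp only [Pi.add_apply]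
    rw [e1 _ (by rw [s1]; exact hm1), e2 _ (by rw [s2]; exact hm2), f1 _ (by rw [s1]; exact hm1.2),
      f2 _ (by rw [s2]; exact hm2.1)]
    ring
  have hRlim : ∀ η : ℝ, Tendsto (fun n => T μ1 (-ε n) η + T μ2 (ε n) η
      - a * (T v1 (-ε n) η + T v2 (ε n) η)) atTop (𝓝 0) := by
    intro η
    simp_rw [hbasic]
    obtain ⟨C, hC⟩ := (IsCompact.reProdIm (isCompact_Icc (a := -(δ/2)) (b := δ/2))
      (isCompact_Icc (a := η - 1) (b := η + 1))).exists_bound_of_continuousOn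
      (hR.mono (fun z hz => by
        have := (Complex.mem_reProdIm.mp hz).1
        exact ⟨by linarith [this.1], by linarith [this.2]⟩))
    have hmem : ∀ _ : ℕ, ∀ θ ∈ Icc (-1:ℝ) 1, ∀ c : ℝ, |c| ≤ δ / 2 →
        (((c : ℝ) + η * I : ℂ) + θ * I) ∈ (Icc (-(δ/2)) (δ/2) ×ℂ Icc (η - 1) (η + 1)) := by
      intro _ θ hθ c hc
      rw [Complex.mem_reProdIm]
      have := abs_le.mp hc
      simp only [mem_Icc] at *
      simp
      refine ⟨this, ?_, ?_⟩ <;> linarith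
    have hcontθ : ∀ c : ℝ, |c| ≤ δ / 2 → Continuous (fun θ : ℝ => R (((c : ℝ) + η * I : ℂ) + θ * I)) := by
      intro c hc
      rw [← continuousOn_univ]
      refine hR.comp (by fun_prop) ?_
      intro θ _
      have := abs_le.mp hc
      simp
      constructor <;> linarith
    have habs : ∀ n, |ε n| ≤ δ / 2 := fun n => by rw [abs_of_pos (hεpos n)]; exact hεle n
    have habs' : ∀ n, |-ε n| ≤ δ / 2 := fun n => by rw [abs_neg]; exact habs n
    have := tendsto_integral_of_dominated_convergence (μ := τ) (f := fun _ => (0:ℂ))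
      (F := fun n θ => R (((-ε n : ℝ) + η * I : ℂ) + θ * I) - R (((ε n : ℝ) + η * I : ℂ) + θ * I))
      (fun _ => C + C) (fun n => ((hcontθ _ (habs' n)).sub (hcontθ _ (habs n))).aestronglyMeasurable)
      (integrable_const _) (fun n => ?_) ?_
    · simpa using this
    · filter_upwards [hτs] with θ hθ
      exact (norm_sub_le _ _).trans (add_le_add (hC _ (hmem n θ hθ _ (habs' n)))
        (hC _ (hmem n θ hθ _ (habs n))))
    · refine Eventually.of_forall fun θ => ?_
      have hopen : IsOpen {z : ℂ | z.re ∈ Ioo (-δ) δ} := isOpen_Ioo.preimage Complex.continuous_re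
      have hat : ContinuousAt R ((((0:ℝ):ℂ) + η * I : ℂ) + θ * I) :=
        hR.continuousAt (hopen.mem_nhds (by simp [hδ]))
      have t1 : ∀ c : ℕ → ℝ, Tendsto c atTop (𝓝 0) →
          Tendsto (fun n => R (((c n : ℝ) + η * I : ℂ) + θ * I)) atTop
            (𝓝 (R ((((0:ℝ):ℂ) + η * I : ℂ) + θ * I))) := by
        intro c hc
        refine hat.tendsto.comp ?_
        refine Tendsto.add_const _ (Tendsto.add_const _ ?_)
        exact (Complex.continuous_ofReal.tendsto _).comp hc
      simpa using (t1 _ hεlim').sub (t1 _ hεlim)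
  have hu1 : ∀ n, -ε n ∈ uIcc 0 (-(δ/2)) := fun n => by
    rw [mem_uIcc]; right; exact ⟨by linarith [hεle n], by linarith [hεpos n]⟩
  have hu2 : ∀ n, ε n ∈ uIcc 0 ((δ/2)) := fun n => by
    rw [mem_uIcc]; left; exact ⟨(hεpos n).le, hεle n⟩
  have hT1 : ∀ η, Tendsto (fun n => T v1 (-ε n) η) atTop _ := fun η =>
    lim_T φ hφc hφ0 hφ4 v1 _ hεlim' (-(δ/2)) (hv1 _ (by linarith)) hu1 hφvol.restrict η
  have hT2 : ∀ η, Tendsto (fun n => T v2 (ε n) η) atTop _ := fun η =>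
    lim_T φ hφc hφ0 hφ4 v2 _ hεlim (δ/2) (hv2 _ (by linarith)) hu2 hφvol.restrict η
  have hTsum : ∀ η, Tendsto (fun n => T μ1 (-ε n) η + T μ2 (ε n) η) atTop
      (𝓝 (a * (∫ x, (φ x : ℂ) * cexp ((η * I) * x) ∂v1 + ∫ x, (φ x : ℂ) * cexp ((η * I) * x) ∂v2))) := by
    intro η
    have := (hRlim η).add (((hT1 η).add (hT2 η)).const_mul (a:ℂ))
    simpa using this
  -- integrability of φ
  have hint : ∀ (ν : Measure ℝ) (c : ℝ), Integrable (fun x => Real.exp (c * x)) ν →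
      Integrable (fun x => φ x * Real.exp (c * x)) ν := by
    intro ν c h
    refine (h.const_mul 4).mono' (hφc.aestronglyMeasurable.mul h.aestronglyMeasurable) ?_
    refine Eventually.of_forall fun x => ?_
    rw [Real.norm_of_nonneg (mul_pos (hφ0 x) (Real.exp_pos _)).le]
    exact mul_le_mul_of_nonneg_right (hφ4 x) (Real.exp_pos _).le
  have hTreal : ∀ ν c, T ν c 0 = ((∫ x, φ x * Real.exp (c * x) ∂ν : ℝ) : ℂ) := by
    intro ν c
    simp only [T]
    rw [← integral_complex_ofReal]
    congr 1; ext x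
    simp
  have hbd : ∃ C : ℝ, ∀ n, ‖T μ1 (-ε n) 0 + T μ2 (ε n) 0‖ ≤ C := by
    obtain ⟨C, hC⟩ := (hTsum 0).norm.bddAbove_range
    exact ⟨C, fun n => hC ⟨n, rfl⟩⟩
  obtain ⟨C, hC⟩ := hbd
  have hnn : ∀ (ν : Measure ℝ) (c : ℝ), 0 ≤ ∫ x, φ x * Real.exp (c * x) ∂ν := fun ν c =>
    integral_nonneg fun x => (mul_pos (hφ0 x) (Real.exp_pos _)).le
  have hCr : ∀ n, (∫ x, φ x * Real.exp (-ε n * x) ∂μ1) + (∫ x, φ x * Real.exp (ε n * x) ∂μ2) ≤ C := by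
    intro n
    have := hC n
    rw [hTreal, hTreal, ← Complex.ofReal_add, Complex.norm_real] at this
    exact (le_abs_self _).trans this
  have hI1 : ∀ n, Integrable (fun x => Real.exp (-ε n * x)) μ1 := fun n =>
    h1 _ ⟨by linarith [hεle n], by linarith [hεpos n]⟩
  have hI2 : ∀ n, Integrable (fun x => Real.exp (ε n * x)) μ2 := fun n =>
    h2 _ ⟨hεpos n, by linarith [hεle n]⟩
  have hφ1' : Integrable φ μ1 := fatou_T φ hφc hφ0 μ1 _ hεlim' (fun n => hint _ _ (hI1 n)) C
    (fun n => by linarith [hCr n, hnn μ2 (ε n)])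
  have hφ2' : Integrable φ μ2 := fatou_T φ hφc hφ0 μ2 _ hεlim (fun n => hint _ _ (hI2 n)) C
    (fun n => by linarith [hCr n, hnn μ1 (-ε n)])
  have hfinal : ∀ η : ℝ, ∫ x, (φ x : ℂ) * cexp ((η * I) * x) ∂(μ1 + μ2)
      = a * ∫ x, (φ x : ℂ) * cexp ((η * I) * x) := by
    intro η
    have t1 := lim_T φ hφc hφ0 hφ4 μ1 _ hεlim' (-(δ/2)) (h1 _ ⟨by linarith, by linarith⟩) hu1 hφ1' η
    have t2 := lim_T φ hφc hφ0 hφ4 μ2 _ hεlim ((δ/2)) (h2 _ ⟨by linarith, by linarith⟩) hu2 hφ2' η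
    have hii : ∀ ν : Measure ℝ, Integrable φ ν → Integrable (fun x : ℝ => (φ x : ℂ) * cexp ((η * I) * x)) ν := by
      intro ν h
      refine h.mono' ?_ ?_
      · apply Continuous.aestronglyMeasurable; fun_prop
      · refine Eventually.of_forall fun x => ?_
        rw [norm_mul, Complex.norm_exp, Complex.norm_real, Real.norm_of_nonneg (hφ0 x).le]
        simp
    rw [integral_add_measure (hii _ hφ1') (hii _ hφ2')]
    rw [tendsto_nhds_unique (t1.add t2) (hTsum η)]
    congr 1
    rw [add_comm]
    have := integral_add_compl (μ := volume) (measurableSet_Iic (a := (0:ℝ))) (hii _ hφvol)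
    rw [compl_Iic] at this
    exact this
  -- conclude
  have hmφ : Measurable (fun x => ENNReal.ofReal (φ x)) := by fun_prop
  have hsum : Integrable φ (μ1 + μ2) := hφ1'.add_measure hφ2'
  have hav : Integrable φ (ENNReal.ofReal a • volume) := hφvol.smul_measure (by simp)
  have hcf : ∀ (ν : Measure ℝ) (η : ℝ), charFun (ν.withDensity (fun x => ENNReal.ofReal (φ x))) η
      = ∫ x, (φ x : ℂ) * cexp ((η * I) * x) ∂ν := by
    intro ν η
    rw [charFun_apply_real, integral_withDensity_eq_integral_toReal_smul (by fun_prop) (by simp)]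
    congr 1; ext x
    rw [ENNReal.toReal_ofReal (hφ0 x).le, Complex.real_smul]
    congr 2; ring
  have hwd : (μ1 + μ2).withDensity (fun x => ENNReal.ofReal (φ x))
      = (ENNReal.ofReal a • volume).withDensity (fun x => ENNReal.ofReal (φ x)) := by
    have q1 := isFiniteMeasure_withDensity_ofReal hsum.2
    have q2 := isFiniteMeasure_withDensity_ofReal hav.2
    apply Measure.ext_of_charFun
    ext η
    rw [hcf, hcf, hfinal, integral_smul_measure, ENNReal.toReal_ofReal ha, Complex.real_smul]
  have hne0 : ∀ x, ENNReal.ofReal (φ x) ≠ 0 := fun x => by simp [hφ0 x]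
  rw [← withDensity_inv_same (μ := μ1 + μ2) hmφ (Eventually.of_forall hne0) (by simp), hwd,
    withDensity_inv_same hmφ (Eventually.of_forall hne0) (by simp)]

lemma key (F μ1 μ2 : Measure ℝ) [IsProbabilityMeasure F] [SFinite μ1] [SFinite μ2]
    (δ : ℝ) (hδ : 0 < δ) (k : ℝ) (hk : 0 < k)
    (hF : ∀ s ∈ Ioo (-δ) δ, Integrable (fun x => Real.exp (s * x)) F)
    (h1 : ∀ s ∈ Ioo (-δ) 0, Integrable (fun x => Real.exp (s * x)) μ1)
    (h2 : ∀ s ∈ Ioo 0 δ, Integrable (fun x => Real.exp (s * x)) μ2)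
    (e1 : ∀ s ∈ Ioo (-δ) 0, mgf id μ1 s * (1 - mgf id F s) = k * mgf id F s)
    (e2 : ∀ s ∈ Ioo 0 δ, mgf id μ2 s * (1 - mgf id F s) = - (k * mgf id F s))
    (hm : 0 < ∫ x, x ∂F) (hchar : ∀ θ : ℝ, θ ≠ 0 → charFun F θ ≠ 1) :
    μ1 + μ2 = ENNReal.ofReal (k / ∫ x, x ∂F) • volume := by
  set m := ∫ x, x ∂F with hm_def
  set Fh : ℂ → ℂ := complexMGF id F with hFh
  have hopen : IsOpen {z : ℂ | z.re ∈ Ioo (-δ) δ} := isOpen_Ioo.preimage Complex.continuous_re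
  have hFa : AnalyticOnNhd ℂ Fh {z | z.re ∈ Ioo (-δ) δ} := analytic_strip hF
  have hFd : DifferentiableOn ℂ Fh {z | z.re ∈ Ioo (-δ) δ} := hFa.differentiableOn
  have hkc : (k:ℂ) ≠ 0 := by exact_mod_cast hk.ne'
  have s1 : ∀ z : ℂ, z.re ∈ Ioo (-δ) 0 → z.re ∈ Ioo (-δ) δ := fun z hz => ⟨hz.1, hz.2.trans hδ⟩
  have s2 : ∀ z : ℂ, z.re ∈ Ioo 0 δ → z.re ∈ Ioo (-δ) δ := fun z hz => ⟨by linarith [hz.1], hz.2⟩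
  have E1 : ∀ z : ℂ, z.re ∈ Ioo (-δ) 0 → complexMGF id μ1 z * (1 - Fh z) = k * Fh z := by
    refine strip_eq (f := fun z => complexMGF id μ1 z * (1 - Fh z)) (g := fun z => k * Fh z) ?_ ?_ ?_
    · exact (analytic_strip h1).mul (analyticOnNhd_const.sub (hFa.mono s1))
    · exact analyticOnNhd_const.mul (hFa.mono s1)
    · intro x hx
      simp only [hFh, complexMGF_ofReal]
      exact_mod_cast e1 x hx
  have E2 : ∀ z : ℂ, z.re ∈ Ioo 0 δ → complexMGF id μ2 z * (1 - Fh z) = -(k * Fh z) := by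
    refine strip_eq (f := fun z => complexMGF id μ2 z * (1 - Fh z)) (g := fun z => -(k * Fh z)) ?_ ?_ ?_
    · exact (analytic_strip h2).mul (analyticOnNhd_const.sub (hFa.mono s2))
    · exact (analyticOnNhd_const.mul (hFa.mono s2)).neg
    · intro x hx
      simp only [hFh, complexMGF_ofReal]
      exact_mod_cast e2 x hx
  have h0mem : (0:ℂ) ∈ {z : ℂ | z.re ∈ Ioo (-δ) δ} := by simp [hδ]
  have hnhds := hopen.mem_nhds h0mem
  set A : ℂ → ℂ := fun z => 1 - Fh z with hA
  have hA0 : A 0 = 0 := by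
    simp [hA, hFh, complexMGF]
  have hAd : DifferentiableOn ℂ A {z | z.re ∈ Ioo (-δ) δ} := hFd.const_sub 1
  have hA' : HasDerivAt A (-(m:ℂ)) 0 := by
    have hz : (0:ℂ).re ∈ interior (integrableExpSet id F) := Ioo_sub_interior hF h0mem
    have := hasDerivAt_complexMGF hz
    have h3 := this.const_sub 1
    have h4 : (m:ℂ) = F[fun ω => ((id ω : ℝ):ℂ) * cexp (0 * ((id ω : ℝ):ℂ))] := by
      simp only [id, zero_mul, Complex.exp_zero, mul_one]
      rw [hm_def, ← integral_complex_ofReal]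
    rw [h4]
    exact h3
  set B : ℂ → ℂ := dslope A 0 with hB
  have hBd : DifferentiableOn ℂ B {z | z.re ∈ Ioo (-δ) δ} :=
    (Complex.differentiableOn_dslope hnhds).mpr hAd
  have hAB : ∀ z, A z = z * B z := by
    intro z
    have := sub_smul_dslope A 0 z
    simp only [sub_zero, hA0, smul_eq_mul] at this
    exact this.symm
  have hB0 : B 0 = -(m:ℂ) := by rw [hB, dslope_same, hA'.deriv]
  have hBne : ∀ z : ℂ, z.re ∈ Ioo (-δ) δ → B z ≠ 0 := by
    intro z hz hBz
    by_cases hz0 : z = 0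
    · rw [hz0, hB0] at hBz
      have : m = 0 := by simpa using hBz
      exact hm.ne' this
    have hAz : 1 - Fh z = 0 := by have := hAB z; rw [hBz, mul_zero] at this; exact this
    have hF1 : Fh z = 1 := by linear_combination -hAz
    rcases lt_trichotomy z.re 0 with h | h | h
    · have := E1 z ⟨hz.1, h⟩
      rw [hAz, hF1] at this
      rw [mul_zero, mul_one] at this
      exact hkc this.symm
    · have hzI : z = (z.im : ℝ) * I := by apply Complex.ext <;> simp [h]
      have hne : z.im ≠ 0 := by
        intro h'; apply hz0; rw [hzI, h']; simp
      apply hchar z.im hne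
      rw [← complexMGF_id_mul_I, ← hzI]; exact hF1
    · have := E2 z ⟨h, hz.2⟩
      rw [hAz, hF1, mul_zero, mul_one] at this
      exact hkc (neg_eq_zero.mp this.symm)
  set K : ℂ → ℂ := fun z => k * Fh z / B z with hK
  have hKd : DifferentiableOn ℂ K {z | z.re ∈ Ioo (-δ) δ} :=
    (hFd.const_mul _).div hBd (fun z hz => hBne z hz)
  have hK0 : K 0 = -((k / m : ℝ):ℂ) := by
    have : Fh 0 = 1 := by have := hA0; simp only [hA] at this; linear_combination -this
    simp only [hK]
    rw [this, hB0]
    push_cast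
    rw [mul_one, div_neg]
  have hRd : DifferentiableOn ℂ (dslope K 0) {z | z.re ∈ Ioo (-δ) δ} :=
    (Complex.differentiableOn_dslope hnhds).mpr hKd
  have hRK : ∀ z : ℂ, z ≠ 0 → z.re ∈ Ioo (-δ) δ →
      dslope K 0 z - ((k/m : ℝ):ℂ) / z = k * Fh z / A z := by
    intro z hz hzs
    have h3 := sub_smul_dslope K 0 z
    simp only [sub_zero, hK0, smul_eq_mul, sub_neg_eq_add] at h3
    have h4 : dslope K 0 z = (K z + ((k/m : ℝ):ℂ)) / z := by
      rw [← h3]; field_simp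
    rw [h4, hAB z]
    have := hBne z hzs
    simp only [hK]
    field_simp
    ring
  have hAne : ∀ z : ℂ, z ≠ 0 → z.re ∈ Ioo (-δ) δ → A z ≠ 0 := fun z hz hzs => by
    rw [hAB]; exact mul_ne_zero hz (hBne z hzs)
  refine key2 μ1 μ2 δ hδ (k/m) (by positivity) (dslope K 0) hRd.continuousOn h1 h2 ?_ ?_
  · intro z hz
    have hz0 : z ≠ 0 := by rintro rfl; simp at hz
    rw [hRK z hz0 (s1 z hz), eq_div_iff (hAne z hz0 (s1 z hz))]
    exact E1 z hz
  · intro z hz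
    have hz0 : z ≠ 0 := by rintro rfl; simp at hz
    have : -dslope K 0 z + ((k/m : ℝ):ℂ) / z = -(k * Fh z / A z) := by
      rw [← hRK z hz0 (s2 z hz)]; ring
    rw [this, ← neg_div, eq_div_iff (hAne z hz0 (s2 z hz))]
    exact E2 z hz

end Kend


namespace Kend
open ProbabilityTheory
open scoped Topology ENNReal

lemma int_exp (L : SNLevy) {lam t : ℝ} (hl : 0 ≤ lam) (ht : 0 < t) :
    Integrable (fun ω => Real.exp (lam * L.X t ω)) (L.P 0 0) := by
  by_contra h
  have h1 := L.psi_def lam t hl ht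
  rw [integral_undef h] at h1
  exact (Real.exp_pos _).ne h1

lemma psi_zero (L : SNLevy) : L.psi 0 = 0 := by
  have := L.prob 0 0
  have h1 := L.psi_def 0 1 le_rfl one_pos
  simp at h1
  exact Real.exp_eq_one_iff _ |>.mp h1.symm

lemma psi_star (L : SNLevy) {θ p : ℝ} (h0 : 0 ≤ θ) (h1 : θ ≤ 1) (hp : 0 ≤ p) :
    L.psi (θ * p) ≤ θ * L.psi p := by
  have := L.prob 0 0
  have hle : ∀ ω, Real.exp (θ * p * L.X 1 ω) * Real.exp (-(θ * L.psi p)) ≤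
      θ * (Real.exp (p * L.X 1 ω) * Real.exp (-L.psi p)) + (1 - θ) := by
    intro ω
    rw [← Real.exp_add, ← Real.exp_add]
    have := convexOn_exp.2 (mem_univ (p * L.X 1 ω + -L.psi p)) (mem_univ 0) h0
      (sub_nonneg.mpr h1) (by ring)
    simp only [smul_eq_mul, mul_zero, add_zero, Real.exp_zero, mul_one] at this
    have e : θ * p * L.X 1 ω + -(θ * L.psi p) = θ * (p * L.X 1 ω + -L.psi p) := by ring
    rw [e]
    exact this
  have i1 : Integrable (fun ω => Real.exp (θ * p * L.X 1 ω) * Real.exp (-(θ * L.psi p))) (L.P 0 0) :=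
    (int_exp L (mul_nonneg h0 hp) one_pos).mul_const _
  have i2 : Integrable (fun ω => θ * (Real.exp (p * L.X 1 ω) * Real.exp (-L.psi p))) (L.P 0 0) :=
    ((int_exp L hp one_pos).mul_const _).const_mul _
  have h2 := integral_mono i1 (i2.add (integrable_const (1 - θ))) hle
  simp only [Pi.add_apply] at h2
  rw [integral_add i2 (integrable_const _), integral_mul_const, integral_const_mul,
    integral_mul_const, L.psi_def _ 1 (mul_nonneg h0 hp) one_pos, L.psi_def _ 1 hp one_pos,
    ← Real.exp_add, ← Real.exp_add] at h2
  simp at h2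
  linarith

lemma psi_cont (L : SNLevy) : ContinuousOn L.psi (Ioi 0) := by
  have h1 : ∀ x ∈ Ioi (0:ℝ), L.psi x = Real.log (mgf (L.X 1) (L.P 0 0) x) := by
    intro x hx
    rw [mgf, L.psi_def x 1 (le_of_lt hx) one_pos]
    simp
  refine ContinuousOn.congr (f := fun x => Real.log (mgf (L.X 1) (L.P 0 0) x)) ?_ h1
  have hsub : Ioi (0:ℝ) ⊆ interior (integrableExpSet (L.X 1) (L.P 0 0)) :=
    interior_maximal (fun s hs => int_exp L (le_of_lt hs) one_pos) isOpen_Ioi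
  refine ContinuousOn.log (continuousOn_mgf.mono hsub) ?_
  intro x hx
  rw [mgf, L.psi_def x 1 (le_of_lt hx) one_pos]
  exact (Real.exp_pos _).ne'

lemma psi_pos (L : SNLevy) : ∃ l > 0, 0 < L.psi l := by
  by_contra! hcon
  have := L.prob 0 0
  have hneg : ∀ t > 0, ∀ᵐ ω ∂ L.P 0 0, L.X t ω ≤ 0 := by
    intro t ht
    have h1 : ∀ n : ℕ, ∀ᵐ ω ∂ L.P 0 0, L.X t ω ≤ 1 / ((n:ℝ) + 1) := by
      intro n
      set ε : ℝ := 1 / ((n:ℝ) + 1)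
      have hε : 0 < ε := by positivity
      have hb : ∀ l > 0, (L.P 0 0).real {ω | ε ≤ L.X t ω} ≤ Real.exp (-l * ε) := by
        intro l hl
        have := measure_ge_le_exp_mul_mgf (X := L.X t) (μ := L.P 0 0) ε hl.le (int_exp L hl.le ht)
        rw [mgf, L.psi_def l t hl.le ht] at this
        refine this.trans ?_
        have : Real.exp (L.psi l * t) ≤ 1 := Real.exp_le_one_iff.mpr (by nlinarith [hcon l hl])
        nlinarith [Real.exp_pos (-l * ε)]
      have hz : (L.P 0 0).real {ω | ε ≤ L.X t ω} ≤ 0 := by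
        refine ge_of_tendsto' (f := fun n : ℕ => Real.exp (-((n:ℝ) + 1) * ε)) (x := atTop) ?_
          (fun n => hb _ (by positivity))
        refine Real.tendsto_exp_atBot.comp ?_
        have : Tendsto (fun n : ℕ => (n:ℝ) + 1) atTop atTop :=
          tendsto_atTop_add_const_right _ _ tendsto_natCast_atTop_atTop
        exact (tendsto_neg_atTop_atBot.comp this).atBot_mul_const hε
      have hz0 : (L.P 0 0) {ω | ε ≤ L.X t ω} = 0 := by
        have := le_antisymm hz measureReal_nonneg
        rwa [measureReal_eq_zero_iff] at this
      have : ∀ᵐ ω ∂ L.P 0 0, ¬ (ε ≤ L.X t ω) := by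
        rw [ae_iff]; simpa using hz0
      filter_upwards [this] with ω h
      exact (not_le.mp h).le
    filter_upwards [ae_all_iff.mpr h1] with ω h
    exact ge_of_tendsto' tendsto_one_div_add_atTop_nhds_zero_nat h
  have hinc : ∀ s t : ℝ, 0 ≤ s → s ≤ t → ∀ᵐ ω ∂ L.P 0 0, L.X t ω ≤ L.X s ω := by
    intro s t hs hst
    rcases hst.eq_or_lt with rfl | hlt
    · simp
    have h1 : ∀ᵐ ω ∂ L.P 0 0, L.X (t - s) ω - L.X 0 ω ∈ Iic (0:ℝ) := by
      filter_upwards [hneg (t - s) (by linarith), L.start 0 0] with ω a b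
      simp only [mem_Iic]; linarith
    have hm : ∀ a b, Measurable (fun ω => L.X a ω - L.X b ω) := fun a b => (L.meas a).sub (L.meas b)
    rw [← ae_map_iff (p := fun y => y ∈ Iic (0:ℝ)) (hm _ _).aemeasurable measurableSet_Iic,
      ← L.stat 0 0 s t hs hst,
      ae_map_iff (p := fun y => y ∈ Iic (0:ℝ)) (hm _ _).aemeasurable measurableSet_Iic] at h1
    filter_upwards [h1] with ω h
    simp only [mem_Iic] at h; linarith
  have hall : ∀ᵐ ω ∂ L.P 0 0, ∀ s t : ℚ, (0:ℝ) ≤ s → (s:ℝ) ≤ t → L.X t ω ≤ L.X s ω := by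
    rw [ae_all_iff]; intro s
    rw [ae_all_iff]; intro t
    by_cases h : (0:ℝ) ≤ s ∧ (s:ℝ) ≤ t
    · filter_upwards [hinc s t h.1 h.2] with ω h _ _ using h
    · refine Eventually.of_forall fun ω a b => absurd ⟨a, b⟩ h
  apply (L.nonMonotone 0 0).2
  filter_upwards [hall, L.cadlag 0 0] with ω h1 h2
  intro s hs t ht hst
  simp only [mem_Ici] at hs ht
  rcases hst.eq_or_lt with rfl | hlt
  · exact le_rfl
  -- rational approximation
  have happ : ∀ r : ℝ, ∃ v : ℕ → ℚ, (∀ n, r < v n) ∧ Tendsto (fun n => (v n : ℝ)) atTop (𝓝 r) := by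
    intro r
    have : ∀ n : ℕ, ∃ v : ℚ, r < v ∧ (v:ℝ) < r + 1 / ((n:ℝ) + 1) := fun n =>
      exists_rat_btwn (by have : (0:ℝ) < 1 / ((n:ℝ) + 1) := by positivity
                          linarith)
    choose v hv1 hv2 using this
    refine ⟨v, hv1, tendsto_of_tendsto_of_tendsto_of_le_of_le tendsto_const_nhds
      (h := fun n : ℕ => r + 1 / ((n:ℝ) + 1)) ?_ (fun n => (hv1 n).le) (fun n => (hv2 n).le)⟩
    simpa using tendsto_one_div_add_atTop_nhds_zero_nat.const_add r
  obtain ⟨a, ha1, ha2⟩ := happ s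
  obtain ⟨b, hb1, hb2⟩ := happ t
  have lim : ∀ (r : ℝ) (hr : 0 ≤ r) (v : ℕ → ℚ), (∀ n, r < v n) →
      Tendsto (fun n => (v n : ℝ)) atTop (𝓝 r) → Tendsto (fun n => L.X (v n) ω) atTop (𝓝 (L.X r ω)) := by
    intro r hr v hv hlim
    refine (h2 r hr).tendsto.comp ?_
    rw [tendsto_nhdsWithin_iff]
    exact ⟨hlim, Eventually.of_forall fun n => (hv n).le⟩
  refine le_of_tendsto_of_tendsto (lim t ht b hb1 hb2) (lim s hs a ha1 ha2) ?_
  filter_upwards [ha2.eventually_lt_const hlt] with n hn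
  exact h1 _ _ (hs.trans (ha1 n).le) (hn.trans (hb1 n)).le

lemma Phi_spec (L : SNLevy) {q : ℝ} (hq : 0 < q) : ∃ β > 0, L.psi β = q ∧ L.Phi q = β ∧
    (∀ l > β, q < L.psi l) ∧ (∀ l > 0, l < β → L.psi l < q) := by
  obtain ⟨p, hp, hpp⟩ := psi_pos L
  have low : ∀ a b, 0 < a → a ≤ b → L.psi a ≤ a / b * L.psi b := by
    intro a b ha hab
    have hb : 0 < b := ha.trans_le hab
    have := psi_star L (θ := a / b) (p := b) (by positivity) (by rw [div_le_one hb]; exact hab) hb.le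
    rwa [div_mul_cancel₀ _ hb.ne'] at this
  have low' : ∀ a b, 0 < a → a ≤ b → b * L.psi a ≤ a * L.psi b := by
    intro a b ha hab
    have := low a b ha hab
    have hb : 0 < b := ha.trans_le hab
    rw [div_mul_eq_mul_div, le_div_iff₀ hb] at this
    linarith
  have hex : ∃ β > 0, L.psi β = q := by
    set a := min p (p * q / L.psi p)
    set b := max p (p * q / L.psi p)
    have hpq : 0 < p * q / L.psi p := by positivity
    have ha : 0 < a := lt_min hp hpq
    have hap : a ≤ p := min_le_left _ _
    have hbp : p ≤ b := le_max_left _ _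
    have h1 : L.psi a ≤ q := by
      have h2 := low' a p ha hap
      have h3 : a * L.psi p ≤ p * q := by
        have : a ≤ p * q / L.psi p := min_le_right _ _
        rwa [le_div_iff₀ hpp] at this
      nlinarith
    have h2 : q ≤ L.psi b := by
      have h2 := low' p b hp hbp
      have h3 : p * q ≤ b * L.psi p := by
        have : p * q / L.psi p ≤ b := le_max_right _ _
        rwa [div_le_iff₀ hpp] at this
      nlinarith
    have := intermediate_value_Icc (hap.trans hbp) ((psi_cont L).mono
      (fun x hx => ha.trans_le hx.1))
    obtain ⟨c, hc, hcq⟩ := this ⟨h1, h2⟩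
    exact ⟨c, ha.trans_le hc.1, hcq⟩
  obtain ⟨β, hβ, hβq⟩ := hex
  have hup : ∀ l > β, q < L.psi l := by
    intro l hl
    have := low' β l hβ hl.le
    rw [hβq] at this
    nlinarith
  have hdn : ∀ l > 0, l < β → L.psi l < q := by
    intro l hl hlb
    have := low' l β hl hlb.le
    rw [hβq] at this
    nlinarith
  refine ⟨β, hβ, hβq, ?_, hup, hdn⟩
  rw [L.Phi_def]
  have : {p | 0 < p ∧ L.psi p = q} = {β} := by
    ext x
    simp only [mem_ofPred_eq, mem_singleton_iff]
    constructor
    · rintro ⟨hx, hxq⟩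
      rcases lt_trichotomy x β with h | h | h
      · exact absurd hxq (hdn x hx h).ne
      · exact h
      · exact absurd hxq (hup x h).ne'
    · rintro rfl; exact ⟨hβ, hβq⟩
  rw [this, csSup_singleton]

lemma Phi_nonneg (L : SNLevy) (u : ℝ) : 0 ≤ L.Phi u := by
  rw [L.Phi_def]
  exact Real.sSup_nonneg (fun x hx => hx.1.le)

lemma Phi_lt (L : SNLevy) {u q : ℝ} (hu : 0 ≤ u) (huq : u < q) :
    L.Phi u < L.Phi q ∧ ∀ l > L.Phi u, L.psi l ≠ u := by
  obtain ⟨β, hβ, hβq, hPhi, hup, hdn⟩ := Phi_spec L (hu.trans_lt huq)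
  have hbd : BddAbove {p | 0 < p ∧ L.psi p = u} := by
    refine ⟨β, ?_⟩
    rintro x ⟨_, hx⟩
    by_contra h
    have := hup x (not_le.mp h)
    linarith
  constructor
  · have hc : ContinuousAt L.psi β := (psi_cont L).continuousAt (Ioi_mem_nhds hβ)
    have hev : ∀ᶠ x in 𝓝 β, u < L.psi x := hc.eventually_const_lt (by rw [hβq]; exact huq)
    obtain ⟨ε, hε, hball⟩ := Metric.eventually_nhds_iff.mp hev
    rw [hPhi]
    have hle : L.Phi u ≤ max 0 (β - ε) := by
      rw [L.Phi_def]
      refine Real.sSup_le ?_ (le_max_left _ _)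
      rintro x ⟨hx0, hx⟩
      by_contra h
      have h1 : β - ε < x := (le_max_right _ _).trans_lt (not_le.mp h)
      rcases lt_or_ge β x with h2 | h2
      · have := hup x h2; linarith
      · have := hball (y := x) (by rw [Real.dist_eq, abs_lt]; constructor <;> linarith)
        linarith
    exact hle.trans_lt (max_lt hβ (by linarith))
  · intro l hl heq
    have hl0 : 0 < l := (Phi_nonneg L u).trans_lt hl
    rw [L.Phi_def] at hl
    exact absurd (le_csSup hbd ⟨hl0, heq⟩) (not_le.mpr hl)

lemma W_int (L : SNLevy) {u l : ℝ} (hu : 0 ≤ u) (hl : L.Phi u < l) :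
    IntegrableOn (fun x => Real.exp (-l * x) * L.W u x) (Ioi 0) ∧ u < L.psi l := by
  have h1 := (Phi_lt L hu (lt_add_one u)).2 l hl
  have h2 := L.W_LT u hu l hl
  have h3 : 1 / (L.psi l - u) ≠ 0 := one_div_ne_zero (sub_ne_zero.mpr h1)
  constructor
  · by_contra h
    rw [integral_undef h] at h2
    exact h3 h2.symm
  · have h4 : 0 ≤ 1 / (L.psi l - u) := by
      rw [← h2]
      exact setIntegral_nonneg measurableSet_Ioi
        (fun x _ => mul_nonneg (Real.exp_pos _).le (L.W_nonneg u x))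
    rw [one_div_nonneg] at h4
    have := lt_of_le_of_ne h4 (fun h => h1 (by linarith))
    linarith

end Kend


namespace Kend
open ProbabilityTheory
open scoped Topology ENNReal

lemma W_meas (L : SNLevy) {u : ℝ} (hu : 0 ≤ u) : Measurable (L.W u) := by
  have h1 : Continuous (fun x => L.W u (max x 0)) := by
    rw [← continuousOn_univ]
    exact (L.W_cont u hu).comp (by fun_prop) (fun x _ => le_max_right x 0)
  have h2 : L.W u = fun x => if x ∈ Ici (0:ℝ) then L.W u (max x 0) else 0 := by
    ext x
    split_ifs with h
    · rw [max_eq_left h]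
    · exact L.W_neg u x (not_le.mp h)
  rw [h2]
  exact Measurable.ite measurableSet_Ici h1.measurable measurable_const

lemma H_cont (L : SNLevy) {u : ℝ} (hu : 0 ≤ u) : Continuous (fun x => x * L.W u x) := by
  have h1 : Continuous (fun x => max x 0 * L.W u (max x 0)) := by
    refine Continuous.mul (by fun_prop) ?_
    rw [← continuousOn_univ]
    exact (L.W_cont u hu).comp (by fun_prop) (fun x _ => le_max_right x 0)
  convert h1 using 2 with x
  rcases le_or_gt 0 x with h | h
  · rw [max_eq_left h]
  · rw [max_eq_right h.le, L.W_neg u x h]; simp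

lemma H_nonneg (L : SNLevy) (u x : ℝ) : 0 ≤ x * L.W u x := by
  rcases le_or_gt 0 x with h | h
  · exact mul_nonneg h (L.W_nonneg u x)
  · rw [L.W_neg u x h]; simp

lemma H_zero (L : SNLevy) (u x : ℝ) (hx : x ≤ 0) : x * L.W u x = 0 := by
  rcases hx.eq_or_lt with h | h
  · rw [h]; simp
  · rw [L.W_neg u x h]; simp

lemma wd_int {μ : Measure ℝ} {f : ℝ → ℝ} (g : ℝ → ℝ) (hf : Measurable f) (hf0 : ∀ x, 0 ≤ f x) :
    (Integrable g (μ.withDensity (fun x => ENNReal.ofReal (f x))) ↔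
      Integrable (fun x => f x * g x) μ) ∧
    ∫ x, g x ∂(μ.withDensity (fun x => ENNReal.ofReal (f x))) = ∫ x, f x * g x ∂μ := by
  constructor
  · rw [integrable_withDensity_iff_integrable_smul' (by fun_prop) (by simp)]
    simp only [smul_eq_mul, ENNReal.toReal_ofReal (hf0 _)]
  · rw [integral_withDensity_eq_integral_toReal_smul (by fun_prop) (by simp)]
    simp only [smul_eq_mul, ENNReal.toReal_ofReal (hf0 _)]

lemma int_of_lint {α : Type*} [MeasurableSpace α] {μ : Measure α} {f : α → ℝ} (hf : AEStronglyMeasurable f μ)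
    (hf0 : ∀ x, 0 ≤ f x) {c : ℝ} (hc : 0 ≤ c) (h : ∫⁻ x, ENNReal.ofReal (f x) ∂μ = ENNReal.ofReal c) :
    Integrable f μ ∧ ∫ x, f x ∂μ = c := by
  constructor
  · refine ⟨hf, ?_⟩
    rw [hasFiniteIntegral_iff_ofReal (Eventually.of_forall hf0), h]
    exact ENNReal.ofReal_lt_top
  · rw [integral_eq_lintegral_of_nonneg_ae (Eventually.of_forall hf0) hf, h, ENNReal.toReal_ofReal hc]

/-- Tilted scale measure. -/
def Wm (L : SNLevy) (γ c u : ℝ) : Measure ℝ :=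
  (volume.restrict (Ioi 0)).withDensity
    (fun x => ENNReal.ofReal (c * (Real.exp (-γ * x) * L.W u x)))

lemma Wm_exp (L : SNLevy) {γ c u s : ℝ} (hu : 0 ≤ u) (hc : 0 ≤ c) (hs : L.Phi u < γ - s) :
    Integrable (fun x => Real.exp (s * x)) (Wm L γ c u) ∧
    ∫ x, Real.exp (s * x) ∂(Wm L γ c u) = c * (1 / (L.psi (γ - s) - u)) := by
  have hm := W_meas L hu
  have h1 := wd_int (μ := volume.restrict (Ioi 0)) (f := fun x => c * (Real.exp (-γ * x) * L.W u x))
    (fun x => Real.exp (s * x)) (by fun_prop)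
    (fun x => mul_nonneg hc (mul_nonneg (Real.exp_pos _).le (L.W_nonneg u x)))
  have h2 : ∀ x, c * (Real.exp (-γ * x) * L.W u x) * Real.exp (s * x)
      = c * (Real.exp (-(γ - s) * x) * L.W u x) := by
    intro x
    have : Real.exp (-(γ - s) * x) = Real.exp (-γ * x) * Real.exp (s * x) := by
      rw [← Real.exp_add]; ring_nf
    rw [this]; ring
  simp only [h2] at h1
  unfold Wm
  rw [h1.1, h1.2]
  refine ⟨(W_int L hu hs).1.const_mul c, ?_⟩
  rw [integral_const_mul, L.W_LT u hu _ hs]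

instance (L : SNLevy) (γ c u : ℝ) : SFinite (Wm L γ c u) := by
  unfold Wm; infer_instance

lemma Wm_fin (L : SNLevy) {γ c u : ℝ} (hu : 0 ≤ u) (hc : 0 ≤ c) (hs : L.Phi u < γ) :
    IsFiniteMeasure (Wm L γ c u) := by
  have h := (Wm_exp L (s := 0) hu hc (by simpa using hs)).1
  simp only [zero_mul, Real.exp_zero] at h
  rw [integrable_const_iff] at h
  simpa using h

lemma Wm_ae (L : SNLevy) (γ c u : ℝ) : ∀ᵐ x ∂(Wm L γ c u), 0 < x := by
  unfold Wm
  exact (withDensity_absolutelyContinuous _ _).ae_le (ae_restrict_mem measurableSet_Ioi)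

lemma le_of_ae_le {f g : ℝ → ℝ} (hf : ContinuousOn f (Ici 0)) (hg : ContinuousOn g (Ici 0))
    (h : ∀ᵐ x ∂(volume.restrict (Ioi (0:ℝ))), f x ≤ g x) : ∀ x, 0 ≤ x → f x ≤ g x := by
  intro x hx
  by_contra hlt
  have hlt := not_le.mp hlt
  have h1 : ContinuousWithinAt f (Ioi x) x := (hf x hx).mono (fun y hy => hx.trans (le_of_lt hy))
  have h2 : ContinuousWithinAt g (Ioi x) x := (hg x hx).mono (fun y hy => hx.trans (le_of_lt hy))
  have h3 : ∀ᶠ y in 𝓝[>] x, g y < f y := h2.eventually_lt h1 hlt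
  obtain ⟨v, hv, hsub⟩ := (mem_nhdsGT_iff_exists_Ioo_subset).mp h3
  have h4 : ∀ᵐ y ∂(volume.restrict (Ioo x v)), f y ≤ g y :=
    ae_mono (Measure.restrict_mono (fun y hy => hx.trans_lt hy.1) le_rfl) h
  have h5 : ∀ᵐ y ∂(volume.restrict (Ioo x v)), False := by
    filter_upwards [h4, ae_restrict_mem measurableSet_Ioo] with y a b
    exact absurd a (not_le.mpr (hsub b))
  rw [eventually_false_iff_eq_bot, ae_eq_bot, Measure.restrict_eq_zero] at h5
  rw [Real.volume_Ioo] at h5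
  simp at h5
  exact absurd hv (not_lt.mpr h5)

/-- Comparison of densities. -/
lemma dens_le {f g : ℝ → ℝ} (hf : Measurable f) (hg0 : ∀ x, 0 ≤ g x)
    (h : (volume.restrict (Ioi (0:ℝ))).withDensity (fun x => ENNReal.ofReal (f x)) ≤
      (volume.restrict (Ioi (0:ℝ))).withDensity (fun x => ENNReal.ofReal (g x))) :
    ∀ᵐ x ∂(volume.restrict (Ioi (0:ℝ))), f x ≤ g x := by
  have h1 : (fun x => ENNReal.ofReal (f x)) ≤ᵐ[volume.restrict (Ioi (0:ℝ))]
      (fun x => ENNReal.ofReal (g x)) := by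
    refine ae_le_of_forall_setLIntegral_le_of_sigmaFinite (by fun_prop) ?_
    intro s hs _
    rw [← withDensity_apply _ hs, ← withDensity_apply _ hs]
    exact h s
  filter_upwards [h1] with x hx
  exact (ENNReal.ofReal_le_ofReal_iff (hg0 x)).mp hx

lemma conv_exp (μ ν : Measure ℝ) [SFinite μ] [SFinite ν] (s : ℝ)
    (h1 : Integrable (fun x => Real.exp (s * x)) μ) (h2 : Integrable (fun x => Real.exp (s * x)) ν) :
    Integrable (fun x => Real.exp (s * x)) (μ.conv ν) ∧
    ∫ x, Real.exp (s * x) ∂(μ.conv ν) = (∫ x, Real.exp (s * x) ∂μ) * ∫ x, Real.exp (s * x) ∂ν := by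
  have e : ∀ p : ℝ × ℝ, Real.exp (s * (p.1 + p.2)) = Real.exp (s * p.1) * Real.exp (s * p.2) := by
    intro p; rw [← Real.exp_add]; ring_nf
  unfold Measure.conv
  constructor
  · rw [integrable_map_measure (by fun_prop) (by fun_prop)]
    simp only [Function.comp_def, e]
    exact h1.mul_prod h2
  · rw [integral_map (by fun_prop) (by fun_prop)]
    simp only [e]
    exact integral_prod_mul (μ := μ) (ν := ν) (fun x => Real.exp (s * x)) (fun x => Real.exp (s * x))

lemma W_mono (L : SNLevy) {u q : ℝ} (hu : 0 ≤ u) (huq : u < q) :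
    ∀ x, 0 ≤ x → L.W u x ≤ L.W q x := by
  have hq : 0 ≤ q := hu.trans huq.le
  have hP := (Phi_lt L hu huq).1
  set γ := L.Phi q + 1 with hγ
  have f1 := Wm_fin L (γ := γ) (c := 1) hu zero_le_one (by linarith)
  have f2 := Wm_fin L (γ := γ) (c := 1) hq zero_le_one (by linarith)
  have key : Wm L γ 1 u + ENNReal.ofReal (q - u) • (Wm L γ 1 u).conv (Wm L γ 1 q) = Wm L γ 1 q := by
    have f3 : IsFiniteMeasure (ENNReal.ofReal (q - u) • (Wm L γ 1 u).conv (Wm L γ 1 q)) :=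
      Measure.smul_finite _ (by simp)
    have hA : ∀ s ∈ Ioo (-1:ℝ) 1, _ := fun s (hs : s ∈ Ioo (-1:ℝ) 1) =>
      Wm_exp L (γ := γ) (c := 1) (s := s) hu zero_le_one (by linarith [hs.2])
    have hB : ∀ s ∈ Ioo (-1:ℝ) 1, _ := fun s (hs : s ∈ Ioo (-1:ℝ) 1) =>
      Wm_exp L (γ := γ) (c := 1) (s := s) hq zero_le_one (by linarith [hs.2])
    have hC : ∀ s ∈ Ioo (-1:ℝ) 1, Integrable (fun x => Real.exp (s * x))
      (ENNReal.ofReal (q - u) • (Wm L γ 1 u).conv (Wm L γ 1 q)) := fun s hs =>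
        (conv_exp _ _ s (hA s hs).1 (hB s hs).1).1.smul_measure (by simp)
    refine ext_of_mgf one_pos (fun s hs => (hA s hs).1.add_measure (hC s hs))
      (fun s hs => (hB s hs).1) ?_
    intro s hs
    rw [integral_add_measure (hA s hs).1 (hC s hs), integral_smul_measure,
      (conv_exp _ _ s (hA s hs).1 (hB s hs).1).2, (hA s hs).2, (hB s hs).2,
      ENNReal.toReal_ofReal (by linarith)]
    have g1 := (W_int L hu (l := γ - s) (by linarith [hs.2])).2
    have g2 := (W_int L hq (l := γ - s) (by linarith [hs.2])).2
    have g1' : L.psi (γ - s) - u ≠ 0 := by linarith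
    have g2' : L.psi (γ - s) - q ≠ 0 := by linarith
    simp only [smul_eq_mul, one_mul]
    field_simp
    ring
  have hle : Wm L γ 1 u ≤ Wm L γ 1 q := by
    conv_rhs => rw [← key]
    exact Measure.le_add_right le_rfl
  have hmu := W_meas L hu
  have h1 := dens_le (f := fun x => 1 * (Real.exp (-γ * x) * L.W u x))
    (g := fun x => 1 * (Real.exp (-γ * x) * L.W q x)) (by fun_prop)
    (fun x => by have := L.W_nonneg q x; positivity) hle
  refine le_of_ae_le (L.W_cont u hu) (L.W_cont q hq) ?_
  filter_upwards [h1] with x hx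
  simp only [one_mul] at hx
  exact le_of_mul_le_mul_left hx (Real.exp_pos _)

/-- Joint measurability. -/
lemma X_aem (L : SNLevy) : AEMeasurable (fun p : ℝ × L.Ω => L.X p.1 p.2)
    ((volume.restrict (Ioi (0:ℝ))).prod (L.P 0 0)) := by
  have := L.prob 0 0
  let v : ℕ → ℝ → ℤ := fun n t => ⌊((n:ℝ) + 1) * t⌋ + 1
  let a : ℕ → ℝ → ℝ := fun n t => (v n t : ℝ) / ((n:ℝ) + 1)
  have hmeas : ∀ n, Measurable (fun p : ℝ × L.Ω => L.X (a n p.1) p.2) := by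
    intro n
    have h1 : Measurable (fun p : ℤ × L.Ω => L.X ((p.1 : ℝ) / ((n:ℝ) + 1)) p.2) :=
      measurable_from_prod_countable_right (fun k => L.meas ((k:ℝ) / ((n:ℝ) + 1)))
    have h2 : Measurable (fun p : ℝ × L.Ω => (v n p.1, p.2)) := by
      refine Measurable.prodMk ?_ measurable_snd
      have : Measurable (v n) := by
        have : Measurable (fun t : ℝ => ⌊((n:ℝ) + 1) * t⌋) := Int.measurable_floor.comp (by fun_prop)
        exact this.add_const 1
      exact this.comp measurable_fst
    exact h1.comp h2
  refine aemeasurable_of_tendsto_metrizable_ae atTop (fun n => (hmeas n).aemeasurable) ?_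
  have h1 := Measure.quasiMeasurePreserving_snd (μ := volume.restrict (Ioi (0:ℝ))) (ν := L.P 0 0)
    |>.ae (L.cadlag 0 0)
  have h2 := Measure.quasiMeasurePreserving_fst (μ := volume.restrict (Ioi (0:ℝ))) (ν := L.P 0 0)
    |>.ae (ae_restrict_mem measurableSet_Ioi)
  filter_upwards [h1, h2] with p hp hp0
  refine (hp p.1 (le_of_lt hp0)).tendsto.comp ?_
  have hb : ∀ n, p.1 < a n p.1 ∧ a n p.1 ≤ p.1 + 1 / ((n:ℝ) + 1) := by
    intro n
    have hn : (0:ℝ) < (n:ℝ) + 1 := by positivity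
    simp only [a, v]
    push_cast
    have f1 := Int.lt_floor_add_one (((n:ℝ) + 1) * p.1)
    have f2 := Int.floor_le (((n:ℝ) + 1) * p.1)
    constructor
    · rw [lt_div_iff₀ hn]; linarith
    · have h9 : (p.1 + 1 / ((n:ℝ) + 1)) * ((n:ℝ) + 1) = ((n:ℝ) + 1) * p.1 + 1 := by
        field_simp
      rw [div_le_iff₀ hn, h9]; linarith
  rw [tendsto_nhdsWithin_iff]
  refine ⟨?_, Eventually.of_forall fun n => (hb n).1.le⟩
  refine tendsto_of_tendsto_of_tendsto_of_le_of_le tendsto_const_nhds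
      (h := fun n : ℕ => p.1 + 1 / ((n:ℝ) + 1)) ?_ (fun n => (hb n).1.le) (fun n => (hb n).2)
  simpa using tendsto_one_div_add_atTop_nhds_zero_nat.const_add p.1

/-- Discounted time. -/
def rhoq (q : ℝ) : Measure ℝ :=
  (volume.restrict (Ioi (0:ℝ))).withDensity (fun t => ENNReal.ofReal (Real.exp (-q * t)))

instance (q : ℝ) : SFinite (rhoq q) := by unfold rhoq; infer_instance

/-- The potential measure. -/
def Uq (L : SNLevy) (q : ℝ) : Measure ℝ :=
  ((rhoq q).prod (L.P 0 0)).map (fun p => L.X p.1 p.2)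

instance (L : SNLevy) (q : ℝ) : SFinite (Uq L q) := by
  have := L.prob 0 0
  unfold Uq; infer_instance

lemma U_lint (L : SNLevy) (q : ℝ) {f : ℝ → ℝ≥0∞} (hf : Measurable f) :
    ∫⁻ x, f x ∂(Uq L q) = ∫⁻ t in Ioi (0:ℝ), ENNReal.ofReal (Real.exp (-q * t)) *
      ∫⁻ ω, f (L.X t ω) ∂(L.P 0 0) := by
  have := L.prob 0 0
  have hac : (rhoq q).prod (L.P 0 0) ≪ (volume.restrict (Ioi (0:ℝ))).prod (L.P 0 0) :=
    Measure.AbsolutelyContinuous.prod (withDensity_absolutelyContinuous _ _) (Measure.AbsolutelyContinuous.refl _)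
  have hX := (X_aem L).mono_ac hac
  unfold Uq
  rw [lintegral_map' hf.aemeasurable hX, lintegral_prod (fun p => f (L.X p.1 p.2)) (hf.comp_aemeasurable hX)]
  unfold rhoq
  rw [lintegral_withDensity_eq_lintegral_mul_non_measurable _ (by fun_prop) (by simp)]
  rfl

lemma U_exp (L : SNLevy) {q l : ℝ} (hl : 0 ≤ l) (hlq : L.psi l < q) :
    ∫⁻ x, ENNReal.ofReal (Real.exp (l * x)) ∂(Uq L q) = ENNReal.ofReal (1 / (q - L.psi l)) := by
  rw [U_lint L q (by fun_prop)]
  have h1 : ∀ t ∈ Ioi (0:ℝ), ENNReal.ofReal (Real.exp (-q * t)) *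
      ∫⁻ ω, ENNReal.ofReal (Real.exp (l * L.X t ω)) ∂(L.P 0 0) =
      ENNReal.ofReal (Real.exp (-(q - L.psi l) * t)) := by
    intro t ht
    rw [← ofReal_integral_eq_lintegral_ofReal (int_exp L hl ht)
      (Eventually.of_forall fun _ => (Real.exp_pos _).le), L.psi_def l t hl ht,
      ← ENNReal.ofReal_mul (Real.exp_pos _).le, ← Real.exp_add]
    ring_nf
  rw [setLIntegral_congr_fun measurableSet_Ioi h1]
  have hneg : -(q - L.psi l) < 0 := by linarith
  rw [← ofReal_integral_eq_lintegral_ofReal (integrableOn_exp_mul_Ioi hneg 0)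
    (Eventually.of_forall fun _ => (Real.exp_pos _).le), integral_exp_mul_Ioi hneg 0]
  congr 1
  simp
  rw [← neg_sub q, neg_div_neg_eq, one_div]

end Kend


namespace Kend
open ProbabilityTheory
open scoped Topology ENNReal

lemma charFun_ne_one (F : Measure ℝ) [IsProbabilityMeasure F] (hF : F ≪ volume) (θ : ℝ) (hθ : θ ≠ 0) :
    charFun F θ ≠ 1 := by
  intro h
  rw [charFun_apply_real] at h
  have hi : Integrable (fun x : ℝ => Complex.exp (θ * x * Complex.I)) F := by
    refine (integrable_const (1:ℝ)).mono' (by apply Continuous.aestronglyMeasurable; fun_prop) ?_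
    refine Eventually.of_forall fun x => ?_
    rw [Complex.norm_exp]; simp
  have hre : ∀ x : ℝ, (Complex.exp (θ * x * Complex.I)).re = Real.cos (θ * x) := by
    intro x
    rw [← Complex.ofReal_mul, Complex.exp_ofReal_mul_I_re]
  have hic : Integrable (fun x : ℝ => Real.cos (θ * x)) F := by
    have := hi.re
    refine this.congr (Eventually.of_forall fun x => ?_)
    exact hre x
  have h1 : ∫ x, Real.cos (θ * x) ∂F = 1 := by
    have h2 := congrArg Complex.re h
    have h3 := integral_re hi
    simp only [RCLike.re_to_complex] at h3
    rw [← h3] at h2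
    simp only [hre] at h2
    simpa using h2
  have h4 : ∫ x, (1 - Real.cos (θ * x)) ∂F = 0 := by
    rw [integral_sub (integrable_const _) hic, h1]; simp
  have hi4 : Integrable (fun x : ℝ => 1 - Real.cos (θ * x)) F := (integrable_const (1:ℝ)).sub hic
  rw [integral_eq_zero_iff_of_nonneg (fun x => by simpa using Real.cos_le_one _) hi4] at h4
  have hcount : volume {x : ℝ | Real.cos (θ * x) = 1} = 0 := by
    apply Set.Countable.measure_zero
    refine (countable_range (fun n : ℤ => (n:ℝ) * (2 * π) / θ)).mono ?_
    intro x hx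
    have hx' : Real.cos (θ * x) = 1 := hx
    rw [Real.cos_eq_one_iff] at hx'
    obtain ⟨n, hn⟩ := hx'
    refine ⟨n, ?_⟩
    simp only
    rw [hn]; field_simp
  have h5 : ∀ᵐ x ∂F, ¬ (Real.cos (θ * x) = 1) := by
    rw [ae_iff]; simpa using hF hcount
  have h6 : ∀ᵐ x ∂F, False := by
    filter_upwards [h4, h5] with x a b
    apply b
    simp at a; linarith
  rw [eventually_false_iff_eq_bot, ae_eq_bot] at h6
  exact IsProbabilityMeasure.ne_zero F h6

lemma main_id (L : SNLevy) {u q : ℝ} (hu : 0 ≤ u) (huq : u < q) :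
    (∃ a : ℝ, 0 ≤ a ∧ ∀ x, 0 ≤ x → L.W q x ≤ a * Real.exp (L.Phi q * x)) ∧
    ∫⁻ x, ENNReal.ofReal (x * L.W u x) ∂(Uq L q) = ENNReal.ofReal (1 / (q - u) ^ 2) := by
  have hq : 0 < q := hu.trans_lt huq
  obtain ⟨β, hβ, hβq, hPhi, hup, hdn⟩ := Phi_spec L hq
  have hP := (Phi_lt L hu huq).1
  rw [hPhi] at hP ⊢
  have hP0 := Phi_nonneg L u
  set δ := β - L.Phi u with hδ
  have hδ0 : 0 < δ := by linarith
  have hqu : 0 < q - u := by linarith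
  have hmu := W_meas L hu
  have hmq := W_meas L hq.le
  set F := Wm L β (q - u) u with hFdef
  set μ1 := Wm L β 1 q with hμ1
  set μ2 : Measure ℝ := ((Uq L q).map (fun x => -x)).withDensity
    (fun x => ENNReal.ofReal (Real.exp (-β * x))) with hμ2
  have hFe : ∀ s ∈ Ioo (-δ) δ, _ := fun s (hs : s ∈ Ioo (-δ) δ) =>
    Wm_exp L (γ := β) (c := q - u) (s := s) hu hqu.le (by linarith [hs.2])
  have hFp : IsProbabilityMeasure F := by
    have hfin := Wm_fin L (γ := β) (c := q - u) hu hqu.le hP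
    have h0 := (hFe 0 ⟨by linarith, hδ0⟩).2
    simp only [zero_mul, Real.exp_zero, sub_zero, hβq] at h0
    rw [mul_one_div_cancel hqu.ne'] at h0
    simp at h0
    constructor
    rw [measureReal_def, ENNReal.toReal_eq_one_iff] at h0
    exact h0
  have hμ1e : ∀ s ∈ Ioo (-δ) 0, _ := fun s (hs : s ∈ Ioo (-δ) 0) =>
    Wm_exp L (γ := β) (c := 1) (s := s) hq.le zero_le_one (by rw [hPhi]; linarith [hs.2])
  have hμ2l : ∀ g : ℝ → ℝ≥0∞, Measurable g → ∫⁻ x, g x ∂μ2 =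
      ∫⁻ y, ENNReal.ofReal (Real.exp (β * y)) * g (-y) ∂(Uq L q) := by
    intro g hg
    rw [hμ2, lintegral_withDensity_eq_lintegral_mul _ (by fun_prop) hg,
      lintegral_map (by fun_prop) (by fun_prop)]
    simp
  have hμ2e : ∀ s ∈ Ioo 0 δ, Integrable (fun x => Real.exp (s * x)) μ2 ∧
      ∫ x, Real.exp (s * x) ∂μ2 = 1 / (q - L.psi (β - s)) := by
    intro s hs
    have hlt := hdn (β - s) (by linarith [hs.2]) (by linarith [hs.1])
    refine int_of_lint (by apply Continuous.aestronglyMeasurable; fun_prop)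
      (fun x => (Real.exp_pos _).le) (one_div_nonneg.mpr (by linarith)) ?_
    rw [hμ2l _ (by fun_prop), ← U_exp L (by linarith [hs.2]) hlt]
    congr 1; ext y
    rw [← ENNReal.ofReal_mul (Real.exp_pos _).le, ← Real.exp_add]
    ring_nf
  have hFac : F ≪ volume := by
    refine (withDensity_absolutelyContinuous _ _).trans ?_
    exact Measure.absolutelyContinuous_of_le Measure.restrict_le_self
  have hFx := wd_int (μ := volume.restrict (Ioi 0)) (f := fun x => (q - u) * (Real.exp (-β * x) * L.W u x))
    (fun x => x) (by fun_prop)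
    (fun x => mul_nonneg hqu.le (mul_nonneg (Real.exp_pos _).le (L.W_nonneg u x)))
  have hxi : Integrable (fun x => x) F := by
    refine ((hFe (δ/2) ⟨by linarith, by linarith⟩).1.const_mul (2/δ)).mono'
      (by apply Continuous.aestronglyMeasurable; fun_prop) ?_
    filter_upwards [Wm_ae L β (q - u) u] with x hx
    rw [Real.norm_of_nonneg hx.le]
    have := Real.add_one_le_exp (δ / 2 * x)
    have h2 : (2 / δ) * (δ / 2 * x) = x := by field_simp
    have h3 : (2 / δ) * (δ / 2 * x) ≤ (2 / δ) * Real.exp (δ / 2 * x) :=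
      mul_le_mul_of_nonneg_left (by linarith) (by positivity)
    linarith
  have hm : 0 < ∫ x, x ∂F := by
    have hnn : 0 ≤ᵐ[F] fun x => x := by
      filter_upwards [Wm_ae L β (q - u) u] with x hx using hx.le
    refine lt_of_le_of_ne (integral_nonneg_of_ae hnn) ?_
    intro h
    have h2 := (integral_eq_zero_iff_of_nonneg_ae hnn hxi).mp h.symm
    have h6 : ∀ᵐ x ∂F, False := by
      filter_upwards [h2, Wm_ae L β (q - u) u] with x a b
      simp at a; linarith
    rw [eventually_false_iff_eq_bot, ae_eq_bot] at h6
    exact IsProbabilityMeasure.ne_zero F h6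
  have hkey := key F μ1 μ2 δ hδ0 (1 / (q - u)) (by positivity) (fun s hs => (hFe s hs).1)
    (fun s hs => (hμ1e s hs).1) (fun s hs => (hμ2e s hs).1) (by
      intro s hs
      have hs' : s ∈ Ioo (-δ) δ := ⟨hs.1, hs.2.trans hδ0⟩
      simp only [mgf, id]
      rw [(hFe s hs').2, (hμ1e s hs).2]
      have g1 := (W_int L hu (l := β - s) (by linarith [hs.2])).2
      have g2 := hup (β - s) (by linarith [hs.2])
      have g1' : L.psi (β - s) - u ≠ 0 := by linarith
      have g2' : L.psi (β - s) - q ≠ 0 := by linarith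
      have g3' := hqu.ne'
      field_simp
      ring) (by
      intro s hs
      have hs' : s ∈ Ioo (-δ) δ := ⟨by linarith [hs.1], hs.2⟩
      simp only [mgf, id]
      rw [(hFe s hs').2, (hμ2e s hs).2]
      have g1 := (W_int L hu (l := β - s) (by linarith [hs.2])).2
      have g2 := hdn (β - s) (by linarith [hs.2]) (by linarith [hs.1])
      have g1' : L.psi (β - s) - u ≠ 0 := by linarith
      have g2' : q - L.psi (β - s) ≠ 0 := by linarith
      have g3' := hqu.ne'
      field_simp
      ring) hm (charFun_ne_one F hFac)
  set m := ∫ x, x ∂F with hm_def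
  set a := 1 / (q - u) / m with ha
  have ha0 : 0 < a := by positivity
  constructor
  · refine ⟨a, ha0.le, ?_⟩
    have hle : μ1 ≤ (volume.restrict (Ioi (0:ℝ))).withDensity (fun _ => ENNReal.ofReal a) := by
      rw [withDensity_const, ← Measure.restrict_smul, ← hkey]
      have h1 : μ1 = μ1.restrict (Ioi 0) := by
        rw [Measure.restrict_eq_self_of_ae_mem]
        exact Wm_ae L β 1 q
      conv_lhs => rw [h1]
      exact Measure.restrict_mono le_rfl (Measure.le_add_right le_rfl)
    have h1 := dens_le (f := fun x => 1 * (Real.exp (-β * x) * L.W q x)) (g := fun _ => a)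
      (by fun_prop) (fun _ => ha0.le) hle
    refine le_of_ae_le (L.W_cont q hq.le) (by fun_prop) ?_
    filter_upwards [h1] with x hx
    have e : Real.exp (-β * x) * Real.exp (β * x) = 1 := by rw [← Real.exp_add]; simp
    have := mul_le_mul_of_nonneg_right hx (Real.exp_pos (β * x)).le
    calc L.W q x = 1 * (Real.exp (-β * x) * L.W q x) * Real.exp (β * x) := by
          linear_combination (-L.W q x) * e
      _ ≤ _ := this
  · have hHm : Measurable (fun x => x * L.W u x) := (H_cont L hu).measurable
    set g : ℝ → ℝ≥0∞ := fun x => ENNReal.ofReal (Real.exp (β * x) * (-x * L.W u (-x))) with hg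
    have hgm : Measurable g := by
      have : Measurable (fun x => (-x) * L.W u (-x)) := hHm.comp measurable_neg
      exact ENNReal.measurable_ofReal.comp (Measurable.mul (by fun_prop) this)
    have e1 : ∫⁻ x, g x ∂(μ1 + μ2) = ∫⁻ x, g x ∂(ENNReal.ofReal a • volume) := by rw [hkey]
    rw [lintegral_add_measure, lintegral_smul_measure] at e1
    have e2 : ∫⁻ x, g x ∂μ1 = 0 := by
      rw [lintegral_eq_zero_iff hgm]
      filter_upwards [Wm_ae L β 1 q] with x hx
      simp only [hg, H_zero L u (-x) (by linarith)]
      simp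
    have e3 : ∫⁻ x, g x ∂μ2 = ∫⁻ x, ENNReal.ofReal (x * L.W u x) ∂(Uq L q) := by
      rw [hμ2l g hgm]
      congr 1; ext y
      simp only [hg, neg_neg]
      rw [← ENNReal.ofReal_mul (Real.exp_pos _).le, ← mul_assoc, ← Real.exp_add]
      simp
    have e4 : ∫⁻ x, g x = ENNReal.ofReal (m / (q - u)) := by
      rw [← lintegral_neg_eq_self]
      simp only [hg, neg_neg]
      rw [← lintegral_add_compl _ (measurableSet_Iic (a := (0:ℝ))), compl_Iic]
      rw [setLIntegral_congr_fun (g := fun _ => 0) measurableSet_Iic (fun x hx => by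
        simp only [H_zero L u x hx]; simp)]
      rw [lintegral_zero, zero_add]
      have hxe : ∀ x, Real.exp (β * -x) * (x * L.W u x) =
          (1 / (q - u)) * ((q - u) * (Real.exp (-β * x) * L.W u x) * x) := by
        intro x
        have : β * -x = -β * x := by ring
        rw [this]
        field_simp
      rw [← ofReal_integral_eq_lintegral_ofReal]
      · simp only [hxe]
        rw [integral_const_mul, ← hFx.2]
        congr 1
        simp only [hm_def, hFdef, Wm]
        ring
      · simp only [hxe]
        exact (hFx.1.mp hxi).const_mul _
      · exact Eventually.of_forall fun x => mul_nonneg (Real.exp_pos _).le (H_nonneg L u x)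
    rw [e2, e3, e4, zero_add] at e1
    rw [e1, smul_eq_mul, ← ENNReal.ofReal_mul ha0.le]
    congr 1
    simp only [ha]
    have g3' := hqu.ne'
    have g4 := hm.ne'
    field_simp

end Kend


namespace Kend
open ProbabilityTheory
open scoped Topology ENNReal

lemma H_bound (L : SNLevy) {u : ℝ} (hu : 0 ≤ u) :
    ∃ C l : ℝ, 0 ≤ C ∧ 0 ≤ l ∧ ∀ x, x * L.W u x ≤ C * Real.exp (l * x) := by
  obtain ⟨⟨a, ha, hb⟩, _⟩ := main_id L hu (lt_add_one u)
  have hmono := W_mono L hu (lt_add_one u)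
  have hP := Phi_nonneg L (u + 1)
  refine ⟨a, L.Phi (u + 1) + 1, ha, by linarith, ?_⟩
  intro x
  rcases le_or_gt x 0 with h | h
  · rw [H_zero L u x h]
    exact mul_nonneg ha (Real.exp_pos _).le
  · have h1 : x ≤ Real.exp x := by linarith [Real.add_one_le_exp x]
    have h2 := (hmono x h.le).trans (hb x h.le)
    have h3 := mul_le_mul h1 h2 (L.W_nonneg u x) (Real.exp_pos _).le
    refine h3.trans_eq ?_
    rw [add_mul, Real.exp_add, one_mul]
    ring

/-- Fatou along right limits. -/
lemma fatou_X (L : SNLevy) {f : ℝ → ℝ} (hf : Continuous f) (hf0 : ∀ x, 0 ≤ f x) {t : ℝ} (ht : 0 < t)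
    {v : ℕ → ℝ} (hv : ∀ n, t < v n) (hvl : Tendsto v atTop (𝓝 t))
    (hint : ∀ s > 0, Integrable (fun ω => f (L.X s ω)) (L.P 0 0)) {c : ℝ}
    (hc : Tendsto (fun n => ∫ ω, f (L.X (v n) ω) ∂(L.P 0 0)) atTop (𝓝 c)) :
    ∫ ω, f (L.X t ω) ∂(L.P 0 0) ≤ c := by
  have hc0 : 0 ≤ c := ge_of_tendsto' hc (fun n => integral_nonneg fun _ => hf0 _)
  have hm : ∀ s, Measurable (fun ω => ENNReal.ofReal (f (L.X s ω))) := fun s =>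
    ENNReal.measurable_ofReal.comp (hf.measurable.comp (L.meas s))
  have heq : ∀ s > 0, ∫⁻ ω, ENNReal.ofReal (f (L.X s ω)) ∂(L.P 0 0) =
      ENNReal.ofReal (∫ ω, f (L.X s ω) ∂(L.P 0 0)) := fun s hs =>
    (ofReal_integral_eq_lintegral_ofReal (hint s hs) (Eventually.of_forall fun _ => hf0 _)).symm
  rw [← ENNReal.ofReal_le_ofReal_iff hc0, ← heq t ht]
  calc ∫⁻ ω, ENNReal.ofReal (f (L.X t ω)) ∂(L.P 0 0)
      = ∫⁻ ω, liminf (fun n => ENNReal.ofReal (f (L.X (v n) ω))) atTop ∂(L.P 0 0) := by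
        apply lintegral_congr_ae
        filter_upwards [L.cadlag 0 0] with ω hω
        symm
        apply Tendsto.liminf_eq
        apply ENNReal.tendsto_ofReal
        refine (hf.tendsto _).comp ((hω t ht.le).tendsto.comp ?_)
        rw [tendsto_nhdsWithin_iff]
        exact ⟨hvl, Eventually.of_forall fun n => (hv n).le⟩
    _ ≤ liminf (fun n => ∫⁻ ω, ENNReal.ofReal (f (L.X (v n) ω)) ∂(L.P 0 0)) atTop :=
        lintegral_liminf_le (fun n => hm _)
    _ = ENNReal.ofReal c := by
        apply Tendsto.liminf_eq
        simp only [heq _ (ht.trans (hv _))]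
        exact ENNReal.tendsto_ofReal hc

lemma G_ae (L : SNLevy) {u : ℝ} (hu : 0 ≤ u) : ∀ᵐ t ∂(volume.restrict (Ioi (0:ℝ))),
    ∫⁻ ω, ENNReal.ofReal (L.X t ω * L.W u (L.X t ω)) ∂(L.P 0 0)
      = ENNReal.ofReal (t * Real.exp (u * t)) := by
  have := L.prob 0 0
  have hHm : Measurable (fun x => x * L.W u x) := (H_cont L hu).measurable
  set g : ℝ → ℝ≥0∞ := fun t => ∫⁻ ω, ENNReal.ofReal (L.X t ω * L.W u (L.X t ω)) ∂(L.P 0 0) with hg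
  have hgm : AEMeasurable g (volume.restrict (Ioi (0:ℝ))) := by
    have h1 : AEMeasurable (fun p : ℝ × L.Ω => ENNReal.ofReal (L.X p.1 p.2 * L.W u (L.X p.1 p.2)))
        ((volume.restrict (Ioi (0:ℝ))).prod (L.P 0 0)) :=
      ENNReal.measurable_ofReal.comp_aemeasurable (hHm.comp_aemeasurable (X_aem L))
    exact h1.lintegral_prod_right'
  have hlap : ∀ q > u, ∫⁻ t in Ioi (0:ℝ), ENNReal.ofReal (Real.exp (-q * t)) * g t =
      ENNReal.ofReal (1 / (q - u) ^ 2) := by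
    intro q hq
    rw [← (main_id L hu hq).2, U_lint L q (f := fun x => ENNReal.ofReal (x * L.W u x)) (ENNReal.measurable_ofReal.comp hHm)]
  set f1 : ℝ → ℝ≥0∞ := fun t => ENNReal.ofReal (Real.exp (-(u + 1) * t)) * g t with hf1
  set f2 : ℝ → ℝ≥0∞ := fun t => ENNReal.ofReal (t * Real.exp (-t)) with hf2
  have hf1m : AEMeasurable f1 (volume.restrict (Ioi (0:ℝ))) :=
    AEMeasurable.mul (by fun_prop) hgm
  have hf2m : AEMeasurable f2 (volume.restrict (Ioi (0:ℝ))) := by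
    simp only [hf2]; fun_prop
  set ν1 := (volume.restrict (Ioi (0:ℝ))).withDensity f1 with hν1
  set ν2 := (volume.restrict (Ioi (0:ℝ))).withDensity f2 with hν2
  have l1 : ∀ s < 1, ∫⁻ t, ENNReal.ofReal (Real.exp (s * t)) ∂ν1 = ENNReal.ofReal (1 / (1 - s) ^ 2) := by
    intro s hs
    rw [hν1, lintegral_withDensity_eq_lintegral_mul₀ hf1m (by fun_prop)]
    have e : (1 - s) = (u + 1 - s) - u := by ring
    rw [e, ← hlap (u + 1 - s) (by linarith)]
    congr 1; ext t
    simp only [Pi.mul_apply, hf1]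
    rw [mul_right_comm, ← ENNReal.ofReal_mul (Real.exp_pos _).le, ← Real.exp_add]
    congr 3; ring
  have l2 : ∀ s < 1, ∫⁻ t, ENNReal.ofReal (Real.exp (s * t)) ∂ν2 = ENNReal.ofReal (1 / (1 - s) ^ 2) := by
    intro s hs
    rw [hν2, lintegral_withDensity_eq_lintegral_mul₀ hf2m (by fun_prop)]
    have hs0 : 0 < 1 - s := by linarith
    have e : ∀ t ∈ Ioi (0:ℝ), (f2 * fun t => ENNReal.ofReal (Real.exp (s * t))) t =
        ENNReal.ofReal (t ^ ((2:ℝ) - 1) * Real.exp (-((1 - s) * t))) := by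
      intro t ht
      have ht' : (0:ℝ) < t := ht
      simp only [Pi.mul_apply, hf2]
      rw [← ENNReal.ofReal_mul (by positivity), mul_assoc, ← Real.exp_add]
      congr 2
      · norm_num
      · ring_nf
    rw [setLIntegral_congr_fun measurableSet_Ioi e]
    have hI := Real.integral_rpow_mul_exp_neg_mul_Ioi (a := 2) two_pos hs0
    rw [Real.Gamma_two] at hI
    rw [← ofReal_integral_eq_lintegral_ofReal]
    · rw [hI]; congr 1
      rw [mul_one, ← Real.rpow_natCast]
      rw [Real.div_rpow zero_le_one hs0.le]; norm_num
    · by_contra h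
      rw [integral_undef h] at hI
      have : 0 < (1 / (1 - s)) ^ (2:ℝ) * 1 := by positivity
      linarith
    · filter_upwards [ae_restrict_mem measurableSet_Ioi] with t ht
      have ht' : (0:ℝ) < t := ht
      positivity
  have fin : ∀ ν : Measure ℝ, (∫⁻ t, ENNReal.ofReal (Real.exp (0 * t)) ∂ν = ENNReal.ofReal (1 / (1 - 0) ^ 2)) →
      ν univ = 1 := by
    intro ν h
    simpa using h
  have m1 : ν1 univ = 1 := fin ν1 (l1 0 one_pos)
  have m2 : ν2 univ = 1 := fin ν2 (l2 0 one_pos)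
  have i1 : IsFiniteMeasure ν1 := ⟨by rw [m1]; simp⟩
  have i2 : IsFiniteMeasure ν2 := ⟨by rw [m2]; simp⟩
  have r : ∀ ν : Measure ℝ, (∀ s < 1, ∫⁻ t, ENNReal.ofReal (Real.exp (s * t)) ∂ν
      = ENNReal.ofReal (1 / (1 - s) ^ 2)) → ∀ s ∈ Ioo (-1:ℝ) 1,
      Integrable (fun t => Real.exp (s * t)) ν ∧ ∫ t, Real.exp (s * t) ∂ν = 1 / (1 - s) ^ 2 := by
    intro ν h s hs
    exact int_of_lint (by apply Continuous.aestronglyMeasurable; fun_prop)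
      (fun x => (Real.exp_pos _).le) (by positivity) (h s hs.2)
  have heq : ν1 = ν2 := ext_of_mgf one_pos (fun s hs => (r ν1 l1 s hs).1) (fun s hs => (r ν2 l2 s hs).1)
    (fun s hs => by rw [(r ν1 l1 s hs).2, (r ν2 l2 s hs).2])
  have hae : f1 =ᵐ[volume.restrict (Ioi (0:ℝ))] f2 := by
    rw [hν1, hν2] at heq
    refine (withDensity_eq_iff hf1m hf2m ?_).mp heq
    have : ν1 univ = ∫⁻ t in Ioi (0:ℝ), f1 t := by
      rw [hν1, withDensity_apply _ MeasurableSet.univ, Measure.restrict_univ]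
    rw [← this, m1]; simp
  filter_upwards [hae, ae_restrict_mem measurableSet_Ioi] with t h ht
  have ht' : (0:ℝ) < t := ht
  have h2 : ENNReal.ofReal (Real.exp ((u + 1) * t)) * f1 t = ENNReal.ofReal (Real.exp ((u + 1) * t)) * f2 t := by
    rw [h]
  simp only [hf1, hf2] at h2
  rw [← mul_assoc, ← ENNReal.ofReal_mul (Real.exp_pos _).le, ← ENNReal.ofReal_mul (Real.exp_pos _).le,
    ← Real.exp_add] at h2
  have e0 : (u + 1) * t + -(u + 1) * t = 0 := by ring
  rw [e0, Real.exp_zero, ENNReal.ofReal_one, one_mul] at h2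
  change g t = _
  rw [h2]
  congr 1
  have : Real.exp (u * t) = Real.exp ((u + 1) * t) * Real.exp (-t) := by
    rw [← Real.exp_add]; ring_nf
  rw [this]; ring

lemma G_eq (L : SNLevy) {u t : ℝ} (hu : 0 ≤ u) (ht : 0 < t) :
    ∫ ω, L.X t ω * L.W u (L.X t ω) ∂(L.P 0 0) = t * Real.exp (u * t) := by
  have := L.prob 0 0
  obtain ⟨C, l, hC, hl, hb⟩ := H_bound L hu
  have hHc := H_cont L hu
  have hHi : ∀ s > 0, Integrable (fun ω => L.X s ω * L.W u (L.X s ω)) (L.P 0 0) := by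
    intro s hs
    refine ((int_exp L hl hs).const_mul C).mono'
      (hHc.measurable.comp (L.meas s)).aestronglyMeasurable ?_
    refine Eventually.of_forall fun ω => ?_
    rw [Real.norm_of_nonneg (H_nonneg L u _)]
    exact hb _
  have hseq : ∀ n : ℕ, ∃ s : ℝ, t < s ∧ s < t + 1 / ((n:ℝ) + 1) ∧
      ∫ ω, L.X s ω * L.W u (L.X s ω) ∂(L.P 0 0) = s * Real.exp (u * s) := by
    intro n
    have hpos : (0:ℝ) < 1 / ((n:ℝ) + 1) := by positivity
    have h1 : ∀ᵐ s ∂(volume.restrict (Ioo t (t + 1 / ((n:ℝ) + 1)))), _ :=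
      ae_mono (Measure.restrict_mono (fun y hy => ht.trans hy.1) le_rfl) (G_ae L hu)
    have h2 := h1.and (ae_restrict_mem measurableSet_Ioo)
    have hne : (ae (volume.restrict (Ioo t (t + 1 / ((n:ℝ) + 1))))).NeBot := by
      rw [ae_neBot, Ne, Measure.restrict_eq_zero, Real.volume_Ioo]
      simp; positivity
    obtain ⟨s, hs1, hs2⟩ := h2.exists
    have hs0 : 0 < s := ht.trans hs2.1
    refine ⟨s, hs2.1, hs2.2, ?_⟩
    exact (int_of_lint (hHi s hs0).aestronglyMeasurable (fun _ => H_nonneg L u _) (by positivity) hs1).2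
  choose v hv1 hv2 hv3 using hseq
  have hvl : Tendsto v atTop (𝓝 t) := by
    refine tendsto_of_tendsto_of_tendsto_of_le_of_le tendsto_const_nhds
      (h := fun n : ℕ => t + 1 / ((n:ℝ) + 1)) ?_ (fun n => (hv1 n).le) (fun n => (hv2 n).le)
    simpa using tendsto_one_div_add_atTop_nhds_zero_nat.const_add t
  have hlim : Tendsto (fun n => v n * Real.exp (u * v n)) atTop (𝓝 (t * Real.exp (u * t))) :=
    (Continuous.tendsto (by fun_prop : Continuous fun s : ℝ => s * Real.exp (u * s)) t).comp hvl
  apply le_antisymm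
  · refine fatou_X L (f := fun x => x * L.W u x) hHc (H_nonneg L u) ht hv1 hvl hHi ?_
    simp only [hv3]
    exact hlim
  · have hK : ∀ s > 0, ∫ ω, (C * Real.exp (l * L.X s ω) - L.X s ω * L.W u (L.X s ω)) ∂(L.P 0 0)
        = C * Real.exp (L.psi l * s) - ∫ ω, L.X s ω * L.W u (L.X s ω) ∂(L.P 0 0) := by
      intro s hs
      rw [integral_sub ((int_exp L hl hs).const_mul C) (hHi s hs), integral_const_mul,
        L.psi_def l s hl hs]
    have hfat := fatou_X L (f := fun x => C * Real.exp (l * x) - x * L.W u x)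
      (Continuous.sub (by fun_prop) hHc) (fun x => sub_nonneg.mpr (hb x)) ht hv1 hvl
      (fun s hs => ((int_exp L hl hs).const_mul C).sub (hHi s hs))
      (c := C * Real.exp (L.psi l * t) - t * Real.exp (u * t)) (by
        simp only [hK _ (ht.trans (hv1 _)), hv3]
        refine Tendsto.sub ?_ hlim
        exact (Continuous.tendsto (by fun_prop : Continuous fun s : ℝ => C * Real.exp (L.psi l * s)) t).comp hvl)
    rw [hK t ht] at hfat
    linarith

end Kend

/-- **Lemma 2, identity (16).** For every `u ≥ 0` and every `t > 0`:
`∫_0^∞ W^{(u)}(z) (z/t) P{X_t ∈ dz} = e^{ut}`. -/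
theorem scale_function_kendall_identity (L : SNLevy) (u t : ℝ)
    (hu : 0 ≤ u) (ht : 0 < t) :
    (∫ z in Ici (0:ℝ), L.W u z * (z / t) ∂ L.law t) = Real.exp (u * t) := by
  have e : ∀ z, L.W u z * (z / t) = (z * L.W u z) / t := fun z => by ring
  simp only [e]
  rw [setIntegral_eq_integral_of_forall_compl_eq_zero (fun z hz => by
    rw [Kend.H_zero L u z (not_le.mp hz).le, zero_div])]
  unfold SNLevy.law
  rw [integral_map (L.meas t).aemeasurable
    (((Kend.H_cont L hu).div_const t).aestronglyMeasurable), integral_div, Kend.G_eq L hu ht]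
  field_simp
end
end

section
/- For every u ≥ 0, θ > u and x ∈ ℝ: ∫_0^∞ e^{−θt} Ω^{(u)}(x, t) dt = e^{Φ(θ)x} ∫_x^∞ e^{−Φ(θ)z} W^{(u)}(z) dz. In particular, for x < 0 this equals e^{Φ(θ)x} / (θ − u). -/
open MeasureTheory Real Set Filter

noncomputable section

namespace SNAux

open scoped ENNReal Topology

/-- bilateral Laplace transform -/
def lap (μ : Measure ℝ) (l : ℝ) : ℝ≥0∞ := ∫⁻ x, ENNReal.ofReal (Real.exp (l * x)) ∂μ

lemma lap_tilt (μ : Measure ℝ) (a l : ℝ) :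
    lap (μ.withDensity fun x => ENNReal.ofReal (Real.exp (a * x))) l = lap μ (a + l) := by
  unfold lap
  rw [lintegral_withDensity_eq_lintegral_mul _ (by fun_prop) (by fun_prop)]
  refine lintegral_congr fun x => ?_
  simp only [Pi.mul_apply]
  rw [← ENNReal.ofReal_mul (Real.exp_pos _).le, ← Real.exp_add]
  congr 2; ring

lemma tilt_inj (μ ν : Measure ℝ) (a : ℝ)
    (h : (μ.withDensity fun x => ENNReal.ofReal (Real.exp (a * x)))
      = ν.withDensity fun x => ENNReal.ofReal (Real.exp (a * x))) : μ = ν := by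
  have key : ∀ ρ : Measure ℝ, (ρ.withDensity fun x => ENNReal.ofReal (Real.exp (a * x))).withDensity
      (fun x => (ENNReal.ofReal (Real.exp (a * x)))⁻¹) = ρ := by
    intro ρ
    refine withDensity_inv_same (by fun_prop) ?_ ?_
    · exact ae_of_all _ fun x => by simp [Real.exp_pos]
    · exact ae_of_all _ fun x => by simp
  rw [← key μ, h, key ν]

lemma integrable_of_lap {μ : Measure ℝ} {l : ℝ} (h : lap μ l ≠ ∞) :
    Integrable (fun x => Real.exp (l * x)) μ := by
  refine ⟨by fun_prop, ?_⟩
  rw [hasFiniteIntegral_iff_ofReal (ae_of_all _ fun x => (Real.exp_pos _).le)]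
  exact lt_of_le_of_ne le_top h

lemma mgf_eq_lap {μ : Measure ℝ} {l : ℝ} :
    ProbabilityTheory.mgf id μ l = (lap μ l).toReal := by
  unfold ProbabilityTheory.mgf lap
  rw [integral_eq_lintegral_of_nonneg_ae (ae_of_all _ fun x => (Real.exp_pos _).le) (by fun_prop)]
  rfl

lemma lap_unique0 (μ ν : Measure ℝ) {a b : ℝ} (ha : a < 0) (hb : 0 < b)
    (h : ∀ l ∈ Ioo a b, lap μ l = lap ν l) (hf : ∀ l ∈ Ioo a b, lap μ l ≠ ∞) : μ = ν := by
  have h0 : (0:ℝ) ∈ Ioo a b := ⟨ha, hb⟩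
  have hsub : ∀ ρ : Measure ℝ, (∀ l ∈ Ioo a b, lap ρ l ≠ ∞) →
      Ioo a b ⊆ interior (ProbabilityTheory.integrableExpSet id ρ) := by
    intro ρ hρ
    refine interior_maximal ?_ isOpen_Ioo
    intro l hl
    exact integrable_of_lap (hρ l hl)
  have hfν : ∀ l ∈ Ioo a b, lap ν l ≠ ∞ := fun l hl => h l hl ▸ hf l hl
  have fin : ∀ ρ : Measure ℝ, lap ρ 0 ≠ ∞ → IsFiniteMeasure ρ := by
    intro ρ hρ
    refine ⟨lt_of_le_of_ne le_top ?_⟩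
    simpa [lap] using hρ
  have := fin μ (hf 0 h0)
  have := fin ν (hfν 0 h0)
  have hX : AnalyticOnNhd ℂ (ProbabilityTheory.complexMGF id μ) {z | z.re ∈ Ioo a b} :=
    ProbabilityTheory.analyticOnNhd_complexMGF.mono fun z hz => hsub μ hf hz
  have hY : AnalyticOnNhd ℂ (ProbabilityTheory.complexMGF id ν) {z | z.re ∈ Ioo a b} :=
    ProbabilityTheory.analyticOnNhd_complexMGF.mono fun z hz => hsub ν hfν hz
  have heq : Set.EqOn (ProbabilityTheory.complexMGF id μ) (ProbabilityTheory.complexMGF id ν)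
      {z | z.re ∈ Ioo a b} := by
    refine AnalyticOnNhd.eqOn_of_preconnected_of_frequently_eq hX hY
      ((convex_Ioo a b).linear_preimage Complex.reLm).isPreconnected
      (z₀ := ((0:ℝ) : ℂ)) (by simpa using h0) ?_
    have h_real : ∃ᶠ (x : ℝ) in 𝓝[≠] 0, ProbabilityTheory.complexMGF id μ x
        = ProbabilityTheory.complexMGF id ν x := by
      refine Eventually.frequently ?_
      filter_upwards [nhdsWithin_le_nhds (isOpen_Ioo.mem_nhds h0)] with y hy
      rw [ProbabilityTheory.complexMGF_ofReal, ProbabilityTheory.complexMGF_ofReal,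
        mgf_eq_lap, mgf_eq_lap, h y hy]
    rw [frequently_iff_seq_forall] at h_real ⊢
    obtain ⟨xs, hx_tendsto, hx_eq⟩ := h_real
    refine ⟨fun n ↦ xs n, ?_, fun n ↦ ?_⟩
    · rw [tendsto_nhdsWithin_iff] at hx_tendsto ⊢
      constructor
      · exact (Complex.continuous_ofReal.tendsto 0).comp hx_tendsto.1
      · simpa using hx_tendsto.2
    · simp [hx_eq]
  refine Measure.ext_of_charFun (funext fun t => ?_)
  rw [← ProbabilityTheory.complexMGF_id_mul_I, ← ProbabilityTheory.complexMGF_id_mul_I]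
  exact heq (by simpa using h0)

lemma lap_unique (μ ν : Measure ℝ) {a b : ℝ} (hab : a < b)
    (h : ∀ l ∈ Ioo a b, lap μ l = lap ν l) (hf : ∀ l ∈ Ioo a b, lap μ l ≠ ∞) : μ = ν := by
  refine tilt_inj μ ν ((a + b) / 2) (lap_unique0 _ _ (a := a - (a + b) / 2)
    (b := b - (a + b) / 2) (by linarith) (by linarith) ?_ ?_)
  · intro l hl
    rw [lap_tilt, lap_tilt]
    exact h _ ⟨by linarith [hl.1], by linarith [hl.2]⟩
  · intro l hl
    rw [lap_tilt]
    exact hf _ ⟨by linarith [hl.1], by linarith [hl.2]⟩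

lemma lap_conv (μ ν : Measure ℝ) [SFinite μ] [SFinite ν] (l : ℝ) :
    lap (μ.conv ν) l = lap μ l * lap ν l := by
  unfold lap
  rw [Measure.lintegral_conv (by fun_prop), ← lintegral_mul_const _ (by fun_prop)]
  refine lintegral_congr fun x => ?_
  rw [← lintegral_const_mul _ (by fun_prop)]
  refine lintegral_congr fun y => ?_
  rw [← ENNReal.ofReal_mul (Real.exp_pos _).le, ← Real.exp_add, mul_add]

/-- maximum principle for renewal measures -/
lemma renewal_bound (p m : Measure ℝ) [IsFiniteMeasure p] [IsFiniteMeasure m]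
    (hp : p univ < 1) (h : m = p + p.conv m) (x : ℝ) :
    m (Ioc (x - 1) x) ≤ 1 + m (Iic 1) := by
  set D : Measure ℝ := Measure.dirac 0 + m with hD
  have hDm : ∀ x, m (Ioc (x - 1) x) ≤ D (Ioc (x - 1) x) := by
    intro x; rw [hD]; simp
  set M : ℝ≥0∞ := ⨆ x, D (Ioc (x - 1) x) with hM
  have hMtop : M ≠ ∞ := by
    have : M ≤ D univ := iSup_le fun x => measure_mono (subset_univ _)
    exact ne_top_of_le_ne_top (measure_ne_top D univ) this
  have step : ∀ x, D (Ioc (x - 1) x) ≤ max (1 + m (Iic 1)) (p univ * M) := by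
    intro x
    rcases le_or_gt x 1 with hx | hx
    · refine le_trans ?_ (le_max_left _ _)
      rw [hD, Measure.add_apply]
      gcongr
      · exact prob_le_one
      · intro y hy; exact hy.2.trans hx
    · refine le_trans ?_ (le_max_right _ _)
      have e1 : D (Ioc (x - 1) x) = ∫⁻ y, D (Ioc (x - y - 1) (x - y)) ∂p := by
        have : D (Ioc (x - 1) x) = m (Ioc (x - 1) x) := by
          rw [hD, Measure.add_apply, Measure.dirac_apply' _ measurableSet_Ioc]
          simp; intro h; linarith
        rw [this, hD]
        conv_lhs => rw [h]
        rw [Measure.add_apply, ← lintegral_indicator_one measurableSet_Ioc,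
          ← lintegral_indicator_one (μ := p.conv m) measurableSet_Ioc,
          Measure.lintegral_conv (measurable_one.indicator measurableSet_Ioc),
          ← lintegral_add_left (measurable_one.indicator measurableSet_Ioc)]
        refine lintegral_congr fun y => ?_
        rw [Measure.add_apply, Measure.dirac_apply' _ measurableSet_Ioc]
        congr 1
        · simp only [indicator, mem_Ioc, Pi.one_apply]
          congr 1
          simp only [eq_iff_iff]
          constructor <;> rintro ⟨h1, h2⟩ <;> constructor <;> linarith
        · rw [← lintegral_indicator_one measurableSet_Ioc]
          refine lintegral_congr fun z => ?_
          simp only [indicator, mem_Ioc, Pi.one_apply]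
          congr 1
          simp only [eq_iff_iff]
          constructor <;> rintro ⟨h1, h2⟩ <;> constructor <;> linarith
      rw [e1]
      calc _ ≤ ∫⁻ y, M ∂p := lintegral_mono fun y => le_iSup (fun x => D (Ioc (x - 1) x)) (x - y)
        _ = p univ * M := by rw [lintegral_const, mul_comm]
  have hM2 : M ≤ max (1 + m (Iic 1)) (p univ * M) := iSup_le step
  refine (hDm x).trans ((le_iSup (fun x => D (Ioc (x - 1) x)) x).trans ?_)
  rcases le_max_iff.1 hM2 with h1 | h1
  · exact h1
  · have : M = 0 := by
      by_contra hne
      have : p univ * M < 1 * M := by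
        rw [ENNReal.mul_lt_mul_iff_left hne hMtop]; exact hp
      rw [one_mul] at this
      exact absurd h1 (not_le.2 this)
    change M ≤ _
    rw [this]; simp

/-- Choquet-Deny on the half line, bounded functions -/
lemma choquet_deny (p : Measure ℝ) [IsProbabilityMeasure p] (hp : ∀ᵐ w ∂p, 0 < w)
    (g : ℝ → ℝ) (hg : Measurable g) (B : ℝ) (hB : ∀ z, |g z| ≤ B)
    (h : ∀ z, 0 < z → ∫ w, g (z + w) ∂p = g z) (z : ℝ) (hz : 0 < z) :
    ∀ᵐ w ∂p, g (z + w) = g z := by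
  have hB0 : 0 ≤ B := (abs_nonneg _).trans (hB 0)
  have bint : ∀ {α : Type} [MeasurableSpace α] (μ : Measure α) [IsFiniteMeasure μ] (f : α → ℝ) (C : ℝ),
      Measurable f → (∀ w, |f w| ≤ C) → Integrable f μ := by
    intro α _ μ _ f C hf hC
    exact Integrable.of_bound hf.aestronglyMeasurable C (ae_of_all _ fun w => by simpa using hC w)
  have gint : ∀ z, Integrable (fun w => g (z + w)) p := fun z =>
    bint p _ B (by fun_prop) fun w => hB _
  have g2b : ∀ z, g z ^ 2 ≤ B ^ 2 := fun z => sq_le_sq' (abs_le.1 (hB z)).1 (abs_le.1 (hB z)).2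
  have g2int : ∀ z, Integrable (fun w => g (z + w) ^ 2) p := fun z =>
    bint p _ (B ^ 2) (by fun_prop) fun w => by rw [abs_of_nonneg (sq_nonneg _)]; exact g2b _
  set Q : ℝ → ℝ := fun z => ∫ w, (g (z + w) - g z) ^ 2 ∂p with hQ
  have dsq : ∀ a b, (g a - g b) ^ 2 ≤ (2 * B) ^ 2 := fun a b => by
    have := abs_le.1 (hB a); have := abs_le.1 (hB b)
    exact sq_le_sq' (by linarith) (by linarith)
  have Qmeas : Measurable Q := by
    have : StronglyMeasurable (fun q : ℝ × ℝ => (g (q.1 + q.2) - g q.1) ^ 2) :=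
      Measurable.stronglyMeasurable (by fun_prop)
    exact (this.integral_prod_right (ν := p)).measurable
  have Q0 : ∀ z, 0 ≤ Q z := fun z => integral_nonneg fun w => sq_nonneg _
  have Qb : ∀ z, |Q z| ≤ (2 * B) ^ 2 := by
    intro z
    rw [abs_of_nonneg (Q0 z)]
    calc Q z ≤ ∫ w, (2 * B) ^ 2 ∂p := by
          refine integral_mono_of_nonneg (ae_of_all _ fun w => sq_nonneg _) (integrable_const _)
            (ae_of_all _ fun w => dsq _ _)
      _ = _ := by simp
  have Qeq : ∀ z, 0 < z → Q z = (∫ w, g (z + w) ^ 2 ∂p) - g z ^ 2 := by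
    intro z hz
    have : Q z = ∫ w, (g (z + w) ^ 2 - (2 * g z) * g (z + w) + g z ^ 2) ∂p := by
      refine integral_congr_ae (ae_of_all _ fun w => ?_); simp only; ring
    have i3 : Integrable (fun w => g (z + w) ^ 2 - (2 * g z) * g (z + w)) p :=
      (g2int z).sub ((gint z).const_mul _)
    rw [this, integral_add i3 (integrable_const _),
      integral_sub (g2int z) ((gint z).const_mul _), integral_const_mul, h z hz]
    simp; ring
  have Qle : ∀ z, 0 < z → Q z ≤ ∫ w, Q (z + w) ∂p := by
    intro z hz
    have e1 : ∀ᵐ w ∂p, (g (z + w) - g z) ^ 2 ≤ ∫ v, (g (z + v + w) - g (z + v)) ^ 2 ∂p := by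
      filter_upwards [hp] with w hw
      have e : g (z + w) - g z = ∫ v, (g (z + v + w) - g (z + v)) ∂p := by
        rw [integral_sub _ (gint z), h z hz, ← h (z + w) (by linarith)]
        · congr 2; ext v; congr 1; ring
        · exact bint p _ B (by fun_prop) fun w => hB _
      rw [e]
      have hv : Integrable (fun v => g (z + v + w) - g (z + v)) p := by
        refine bint p _ (2 * B) (by fun_prop) fun v => ?_
        have := abs_le.1 (hB (z + v + w)); have := abs_le.1 (hB (z + v))
        exact abs_le.2 ⟨by linarith, by linarith⟩
      have hv2 : Integrable (fun v => (g (z + v + w) - g (z + v)) ^ 2) p :=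
        bint p _ ((2 * B) ^ 2) (by fun_prop) fun v => by
          rw [abs_of_nonneg (sq_nonneg _)]; exact dsq _ _
      exact (even_two.convexOn_pow (𝕜 := ℝ)).map_integral_le (by fun_prop) isClosed_univ
        (ae_of_all _ fun _ => mem_univ _) hv hv2
    have i2 : Integrable (fun q : ℝ × ℝ => (g (z + q.2 + q.1) - g (z + q.2)) ^ 2) (p.prod p) :=
      bint _ _ ((2 * B) ^ 2) (by fun_prop) fun v => by
          rw [abs_of_nonneg (sq_nonneg _)]; exact dsq _ _
    calc Q z ≤ ∫ w, ∫ v, (g (z + v + w) - g (z + v)) ^ 2 ∂p ∂p :=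
          integral_mono_of_nonneg (ae_of_all _ fun w => sq_nonneg _) i2.integral_prod_left e1
      _ = ∫ v, ∫ w, (g (z + v + w) - g (z + v)) ^ 2 ∂p ∂p :=
          integral_integral_swap i2
      _ = _ := rfl
  have main : ∀ N : ℕ, ∀ z, 0 < z → N * Q z + g z ^ 2 ≤ B ^ 2 := by
    intro N
    induction N with
    | zero => intro z hz; simpa using g2b z
    | succ N ih =>
      intro z hz
      have i1 : Integrable (fun w => N * Q (z + w)) p :=
        (bint p _ _ (by fun_prop) fun w => Qb (z + w)).const_mul _
      calc ((N + 1 : ℕ) : ℝ) * Q z + g z ^ 2 = N * Q z + ∫ w, g (z + w) ^ 2 ∂p := by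
            have := Qeq z hz; push_cast; linarith
        _ ≤ N * (∫ w, Q (z + w) ∂p) + ∫ w, g (z + w) ^ 2 ∂p := by
            gcongr; exact Qle z hz
        _ = ∫ w, (N * Q (z + w) + g (z + w) ^ 2) ∂p := by
            rw [integral_add i1 (g2int z), integral_const_mul]
        _ ≤ ∫ w, B ^ 2 ∂p := by
            refine integral_mono_ae (i1.add (g2int z)) (integrable_const _) ?_
            filter_upwards [hp] with w hw
            exact ih _ (by linarith)
        _ = B ^ 2 := by simp
  have Qz : Q z = 0 := by
    by_contra hne
    have hpos : 0 < Q z := lt_of_le_of_ne (Q0 z) (Ne.symm hne)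
    obtain ⟨N, hN⟩ := exists_nat_gt (B ^ 2 / Q z)
    have := main N z hz
    rw [div_lt_iff₀ hpos] at hN
    nlinarith [sq_nonneg (g z)]
  have := (integral_eq_zero_iff_of_nonneg (fun w => sq_nonneg (g (z + w) - g z))
    (bint p _ ((2 * B) ^ 2) (by fun_prop) fun v => by
          rw [abs_of_nonneg (sq_nonneg _)]; exact dsq _ _)).1 Qz
  filter_upwards [this] with w hw
  have : g (z + w) - g z = 0 := by simpa using hw
  linarith

end SNAux
namespace SNAux

open scoped ENNReal Topology
open ProbabilityTheory

variable (L : SNLevy)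

lemma X_int {l t : ℝ} (hl : 0 ≤ l) (ht : 0 < t) :
    Integrable (fun ω => Real.exp (l * L.X t ω)) (L.P 0 0) := by
  by_contra h
  have := L.psi_def l t hl ht
  rw [integral_undef h] at this
  exact (Real.exp_pos _).ne this

lemma psi_eq_cgf {l : ℝ} (hl : 0 ≤ l) : L.psi l = cgf (L.X 1) (L.P 0 0) l := by
  have := L.psi_def l 1 hl one_pos
  unfold cgf mgf
  rw [this]; simp

lemma psi_zero : L.psi 0 = 0 := by
  have := L.prob 0 0
  rw [psi_eq_cgf L le_rfl]; simp

lemma psi_star {l a : ℝ} (hl : 0 ≤ l) (ha : 0 ≤ a) (ha1 : a ≤ 1) :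
    L.psi (a * l) ≤ a * L.psi l := by
  have := L.prob 0 0
  have h1 := L.psi_def l 1 hl one_pos
  have h2 := L.psi_def (a * l) 1 (mul_nonneg ha hl) one_pos
  rw [mul_one] at h1 h2
  rw [← Real.exp_le_exp, ← h2]
  have i1 := X_int L hl one_pos
  have key : ∀ s : ℝ, Real.exp (a * s) ≤ (1 - a) + a * Real.exp s := by
    intro s
    have := convexOn_exp.2 (mem_univ (0:ℝ)) (mem_univ s) (sub_nonneg.2 ha1) ha (by ring)
    simpa using this
  have i3 : Integrable (fun ω => a * (Real.exp (- L.psi l) * Real.exp (l * L.X 1 ω))) (L.P 0 0) :=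
    (i1.const_mul _).const_mul _
  have i2 : Integrable (fun ω => Real.exp (a * L.psi l) * ((1 - a) + a * (Real.exp (- L.psi l) *
      Real.exp (l * L.X 1 ω)))) (L.P 0 0) :=
    ((integrable_const _).add i3).const_mul _
  calc _ ≤ ∫ ω, Real.exp (a * L.psi l) * ((1 - a) + a * (Real.exp (- L.psi l) *
            Real.exp (l * L.X 1 ω))) ∂ (L.P 0 0) := by
        refine integral_mono (X_int L (mul_nonneg ha hl) one_pos) i2 fun ω => ?_
        have := key (l * L.X 1 ω - L.psi l)
        have e : Real.exp (a * l * L.X 1 ω) = Real.exp (a * L.psi l) *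
          Real.exp (a * (l * L.X 1 ω - L.psi l)) := by
          rw [← Real.exp_add]; congr 1; ring
        simp only
        have e2 : Real.exp (-L.psi l) * Real.exp (l * L.X 1 ω)
            = Real.exp (l * L.X 1 ω - L.psi l) := by
          rw [← Real.exp_add]; congr 1; ring
        rw [e, e2]
        gcongr
    _ = Real.exp (a * L.psi l) := by
        rw [integral_const_mul, integral_add (integrable_const _) i3, integral_const_mul,
          integral_const_mul, h1, ← Real.exp_add]
        simp

lemma psi_diff {l : ℝ} (hl : 0 < l) : DifferentiableAt ℝ L.psi l := by
  have hsub : Ioi 0 ⊆ integrableExpSet (L.X 1) (L.P 0 0) := fun l hl =>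
    X_int L (le_of_lt hl) one_pos
  have : l ∈ interior (integrableExpSet (L.X 1) (L.P 0 0)) :=
    interior_maximal hsub isOpen_Ioi hl
  refine (analyticAt_cgf this).differentiableAt.congr_of_eventuallyEq ?_
  filter_upwards [isOpen_Ioi.mem_nhds hl] with s hs
  exact psi_eq_cgf L (le_of_lt hs)

lemma psi_gt {p q l : ℝ} (hp : 0 < p) (hq : L.psi p = q) (hl : p < l) :
    q * l / p ≤ L.psi l := by
  have hl0 : 0 < l := hp.trans hl
  have := psi_star L hl0.le (a := p / l) (by positivity) ((div_le_one hl0).2 hl.le)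
  rw [div_mul_cancel₀ _ hl0.ne', hq] at this
  rw [div_le_iff₀ hp]
  calc q * l ≤ (p / l * L.psi l) * l := by gcongr
    _ = _ := by field_simp

lemma psi_lt {p q l : ℝ} (hp : 0 < p) (hq : L.psi p = q) (hl0 : 0 ≤ l) (hl : l ≤ p) :
    L.psi l ≤ l / p * q := by
  have := psi_star L hp.le (a := l / p) (by positivity) ((div_le_one hp).2 hl)
  rwa [div_mul_cancel₀ _ hp.ne', hq] at this

lemma exists_root {q : ℝ} (hq : 0 < q) : ∃ p, 0 < p ∧ L.psi p = q := by
  by_contra hcon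
  push Not at hcon
  have hPhi : L.Phi q = 0 := by
    rw [L.Phi_def]
    have : {p | 0 < p ∧ L.psi p = q} = ∅ := by
      ext p; simp only [mem_setOf_eq, mem_empty_iff_false, iff_false, not_and]; exact hcon p
    rw [this, Real.sSup_empty]
  have hcont : ContinuousOn L.psi (Ioi 0) := fun l hl =>
    (psi_diff L hl).continuousAt.continuousWithinAt
  -- small value
  obtain ⟨a, ha0, haq⟩ : ∃ a, 0 < a ∧ L.psi a < q := by
    by_cases h1 : L.psi 1 < q
    · exact ⟨1, one_pos, h1⟩
    · push Not at h1
      have h1' : 0 < L.psi 1 := hq.trans_le h1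
      refine ⟨q / (2 * L.psi 1), by positivity, ?_⟩
      have := psi_star L zero_le_one (a := q / (2 * L.psi 1)) (by positivity)
        (by rw [div_le_one (by positivity)]; linarith)
      rw [mul_one] at this
      refine this.trans_lt ?_
      field_simp; linarith
  have all : ∀ l, 0 < l → L.psi l < q := by
    intro l hl
    by_contra hlq
    push Not at hlq
    obtain ⟨c, hc, hcq⟩ := isPreconnected_Ioi.intermediate_value (a := a) (b := l) ha0 hl hcont
      ⟨haq.le, hlq⟩
    exact hcon c hc hcq
  have h1 := L.W_LT q hq.le 1 (by rw [hPhi]; exact one_pos)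
  have h2 : 0 ≤ ∫ x in Ioi (0:ℝ), Real.exp (-1 * x) * L.W q x :=
    integral_nonneg fun x => mul_nonneg (Real.exp_pos _).le (L.W_nonneg _ _)
  rw [h1] at h2
  have h3 := all 1 one_pos
  have : 1 / (L.psi 1 - q) < 0 := div_neg_of_pos_of_neg one_pos (by linarith)
  linarith

lemma Phi_of_psi {p q : ℝ} (hq0 : 0 < q) (hp : 0 < p) (hq : L.psi p = q) : L.Phi q = p := by
  rw [L.Phi_def]
  have : {p | 0 < p ∧ L.psi p = q} = {p} := by
    ext r
    simp only [mem_setOf_eq, mem_singleton_iff]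
    constructor
    · rintro ⟨hr, hrq⟩
      rcases lt_trichotomy r p with h | h | h
      · have := psi_lt L hp hq hr.le h.le
        rw [hrq] at this
        have h2 : r / p < 1 := (div_lt_one hp).2 h
        nlinarith
      · exact h
      · have := psi_gt L hp hq h
        rw [hrq, div_le_iff₀ hp] at this
        nlinarith
    · rintro rfl; exact ⟨hp, hq⟩
  rw [this, csSup_singleton]

lemma Phi_pos {q : ℝ} (hq : 0 < q) : 0 < L.Phi q := by
  obtain ⟨p, hp, h⟩ := exists_root L hq
  rwa [Phi_of_psi L hq hp h]

lemma psi_Phi {q : ℝ} (hq : 0 < q) : L.psi (L.Phi q) = q := by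
  obtain ⟨p, hp, h⟩ := exists_root L hq
  rwa [Phi_of_psi L hq hp h]

lemma psi_gt_of_Phi {q l : ℝ} (hq : 0 < q) (h : L.Phi q < l) : q < L.psi l := by
  have hp := Phi_pos L hq
  refine lt_of_lt_of_le ?_ (psi_gt L hp (psi_Phi L hq) h)
  rw [lt_div_iff₀ hp]; nlinarith

lemma psi_le_of_Phi {q l : ℝ} (hq : 0 < q) (hl : 0 ≤ l) (h : l ≤ L.Phi q) :
    L.psi l ≤ l / L.Phi q * q := psi_lt L (Phi_pos L hq) (psi_Phi L hq) hl h

lemma psi_lt_of_Phi {q l : ℝ} (hq : 0 < q) (hl : 0 ≤ l) (h : l < L.Phi q) :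
    L.psi l < q := by
  have hp := Phi_pos L hq
  refine (psi_le_of_Phi L hq hl h.le).trans_lt ?_
  have : l / L.Phi q < 1 := (div_lt_one hp).2 h
  nlinarith

lemma Phi_lt {s q : ℝ} (hs : 0 < s) (h : s < q) : L.Phi s < L.Phi q := by
  by_contra hc
  push Not at hc
  have hq := hs.trans h
  rcases hc.lt_or_eq with h1 | h1
  · have := psi_gt_of_Phi L hq h1
    rw [psi_Phi L hs] at this; linarith
  · have := psi_Phi L hs
    rw [← h1, psi_Phi L hq] at this; linarith

lemma Phi_ge {s q : ℝ} (hs : 0 < s) (h : s < q) : s / q * L.Phi q ≤ L.Phi s := by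
  by_contra hc
  push Not at hc
  have hq := hs.trans h
  have h1 := psi_gt_of_Phi L hs hc
  have hp := Phi_pos L hq
  have h2 := psi_le_of_Phi L hq (l := s / q * L.Phi q) (by positivity) (by
    have : s / q ≤ 1 := (div_le_one hq).2 h.le
    nlinarith)
  have : s / q * L.Phi q / L.Phi q * q = s := by field_simp
  linarith

lemma Phi_lt' {u q : ℝ} (hu : 0 ≤ u) (h : u < q) : L.Phi u < L.Phi q := by
  rcases hu.eq_or_lt with rfl | hu
  · refine lt_of_le_of_lt ?_ (Phi_lt L (s := q / 2) (by linarith) (by linarith))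
    rw [L.Phi_def]
    refine Real.sSup_le ?_ (Phi_pos L (by linarith)).le
    rintro p ⟨hp, hp0⟩
    by_contra hc
    push Not at hc
    have := psi_gt_of_Phi L (by linarith) hc
    linarith
  · exact Phi_lt L hu h

lemma psi_deriv_pos {l : ℝ} (hl : 0 < l) (hpsi : 0 < L.psi l) : 0 < deriv L.psi l := by
  have hd := (psi_diff L hl).hasDerivAt
  have h1 : Tendsto (slope L.psi l) (𝓝[<] l) (𝓝 (deriv L.psi l)) :=
    (hasDerivAt_iff_tendsto_slope.1 hd).mono_left (nhdsWithin_mono _ fun x hx => ne_of_lt hx)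
  refine lt_of_lt_of_le (div_pos hpsi hl) (ge_of_tendsto h1 ?_)
  filter_upwards [Ioo_mem_nhdsLT hl] with x hx
  have := psi_lt L hl rfl hx.1.le hx.2.le
  rw [slope_def_field, show (L.psi x - L.psi l) / (x - l) = (L.psi l - L.psi x) / (l - x) by
    rw [← neg_div_neg_eq, neg_sub, neg_sub], div_le_div_iff₀ hl (by linarith [hx.2])]
  rw [div_mul_eq_mul_div, le_div_iff₀ hl] at this
  nlinarith

end SNAux
namespace SNAux

open scoped ENNReal Topology
open ProbabilityTheory

variable (L : SNLevy)

lemma W_meas {u : ℝ} (hu : 0 ≤ u) : Measurable (L.W u) := by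
  have h : L.W u = (Ici 0).piecewise (L.W u) (fun _ => 0) := by
    funext x
    by_cases hx : x ∈ Ici (0:ℝ)
    · simp only [Set.piecewise, hx, if_true]
    · simp only [Set.piecewise, hx, if_false]
      exact L.W_neg u x (by simpa using hx)
  rw [h]
  exact ContinuousOn.measurable_piecewise (L.W_cont u hu) continuousOn_const measurableSet_Ici

/-- the scale measure -/
def wm (u : ℝ) : Measure ℝ :=
  (volume.restrict (Ioi (0:ℝ))).withDensity fun x => ENNReal.ofReal (L.W u x)

instance (u : ℝ) : SFinite (wm L u) := by unfold wm; infer_instance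

lemma lap_wm {u l : ℝ} (hu : 0 ≤ u) (hl : L.Phi u < l) (hpsi : u < L.psi l) :
    lap (wm L u) (-l) = ENNReal.ofReal (1 / (L.psi l - u)) := by
  have h := L.W_LT u hu l hl
  have hpos : 0 < 1 / (L.psi l - u) := one_div_pos.2 (sub_pos.2 hpsi)
  have hi : Integrable (fun x => Real.exp (-l * x) * L.W u x) (volume.restrict (Ioi (0:ℝ))) := by
    by_contra hc
    rw [integral_undef hc] at h
    exact hpos.ne h
  rw [← h, ofReal_integral_eq_lintegral_ofReal hi
    (ae_of_all _ fun x => mul_nonneg (Real.exp_pos _).le (L.W_nonneg _ _))]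
  unfold lap wm
  rw [lintegral_withDensity_eq_lintegral_mul _ (W_meas L hu).ennreal_ofReal (by fun_prop)]
  refine lintegral_congr fun x => ?_
  simp only [Pi.mul_apply]
  rw [ENNReal.ofReal_mul (Real.exp_pos _).le, mul_comm]

/-- tilted scale measure -/
def tw (c a u : ℝ) : Measure ℝ :=
  ENNReal.ofReal c • (wm L u).withDensity fun x => ENNReal.ofReal (Real.exp (a * x))

instance (c a u : ℝ) : SFinite (tw L c a u) := by unfold tw; infer_instance

lemma lap_tw {u c l a : ℝ} (hc : 0 ≤ c) (hu : 0 < u) (hl : L.Phi u < a - l) :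
    lap (tw L c (-a) u) l = ENNReal.ofReal (c / (L.psi (a - l) - u)) := by
  have : lap (tw L c (-a) u) l = ENNReal.ofReal c *
      lap ((wm L u).withDensity fun x => ENNReal.ofReal (Real.exp (-a * x))) l := by
    unfold tw lap
    rw [lintegral_smul_measure, smul_eq_mul]
  rw [this, lap_tilt, show -a + l = -(a - l) by ring, lap_wm L hu.le hl (psi_gt_of_Phi L hu hl),
    ← ENNReal.ofReal_mul hc, mul_one_div]

lemma tw_univ {u c a : ℝ} (hc : 0 ≤ c) (hu : 0 < u) (hl : L.Phi u < a) :
    tw L c (-a) u univ = ENNReal.ofReal (c / (L.psi a - u)) := by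
  have := lap_tw L hc hu (l := 0) (a := a) (by simpa using hl)
  rw [sub_zero] at this
  rw [← this]
  simp [lap]

lemma renewal_id {u v a : ℝ} (hv : 0 < v) (hvu : v < u) (ha : L.Phi u < a) :
    tw L (u - v) (-a) u = tw L (u - v) (-a) v +
      (tw L (u - v) (-a) v).conv (tw L (u - v) (-a) u) := by
  have hu := hv.trans hvu
  have hΦ := Phi_lt L hv hvu
  have hc : 0 ≤ u - v := by linarith
  apply lap_unique _ _ (show (-1:ℝ) < 0 by norm_num)
  · intro l hl
    have h1 : L.Phi u < a - l := by linarith [hl.2]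
    have hadd : ∀ μ ν : Measure ℝ, lap (μ + ν) l = lap μ l + lap ν l := fun μ ν => by
      unfold lap; rw [lintegral_add_measure]
    rw [hadd, lap_conv, lap_tw L hc hu h1, lap_tw L hc hv (by linarith)]
    have h2 := psi_gt_of_Phi L hu h1
    rw [← ENNReal.ofReal_mul (by apply div_nonneg <;> linarith),
      ← ENNReal.ofReal_add (by apply div_nonneg <;> linarith)
        (by apply mul_nonneg <;> apply div_nonneg <;> linarith)]
    congr 1
    have h3 : L.psi (a - l) - u ≠ 0 := by linarith
    have h4 : L.psi (a - l) - v ≠ 0 := by linarith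
    field_simp
    ring
  · intro l hl
    rw [lap_tw L hc hu (by linarith [hl.2])]
    exact ENNReal.ofReal_ne_top

lemma tw_window {q u a : ℝ} (hq : 0 < q) (hu : q / 2 < u) (huq : u < q) (ha : L.Phi u < a)
    (ha2 : a < L.Phi (2 * q)) (x : ℝ) :
    tw L (u - q / 2) (-a) u (Ioc (x - 1) x) ≤ 1 + ENNReal.ofReal (Real.exp (L.Phi (2 * q))) := by
  have hu0 : 0 < u := by linarith
  have hc : 0 ≤ u - q / 2 := by linarith
  have ha' : L.Phi (q / 2) < a := (Phi_lt L (by linarith) hu).trans ha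
  have ha0 : 0 < a := (Phi_pos L hu0).trans ha
  have hpu := psi_gt_of_Phi L hu0 ha
  have f1 : IsFiniteMeasure (tw L (u - q / 2) (-a) u) :=
    ⟨by rw [tw_univ L hc hu0 ha]; exact ENNReal.ofReal_lt_top⟩
  have f2 : IsFiniteMeasure (tw L (u - q / 2) (-a) (q / 2)) :=
    ⟨by rw [tw_univ L hc (by linarith) ha']; exact ENNReal.ofReal_lt_top⟩
  refine (renewal_bound (tw L (u - q / 2) (-a) (q / 2)) (tw L (u - q / 2) (-a) u) ?_
    (renewal_id L (by linarith) hu ha) x).trans ?_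
  · rw [tw_univ L hc (by linarith) ha', ← ENNReal.ofReal_one,
      ENNReal.ofReal_lt_ofReal_iff one_pos, div_lt_one (by linarith)]
    linarith
  · gcongr
    set Λ := L.Phi (2 * q)
    set m := tw L (u - q / 2) (-a) u
    calc m (Iic 1) = ∫⁻ x in Iic 1, 1 ∂m := by simp
      _ ≤ ∫⁻ x in Iic 1, ENNReal.ofReal (Real.exp (Λ - a)) *
            ENNReal.ofReal (Real.exp (-(Λ - a) * x)) ∂m := by
          refine setLIntegral_mono (by fun_prop) fun x hx => ?_
          rw [← ENNReal.ofReal_mul (Real.exp_pos _).le, ← Real.exp_add, ← ENNReal.ofReal_one]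
          apply ENNReal.ofReal_le_ofReal
          rw [Real.one_le_exp_iff]
          have : x ≤ 1 := hx
          nlinarith
      _ ≤ ∫⁻ x, ENNReal.ofReal (Real.exp (Λ - a)) *
            ENNReal.ofReal (Real.exp (-(Λ - a) * x)) ∂m := setLIntegral_le_lintegral _ _
      _ = ENNReal.ofReal (Real.exp (Λ - a)) * lap m (-(Λ - a)) := by
          rw [lintegral_const_mul _ (by fun_prop)]; rfl
      _ ≤ _ := by
          rw [lap_tw L hc hu0 (by linarith), ← ENNReal.ofReal_mul (Real.exp_pos _).le]
          apply ENNReal.ofReal_le_ofReal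
          rw [show a - -(Λ - a) = Λ by ring, psi_Phi L (by linarith)]
          have h1 : Real.exp (Λ - a) ≤ Real.exp Λ := Real.exp_le_exp.2 (by linarith)
          have h2 : (u - q / 2) / (2 * q - u) ≤ 1 := by
            rw [div_le_one (by linarith)]; linarith
          have h3 : 0 ≤ (u - q / 2) / (2 * q - u) := div_nonneg hc (by linarith)
          nlinarith [Real.exp_pos (Λ - a)]

lemma wm_window {q u a : ℝ} (hq : 0 < q) (hu : q / 2 < u) (huq : u < q) (ha : L.Phi u < a)
    (ha2 : a < L.Phi (2 * q)) (x : ℝ) :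
    ENNReal.ofReal (u - q / 2) * wm L u (Ioc (x - 1) x) ≤
      ENNReal.ofReal (Real.exp (a * x)) * (1 + ENNReal.ofReal (Real.exp (L.Phi (2 * q)))) := by
  have hu0 : 0 < u := by linarith
  have ha0 : 0 < a := (Phi_pos L hu0).trans ha
  refine le_trans ?_ (mul_le_mul_right (tw_window L hq hu huq ha ha2 x) _)
  unfold tw
  rw [Measure.smul_apply, smul_eq_mul, withDensity_apply _ measurableSet_Ioc, mul_left_comm]
  gcongr
  rw [← lintegral_const_mul _ (by fun_prop)]
  calc wm L u (Ioc (x - 1) x) = ∫⁻ y in Ioc (x - 1) x, 1 ∂(wm L u) := by simp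
    _ ≤ _ := by
      refine setLIntegral_mono (by fun_prop) fun y hy => ?_
      rw [← ENNReal.ofReal_mul (Real.exp_pos _).le, ← Real.exp_add, ← ENNReal.ofReal_one]
      apply ENNReal.ofReal_le_ofReal
      rw [Real.one_le_exp_iff]
      nlinarith [hy.2]

end SNAux
namespace SNAux

open scoped ENNReal Topology
open ProbabilityTheory

variable (L : SNLevy)

lemma lint_exp {a : ℝ} (ha : 0 < a) (c : ℝ) :
    ∫⁻ t in Ioi c, ENNReal.ofReal (Real.exp (-a * t)) = ENNReal.ofReal (Real.exp (-a * c) / a) := by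
  rw [← ofReal_integral_eq_lintegral_ofReal (integrableOn_exp_mul_Ioi (by linarith) c)
    (ae_of_all _ fun x => (Real.exp_pos _).le), integral_exp_mul_Ioi (by linarith) c]
  congr 1
  rw [neg_div_neg_eq]

/-- measurable version of the process -/
def Xt (z : ℝ × L.Ω) : ℝ :=
  limsup (fun n : ℕ => L.X (((⌊((n:ℝ) + 1) * z.1⌋₊ : ℝ) + 1) / ((n:ℝ) + 1)) z.2) atTop

lemma Xt_meas : Measurable (Xt L) := by
  unfold Xt
  refine Measurable.limsup fun n => ?_
  have h1 : Measurable fun p : L.Ω × ℕ => L.X (((p.2 : ℝ) + 1) / ((n:ℝ) + 1)) p.1 :=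
    measurable_from_prod_countable_left fun k => L.meas (((k : ℝ) + 1) / ((n:ℝ) + 1))
  have h2 : Measurable fun z : ℝ × L.Ω => (z.2, ⌊((n:ℝ) + 1) * z.1⌋₊) :=
    measurable_snd.prodMk (Nat.measurable_floor.comp (measurable_fst.const_mul _))
  exact h1.comp h2

lemma Xt_eq : ∀ᵐ ω ∂ L.P 0 0, ∀ t, 0 ≤ t → Xt L (t, ω) = L.X t ω := by
  filter_upwards [L.cadlag 0 0] with ω hω t ht
  unfold Xt
  have hc := hω t ht
  refine Tendsto.limsup_eq ?_
  refine Tendsto.comp (g := fun s => L.X s ω) (y := 𝓝[Ici t] t) hc ?_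
  have hb : ∀ n : ℕ, t ≤ ((⌊((n:ℝ) + 1) * t⌋₊ : ℝ) + 1) / ((n:ℝ) + 1) ∧
      ((⌊((n:ℝ) + 1) * t⌋₊ : ℝ) + 1) / ((n:ℝ) + 1) ≤ t + 1 / ((n:ℝ) + 1) := by
    intro n
    have hn : (0:ℝ) < (n:ℝ) + 1 := by positivity
    have h1 := Nat.lt_floor_add_one (((n:ℝ) + 1) * t)
    have h2 := Nat.floor_le (show 0 ≤ ((n:ℝ) + 1) * t by positivity)
    constructor
    · rw [le_div_iff₀ hn]; linarith
    · have e : (t + 1 / ((n:ℝ) + 1)) * ((n:ℝ) + 1) = ((n:ℝ) + 1) * t + 1 := by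
        field_simp
      rw [div_le_iff₀ hn, e]; linarith
  refine tendsto_nhdsWithin_iff.2 ⟨?_, Eventually.of_forall fun n => (hb n).1⟩
  refine tendsto_of_tendsto_of_tendsto_of_le_of_le tendsto_const_nhds ?_ (fun n => (hb n).1)
    fun n => (hb n).2
  simpa using tendsto_one_div_add_atTop_nhds_zero_nat.const_add t

/-- resolvent measure -/
def Um (q : ℝ) : Measure ℝ :=
  Measure.map (Xt L) (((volume.restrict (Ioi (0:ℝ))).withDensity
    fun t => ENNReal.ofReal (Real.exp (-q * t))).prod (L.P 0 0))

lemma lint_law {f : ℝ → ℝ≥0∞} (hf : Measurable f) {t : ℝ} (ht : 0 < t) :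
    ∫⁻ z, f z ∂(L.law t) = ∫⁻ ω, f (Xt L (t, ω)) ∂(L.P 0 0) := by
  unfold SNLevy.law
  rw [lintegral_map hf (L.meas t)]
  refine lintegral_congr_ae ?_
  filter_upwards [Xt_eq L] with ω hω
  rw [hω t ht.le]

lemma lint_Um (q : ℝ) {f : ℝ → ℝ≥0∞} (hf : Measurable f) :
    ∫⁻ z, f z ∂(Um L q) = ∫⁻ t in Ioi (0:ℝ), ENNReal.ofReal (Real.exp (-q * t)) *
      ∫⁻ ω, f (Xt L (t, ω)) ∂(L.P 0 0) := by
  have := L.prob 0 0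
  have hm : Measurable fun z => f (Xt L z) := hf.comp (Xt_meas L)
  unfold Um
  rw [lintegral_map hf (Xt_meas L), lintegral_prod _ hm.aemeasurable,
    lintegral_withDensity_eq_lintegral_mul _ (by fun_prop) hm.lintegral_prod_right']
  rfl

lemma lap_Um {q l : ℝ} (hl : 0 ≤ l) (hq : L.psi l < q) :
    lap (Um L q) l = ENNReal.ofReal (1 / (q - L.psi l)) := by
  unfold lap
  rw [lint_Um L q (by fun_prop)]
  have : ∀ t ∈ Ioi (0:ℝ), ENNReal.ofReal (Real.exp (-q * t)) *
      ∫⁻ ω, ENNReal.ofReal (Real.exp (l * Xt L (t, ω))) ∂(L.P 0 0) =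
      ENNReal.ofReal (Real.exp (-(q - L.psi l) * t)) := by
    intro t ht
    rw [← lint_law L (f := fun z => ENNReal.ofReal (Real.exp (l * z))) (by fun_prop) ht]
    unfold SNLevy.law
    rw [lintegral_map (by fun_prop) (L.meas t),
      ← ofReal_integral_eq_lintegral_ofReal (X_int L hl ht) (ae_of_all _ fun x => (Real.exp_pos _).le),
      L.psi_def l t hl ht, ← ENNReal.ofReal_mul (Real.exp_pos _).le, ← Real.exp_add]
    congr 2; ring
  rw [setLIntegral_congr_fun measurableSet_Ioi this, lint_exp (by linarith)]
  simp

lemma Um_univ {q : ℝ} (hq : 0 < q) : Um L q univ = ENNReal.ofReal (1 / q) := by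
  have := lap_Um L (q := q) le_rfl (by rwa [psi_zero])
  rw [psi_zero, sub_zero] at this
  rw [← this]; simp [lap]

lemma Um_fin {q : ℝ} (hq : 0 < q) : IsFiniteMeasure (Um L q) :=
  ⟨by rw [Um_univ L hq]; exact ENNReal.ofReal_lt_top⟩

lemma wm_pos (u : ℝ) : ∀ᵐ x ∂(wm L u), 0 < x := by
  unfold wm
  refine (withDensity_absolutelyContinuous _ _).ae_le ?_
  exact ae_restrict_mem measurableSet_Ioi

/-- reflected scale measure -/
def wr (u : ℝ) : Measure ℝ := Measure.map (fun x => -x) (wm L u)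

instance (u : ℝ) : SFinite (wr L u) := by unfold wr; infer_instance

lemma icfe {u q : ℝ} (hu : 0 < u) (huq : u < q) :
    ENNReal.ofReal (q - u) • (Um L q).conv (wr L u) = Um L q + wr L u := by
  have hq := hu.trans huq
  have := Um_fin L hq
  have hU0 := Phi_pos L hu
  refine (lap_unique _ _ (Phi_lt L hu huq) ?_ ?_).symm
  all_goals
    intro l hl
    have h1 := psi_gt_of_Phi L hu hl.1
    have h2 := psi_lt_of_Phi L hq (hU0.trans hl.1).le hl.2
    have hw : lap (wr L u) l = ENNReal.ofReal (1 / (L.psi l - u)) := by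
      rw [← lap_wm L hu.le hl.1 h1]
      unfold lap wr
      rw [lintegral_map (by fun_prop) measurable_neg]
      simp
    have hadd : lap (Um L q + wr L u) l = ENNReal.ofReal (1 / (q - L.psi l)
        + 1 / (L.psi l - u)) := by
      rw [ENNReal.ofReal_add (one_div_nonneg.2 (by linarith)) (one_div_nonneg.2 (by linarith)),
        ← lap_Um L (hU0.trans hl.1).le h2, ← hw]
      unfold lap; rw [lintegral_add_measure]
  · have hs : ∀ (c : ℝ≥0∞) (μ : Measure ℝ), lap (c • μ) l = c * lap μ l := fun c μ => by
      unfold lap; rw [lintegral_smul_measure, smul_eq_mul]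
    rw [hadd, hs, lap_conv, lap_Um L (hU0.trans hl.1).le h2, hw,
      ← ENNReal.ofReal_mul (one_div_nonneg.2 (by linarith)), ← ENNReal.ofReal_mul (by linarith)]
    congr 1
    have h3 : q - L.psi l ≠ 0 := by linarith
    have h4 : L.psi l - u ≠ 0 := by linarith
    field_simp
    ring
  · rw [hadd]; exact ENNReal.ofReal_ne_top

lemma icfe_int {u q : ℝ} (hu : 0 < u) (huq : u < q) {f : ℝ → ℝ≥0∞} (hf : Measurable f)
    (hf0 : ∀ x, x ≤ 0 → f x = 0) :
    ∫⁻ y, f y ∂(Um L q) =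
      ENNReal.ofReal (q - u) * ∫⁻ y, ∫⁻ w, f (y - w) ∂(wm L u) ∂(Um L q) := by
  have := Um_fin L (hu.trans huq)
  have h : ∫⁻ y, f y ∂(ENNReal.ofReal (q - u) • (Um L q).conv (wr L u))
      = ∫⁻ y, f y ∂(Um L q + wr L u) := by rw [icfe L hu huq]
  rw [lintegral_add_measure, lintegral_smul_measure, smul_eq_mul, Measure.lintegral_conv hf] at h
  have h0 : ∫⁻ y, f y ∂(wr L u) = 0 := by
    unfold wr
    rw [lintegral_map hf measurable_neg, lintegral_eq_zero_iff (by fun_prop)]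
    filter_upwards [wm_pos L u] with x hx
    exact hf0 _ (by linarith)
  rw [h0, add_zero] at h
  rw [← h]
  congr 1
  refine lintegral_congr fun y => ?_
  unfold wr
  rw [lintegral_map (by fun_prop) measurable_neg]
  rfl

end SNAux
namespace SNAux

open scoped ENNReal Topology
open ProbabilityTheory

variable (L : SNLevy)

lemma Um_window0 {q u z : ℝ} (hq : 0 < q) (hu : q / 2 < u) (huq : u < q) (hz : 0 < z) :
    ENNReal.ofReal (u - q / 2) * Um L q (Ico z (z + 1)) ≤
      ENNReal.ofReal (2 * Real.exp (-L.Phi ((u + q) / 2) * z)) *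
        (1 + ENNReal.ofReal (Real.exp (L.Phi (2 * q)))) := by
  have hu0 : 0 < u := by linarith
  set K : ℝ≥0∞ := 1 + ENNReal.ofReal (Real.exp (L.Phi (2 * q)))
  set s := (u + q) / 2 with hs
  set a := L.Phi s with ha
  have hs0 : 0 < s := by linarith
  have ha0 : 0 < a := Phi_pos L hs0
  have h1 : L.Phi u < a := Phi_lt L hu0 (by linarith)
  have h2 : a < L.Phi (2 * q) := Phi_lt L hs0 (by linarith)
  have e1 : Um L q (Ico z (z + 1)) = ENNReal.ofReal (q - u) *
      ∫⁻ y, wm L u (Ioc ((y - z) - 1) (y - z)) ∂(Um L q) := by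
    have := icfe_int L hu0 huq (f := (Ico z (z + 1)).indicator 1)
      (measurable_one.indicator measurableSet_Ico)
      (fun x hx => indicator_of_notMem (fun h => by linarith [h.1]) _)
    rw [lintegral_indicator_one measurableSet_Ico] at this
    rw [this]
    congr 1
    refine lintegral_congr fun y => ?_
    rw [← lintegral_indicator_one measurableSet_Ioc]
    refine lintegral_congr fun w => ?_
    by_cases hw : w ∈ Ioc (y - z - 1) (y - z)
    · rw [indicator_of_mem hw, indicator_of_mem]
      · rfl
      · exact ⟨by linarith [hw.2], by linarith [hw.1]⟩
    · rw [indicator_of_notMem hw, indicator_of_notMem]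
      intro h
      exact hw ⟨by linarith [h.2], by linarith [h.1]⟩
  rw [e1, mul_left_comm]
  calc _ ≤ ENNReal.ofReal (q - u) * ∫⁻ y, ENNReal.ofReal (u - q / 2) *
          wm L u (Ioc ((y - z) - 1) (y - z)) ∂(Um L q) := by
        gcongr
        exact lintegral_const_mul_le _ _
    _ ≤ ENNReal.ofReal (q - u) * ∫⁻ y, ENNReal.ofReal (Real.exp (a * (y - z))) * K ∂(Um L q) := by
        refine mul_le_mul_right (lintegral_mono fun y => ?_) _
        exact wm_window L hq hu huq h1 h2 (y - z)
    _ = ENNReal.ofReal (q - u) * (ENNReal.ofReal (Real.exp (-a * z)) * lap (Um L q) a * K) := by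
        rw [lintegral_mul_const _ (by fun_prop)]
        congr 2
        unfold lap
        rw [← lintegral_const_mul _ (by fun_prop)]
        refine lintegral_congr fun y => ?_
        rw [← ENNReal.ofReal_mul (Real.exp_pos _).le, ← Real.exp_add]
        congr 2; ring
    _ = _ := by
        have hpa : L.psi a = s := psi_Phi L hs0
        rw [lap_Um L ha0.le (by rw [hpa]; linarith), hpa, ← mul_assoc,
          ← ENNReal.ofReal_mul (Real.exp_pos _).le, ← ENNReal.ofReal_mul (by linarith)]
        congr 2
        have : q - s ≠ 0 := by rw [hs]; intro h; linarith
        have e : q - u = 2 * (q - s) := by rw [hs]; ring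
        rw [e]; field_simp

lemma Um_window {q z : ℝ} (hq : 0 < q) (hz : 0 < z) :
    Um L q (Ico z (z + 1)) ≤
      ENNReal.ofReal (4 / q * (1 + Real.exp (L.Phi (2 * q))) * Real.exp (-L.Phi q * z)) := by
  have := Um_fin L hq
  set r := (Um L q (Ico z (z + 1))).toReal with hr
  have hr0 : 0 ≤ r := ENNReal.toReal_nonneg
  have er : Um L q (Ico z (z + 1)) = ENNReal.ofReal r :=
    (ENNReal.ofReal_toReal (measure_ne_top _ _)).symm
  set E := 1 + Real.exp (L.Phi (2 * q)) with hE
  have hE0 : 0 < E := by positivity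
  have h : ∀ u ∈ Ioo (q / 2) q, (u - q / 2) * r ≤
      2 * Real.exp (-((u + q) / 2 / q * L.Phi q) * z) * E := by
    intro u hu
    have h0 := Um_window0 L hq hu.1 hu.2 hz
    have hu1 := hu.1
    have hu2 := hu.2
    rw [er, ← ENNReal.ofReal_one, ← ENNReal.ofReal_add zero_le_one (Real.exp_pos _).le,
      ← ENNReal.ofReal_mul (by linarith), ← ENNReal.ofReal_mul (by positivity),
      ENNReal.ofReal_le_ofReal_iff (by positivity)] at h0
    refine h0.trans ?_
    have := Phi_ge L (s := (u + q) / 2) (q := q) (by linarith) (by linarith)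
    gcongr
  have lim : q / 2 * r ≤ 2 * Real.exp (-L.Phi q * z) * E := by
    have t1 : Tendsto (fun u => (u - q / 2) * r) (𝓝[<] q) (𝓝 ((q - q / 2) * r)) :=
      (Continuous.tendsto (by fun_prop) q).mono_left nhdsWithin_le_nhds
    have t2 : Tendsto (fun u => 2 * Real.exp (-((u + q) / 2 / q * L.Phi q) * z) * E) (𝓝[<] q)
        (𝓝 (2 * Real.exp (-((q + q) / 2 / q * L.Phi q) * z) * E)) :=
      (Continuous.tendsto (by fun_prop) q).mono_left nhdsWithin_le_nhds
    have := le_of_tendsto_of_tendsto t1 t2 (by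
      filter_upwards [Ioo_mem_nhdsLT (show q / 2 < q by linarith)] with u hu
      exact h u hu)
    have e : (q + q) / 2 / q * L.Phi q = L.Phi q := by field_simp; ring
    rw [e] at this
    linarith
  rw [er]
  apply ENNReal.ofReal_le_ofReal
  rw [show 4 / q * E * Real.exp (-L.Phi q * z) = (2 / q) * (2 * Real.exp (-L.Phi q * z) * E) by ring]
  calc r = (2 / q) * (q / 2 * r) := by field_simp
    _ ≤ _ := by gcongr

/-- tilted resolvent -/
def Vm (q : ℝ) : Measure ℝ :=
  (Um L q).withDensity fun y => ENNReal.ofReal (Real.exp ((L.Phi q - 1) * y))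

lemma Vm_tail {q : ℝ} (hq : 0 < q) : ∃ B : ℝ, 0 ≤ B ∧ ∀ z, 0 < z →
    Vm L q (Ioi z) ≤ ENNReal.ofReal (B * Real.exp (-z)) := by
  have hP := Phi_pos L hq
  set C := 4 / q * (1 + Real.exp (L.Phi (2 * q))) with hC
  have hC0 : 0 ≤ C := by positivity
  have h1 : ∀ z, 0 < z → Vm L q (Ico z (z + 1)) ≤
      ENNReal.ofReal (C * Real.exp (L.Phi q) * Real.exp (-z)) := by
    intro z hz
    unfold Vm
    rw [withDensity_apply _ measurableSet_Ico]
    calc _ ≤ ∫⁻ y in Ico z (z + 1), ENNReal.ofReal (Real.exp (L.Phi q * (z + 1) - z)) ∂(Um L q) := by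
          refine setLIntegral_mono measurable_const fun y hy => ?_
          apply ENNReal.ofReal_le_ofReal
          apply Real.exp_le_exp.2
          nlinarith [hy.1, hy.2]
      _ = ENNReal.ofReal (Real.exp (L.Phi q * (z + 1) - z)) * Um L q (Ico z (z + 1)) := by
          rw [setLIntegral_const]
      _ ≤ ENNReal.ofReal (Real.exp (L.Phi q * (z + 1) - z)) *
            ENNReal.ofReal (C * Real.exp (-L.Phi q * z)) := by
          gcongr
          exact Um_window L hq hz
      _ = _ := by
          rw [← ENNReal.ofReal_mul (Real.exp_pos _).le]
          congr 1
          have e : Real.exp (L.Phi q * (z + 1) - z) =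
              Real.exp (L.Phi q) * Real.exp (-z) * Real.exp (L.Phi q * z) := by
            rw [← Real.exp_add, ← Real.exp_add]; congr 1; ring
          have e2 : Real.exp (L.Phi q * z) * Real.exp (-L.Phi q * z) = 1 := by
            rw [← Real.exp_add]; simp
          rw [e]
          linear_combination C * Real.exp (L.Phi q) * Real.exp (-z) * e2
  have hsum : Summable fun n : ℕ => Real.exp (-(n:ℝ)) := Real.summable_exp_neg_nat
  refine ⟨C * Real.exp (L.Phi q) * ∑' n : ℕ, Real.exp (-(n:ℝ)), ?_, fun z hz => ?_⟩
  · exact mul_nonneg (by positivity) (tsum_nonneg fun n => (Real.exp_pos _).le)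
  · have hsub : Ioi z ⊆ ⋃ n : ℕ, Ico (z + n) (z + n + 1) := by
      intro y hy
      have hy' : z < y := hy
      refine mem_iUnion.2 ⟨⌊y - z⌋₊, ?_, ?_⟩
      · have := Nat.floor_le (show 0 ≤ y - z by linarith)
        linarith
      · have := Nat.lt_floor_add_one (y - z)
        linarith
    refine (measure_mono hsub).trans ((measure_iUnion_le _).trans ?_)
    calc _ ≤ ∑' n : ℕ, ENNReal.ofReal (C * Real.exp (L.Phi q) * Real.exp (-z) * Real.exp (-(n:ℝ))) := by
          refine ENNReal.tsum_le_tsum fun n => ?_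
          refine (h1 (z + n) (by positivity)).trans (le_of_eq ?_)
          rw [mul_assoc _ (Real.exp (-z)), ← Real.exp_add, neg_add]
      _ = _ := by
          rw [← ENNReal.ofReal_tsum_of_nonneg (fun n => by positivity) (hsum.mul_left _), tsum_mul_left]
          congr 1; ring

lemma Vm_harm {q u z : ℝ} (hu : 0 < u) (huq : u < q) (hz : 0 < z) :
    Vm L q (Ioi z) = ENNReal.ofReal (q - u) * ∫⁻ w, ENNReal.ofReal (Real.exp (-(L.Phi q - 1) * w)) *
      Vm L q (Ioi (z + w)) ∂(wm L u) := by
  have := Um_fin L (hu.trans huq)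
  have hm : Measurable ((Ioi z).indicator fun y => ENNReal.ofReal (Real.exp ((L.Phi q - 1) * y))) :=
    Measurable.indicator (by fun_prop) measurableSet_Ioi
  have h := icfe_int L hu huq hm
    (fun x hx => indicator_of_notMem (fun h => by have : z < x := h; linarith) _)
  have hV : ∀ a, Vm L q (Ioi a) =
      ∫⁻ y, (Ioi a).indicator (fun y => ENNReal.ofReal (Real.exp ((L.Phi q - 1) * y))) y ∂(Um L q) := by
    intro a
    unfold Vm
    rw [withDensity_apply _ measurableSet_Ioi, lintegral_indicator measurableSet_Ioi]
  rw [hV, h, lintegral_lintegral_swap (by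
    apply Measurable.aemeasurable
    exact hm.comp (measurable_fst.sub measurable_snd))]
  congr 1
  refine lintegral_congr fun w => ?_
  rw [hV, ← lintegral_const_mul _ (Measurable.indicator (by fun_prop) measurableSet_Ioi)]
  refine lintegral_congr fun y => ?_
  by_cases hy : z + w < y
  · rw [indicator_of_mem (show y ∈ Ioi (z + w) from hy), indicator_of_mem (show y - w ∈ Ioi z by
      show z < y - w; linarith), ← ENNReal.ofReal_mul (Real.exp_pos _).le, ← Real.exp_add]
    congr 2; ring
  · rw [indicator_of_notMem (show y ∉ Ioi (z + w) from hy), indicator_of_notMem (show y - w ∉ Ioi z by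
      intro h; exact hy (by have : z < y - w := h; linarith)), mul_zero]

end SNAux
namespace SNAux

open scoped ENNReal Topology
open ProbabilityTheory

variable (L : SNLevy)

lemma Vm_const_ae {q u : ℝ} (hu : 0 < u) (huq : u < q) {z : ℝ} (hz : 0 < z) :
    ∀ᵐ w ∂(wm L u), Real.exp (z + w) * (Vm L q (Ioi (z + w))).toReal
      = Real.exp z * (Vm L q (Ioi z)).toReal := by
  have hq := hu.trans huq
  obtain ⟨B, hB0, hB⟩ := Vm_tail L hq
  have hfin : ∀ z, 0 < z → Vm L q (Ioi z) ≠ ∞ := fun z hz =>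
    ((hB z hz).trans_lt ENNReal.ofReal_lt_top).ne
  set g : ℝ → ℝ := (Ioi 0).indicator fun z => Real.exp z * (Vm L q (Ioi z)).toReal with hg
  have hgm : Measurable g := by
    refine Measurable.indicator ?_ measurableSet_Ioi
    refine Real.measurable_exp.mul ?_
    have : Antitone fun z => Vm L q (Ioi z) := fun a b hab => measure_mono (Ioi_subset_Ioi hab)
    exact this.measurable.ennreal_toReal
  have hgpos : ∀ z, 0 < z → g z = Real.exp z * (Vm L q (Ioi z)).toReal := fun z hz =>
    indicator_of_mem (show z ∈ Ioi (0:ℝ) from hz) _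
  have hg0 : ∀ z, 0 ≤ g z := fun z =>
    indicator_nonneg (fun z _ => mul_nonneg (Real.exp_pos _).le ENNReal.toReal_nonneg) z
  have hgB : ∀ z, |g z| ≤ B := by
    intro z
    rw [abs_of_nonneg (hg0 z)]
    by_cases hz : 0 < z
    · rw [hgpos z hz]
      have h1 : (Vm L q (Ioi z)).toReal ≤ B * Real.exp (-z) :=
        ENNReal.toReal_le_of_le_ofReal (by positivity) (hB z hz)
      calc _ ≤ Real.exp z * (B * Real.exp (-z)) := by gcongr
        _ = B := by rw [mul_left_comm, ← Real.exp_add]; simp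
    · rw [hg, indicator_of_notMem (show z ∉ Ioi (0:ℝ) from hz)]; exact hB0
  have hgE : ∀ z, 0 < z → ENNReal.ofReal (g z) = ENNReal.ofReal (Real.exp z) * Vm L q (Ioi z) := by
    intro z hz
    rw [hgpos z hz, ENNReal.ofReal_mul (Real.exp_pos _).le, ENNReal.ofReal_toReal (hfin z hz)]
  have hPhi := Phi_lt L hu huq
  have hqu : 0 < q - u := by linarith
  have hprob : IsProbabilityMeasure (tw L (q - u) (-L.Phi q) u) := ⟨by
    rw [tw_univ L hqu.le hu hPhi, psi_Phi L hq, div_self hqu.ne', ENNReal.ofReal_one]⟩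
  have hae : ∀ P : ℝ → Prop, (∀ᵐ w ∂(wm L u), P w) ↔ ∀ᵐ w ∂(tw L (q - u) (-L.Phi q) u), P w := by
    intro P
    unfold tw
    rw [Measure.ae_ennreal_smul_measure_iff (by simpa using hqu), ae_withDensity_iff (by fun_prop)]
    simp [Real.exp_pos]
  have key := choquet_deny (tw L (q - u) (-L.Phi q) u) ((hae _).1 (wm_pos L u)) g hgm B hgB
    (fun z hz => ?_) z hz
  · rw [← hae] at key
    filter_upwards [key, wm_pos L u] with w h1 h2
    rwa [hgpos _ (by linarith), hgpos _ hz] at h1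
  · rw [integral_eq_lintegral_of_nonneg_ae (ae_of_all _ fun w => hg0 _)
      (hgm.comp (measurable_const_add z)).aestronglyMeasurable]
    rw [← ENNReal.toReal_ofReal (hg0 z)]
    congr 1
    rw [hgE z hz, Vm_harm L hu huq hz]
    unfold tw
    rw [lintegral_smul_measure, smul_eq_mul, mul_left_comm,
      lintegral_withDensity_eq_lintegral_mul _ (by fun_prop) (by fun_prop),
      ← lintegral_const_mul' (ENNReal.ofReal (Real.exp z))]
    · congr 1
      refine lintegral_congr_ae ?_
      filter_upwards [wm_pos L u] with w hw
      simp only [Pi.mul_apply]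
      rw [hgE _ (by linarith), ← mul_assoc, ← mul_assoc, ← ENNReal.ofReal_mul (Real.exp_pos _).le,
        ← ENNReal.ofReal_mul (Real.exp_pos _).le, ← Real.exp_add, ← Real.exp_add]
      congr 3; ring
    · exact ENNReal.ofReal_ne_top

lemma wm_interval {u : ℝ} (hu : 0 < u) : ∃ a b : ℝ, a < b ∧ ∀ P : ℝ → Prop,
    (∀ᵐ w ∂(wm L u), P w) → ∀ᵐ w ∂(volume : Measure ℝ), w ∈ Ioo a b → P w := by
  obtain ⟨x0, hx0, hW⟩ : ∃ x0, 0 < x0 ∧ 0 < L.W u x0 := by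
    by_contra hc
    push Not at hc
    have h := L.W_LT u hu.le (L.Phi u + 1) (by linarith)
    rw [setIntegral_congr_fun (g := fun _ => (0:ℝ)) measurableSet_Ioi (fun x hx => by
      have := le_antisymm (hc x hx) (L.W_nonneg u x)
      simp [this])] at h
    have := psi_gt_of_Phi L hu (show L.Phi u < L.Phi u + 1 by linarith)
    have h2 : 0 < 1 / (L.psi (L.Phi u + 1) - u) := one_div_pos.2 (by linarith)
    rw [← h] at h2
    simp at h2
  have hc : ContinuousAt (L.W u) x0 := (L.W_cont u hu.le).continuousAt (Ici_mem_nhds hx0)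
  have hev : ∀ᶠ x in 𝓝 x0, 0 < x ∧ 0 < L.W u x :=
    (lt_mem_nhds hx0).and (hc.eventually (lt_mem_nhds hW))
  obtain ⟨a, b, hab, hsub⟩ := mem_nhds_iff_exists_Ioo_subset.1 hev
  refine ⟨a, b, hab.1.trans hab.2, fun P hP => ?_⟩
  unfold wm at hP
  rw [ae_withDensity_iff (W_meas L hu.le).ennreal_ofReal, ae_restrict_iff' measurableSet_Ioi] at hP
  filter_upwards [hP] with w hw hwab
  have := hsub hwab
  exact hw this.1 (by simpa using this.2)

lemma Vm_const {q : ℝ} (hq : 0 < q) : ∃ c : ℝ, 0 ≤ c ∧ ∀ z, 0 < z →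
    Vm L q (Ioi z) = ENNReal.ofReal (c * Real.exp (-z)) := by
  obtain ⟨B, hB0, hB⟩ := Vm_tail L hq
  have hfin : ∀ z, 0 < z → Vm L q (Ioi z) ≠ ∞ := fun z hz =>
    ((hB z hz).trans_lt ENNReal.ofReal_lt_top).ne
  obtain ⟨a, b, hab, hI⟩ := wm_interval L (u := q / 2) (by linarith)
  set g : ℝ → ℝ := fun z => Real.exp z * (Vm L q (Ioi z)).toReal with hg
  have step : ∀ z z', 0 < z → z ≤ z' → z' < z + (b - a) → g z = g z' := by
    intro z z' hz hzz h
    have h1 : ∀ z, 0 < z → ∀ᵐ y ∂(volume : Measure ℝ), y ∈ Ioo (z + a) (z + b) → g y = g z := by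
      intro z hz
      have := hI _ (Vm_const_ae L (q := q) (u := q / 2) (by linarith) (by linarith) hz)
      have h2 := (measurePreserving_sub_right (volume : Measure ℝ) z).quasiMeasurePreserving.ae this
      filter_upwards [h2] with y hy hyI
      have := hy ⟨by linarith [hyI.1], by linarith [hyI.2]⟩
      rwa [show z + (y - z) = y by ring] at this
    have hne : ¬ (∀ᵐ y ∂(volume : Measure ℝ), y ∉ Ioo (z' + a) (z + b)) := by
      intro hc
      have : volume (Ioo (z' + a) (z + b)) = 0 := by
        have := ae_iff.1 hc
        simp only [not_not] at this
        exact this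
      rw [Real.volume_Ioo] at this
      simp at this
      linarith
    have : ∃ᵐ y ∂(volume : Measure ℝ), y ∈ Ioo (z' + a) (z + b) := hne
    obtain ⟨y, hy, hy1, hy2⟩ := (this.and_eventually ((h1 z hz).and (h1 z' (by linarith)))).exists
    rw [← hy1 ⟨by linarith [hy.1], hy.2⟩, ← hy2 ⟨hy.1, by linarith [hy.2]⟩]
  have steps : ∀ n : ℕ, ∀ z z', 0 < z → z ≤ z' → z' < z + 2 ^ n * (b - a) → g z = g z' := by
    intro n
    induction n with
    | zero => intro z z' hz h1 h2; exact step z z' hz h1 (by simpa using h2)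
    | succ n ih =>
      intro z z' hz h1 h2
      rw [pow_succ] at h2
      rw [ih z ((z + z') / 2) hz (by linarith) (by linarith),
        ih ((z + z') / 2) z' (by linarith) (by linarith) (by linarith)]
  have all : ∀ z z', 0 < z → z ≤ z' → g z = g z' := by
    intro z z' hz h1
    obtain ⟨n, hn⟩ := pow_unbounded_of_one_lt ((z' - z) / (b - a)) (one_lt_two)
    refine steps n z z' hz h1 ?_
    rw [div_lt_iff₀ (by linarith)] at hn
    linarith
  refine ⟨g 1, mul_nonneg (Real.exp_pos _).le ENNReal.toReal_nonneg, fun z hz => ?_⟩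
  have : g z = g 1 := by
    rcases le_total z 1 with h | h
    · exact all z 1 hz h
    · exact (all 1 z one_pos h).symm
  rw [← this, hg]
  simp only
  rw [mul_right_comm, ← Real.exp_add]
  simp [ENNReal.ofReal_toReal (hfin z hz)]

lemma Um_density {q : ℝ} (hq : 0 < q) : ∃ c : ℝ, 0 ≤ c ∧ ∀ f : ℝ → ℝ≥0∞, Measurable f →
    ∫⁻ z in Ioi 0, f z ∂(Um L q) =
      ENNReal.ofReal c * ∫⁻ z in Ioi (0:ℝ), f z * ENNReal.ofReal (Real.exp (-L.Phi q * z)) := by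
  obtain ⟨c, hc, h⟩ := Vm_const L hq
  refine ⟨c, hc, ?_⟩
  set ρ := (Vm L q).restrict (Ioi 0) with hρ
  set σ := ENNReal.ofReal c • ((volume.restrict (Ioi (0:ℝ))).withDensity
    fun y => ENNReal.ofReal (Real.exp (-1 * y))) with hσ
  have hσI : ∀ a, 0 ≤ a → σ (Ioi a) = ENNReal.ofReal (c * Real.exp (-a)) := by
    intro a ha
    rw [hσ, Measure.smul_apply, withDensity_apply _ measurableSet_Ioi,
      Measure.restrict_restrict measurableSet_Ioi, Ioi_inter_Ioi, sup_of_le_left ha,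
      lint_exp one_pos, smul_eq_mul, ← ENNReal.ofReal_mul hc]
    simp
  have hpos : ∀ a, 0 < a → ρ (Ioi a) = σ (Ioi a) := by
    intro a ha
    rw [hσI a ha.le, hρ, Measure.restrict_apply measurableSet_Ioi, Ioi_inter_Ioi,
      sup_of_le_left ha.le, h a ha]
  have h0 : ρ (Ioi 0) = σ (Ioi 0) := by
    have hU : Ioi (0:ℝ) = ⋃ n : ℕ, Ioi (1 / ((n:ℝ) + 1)) := by
      ext x
      simp only [mem_Ioi, mem_iUnion]
      constructor
      · exact fun hx => exists_nat_one_div_lt hx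
      · rintro ⟨n, hn⟩
        exact lt_trans (by positivity) hn
    have hmono : Monotone fun n : ℕ => Ioi (1 / ((n:ℝ) + 1)) := by
      intro m n hmn
      refine Ioi_subset_Ioi ?_
      gcongr
    rw [hU, hmono.measure_iUnion, hmono.measure_iUnion]
    refine iSup_congr fun n => hpos _ (by positivity)
  have hIic : ρ (Iic 0) = 0 ∧ σ (Iic 0) = 0 := by
    constructor
    · rw [hρ, Measure.restrict_apply measurableSet_Iic, Iic_inter_Ioi, Ioc_self]; simp
    · rw [hσ, Measure.smul_apply, withDensity_apply _ measurableSet_Iic,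
        Measure.restrict_restrict measurableSet_Iic, Iic_inter_Ioi, Ioc_self]; simp
  have huniv : ∀ a, a ≤ 0 → ρ (Ioi a) = σ (Ioi a) := by
    intro a ha
    have e : Ioi a = Ioc a 0 ∪ Ioi 0 := (Ioc_union_Ioi_eq_Ioi ha).symm
    have hn : ∀ μ : Measure ℝ, μ (Iic 0) = 0 → μ (Ioi a) = μ (Ioi 0) := by
      intro μ hμ
      refine le_antisymm ?_ (measure_mono (Ioi_subset_Ioi ha))
      rw [e]
      refine (measure_union_le _ _).trans ?_
      rw [measure_mono_null (fun x hx => hx.2 : Ioc a 0 ⊆ Iic 0) hμ, zero_add]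
    rw [hn ρ hIic.1, hn σ hIic.2, h0]
  have hall : ∀ a, ρ (Ioi a) = σ (Ioi a) := fun a =>
    (le_or_gt a 0).elim (huniv a) (hpos a)
  have hu : ∀ μ : Measure ℝ, μ (Iic 0) = 0 → μ univ = μ (Ioi 0) := by
    intro μ hμ
    refine le_antisymm ?_ (measure_mono (subset_univ _))
    rw [← Iic_union_Ioi (a := (0:ℝ))]
    refine (measure_union_le _ _).trans ?_
    rw [hμ, zero_add]
  have hσf : IsFiniteMeasure σ := ⟨by
    rw [hu σ hIic.2, hσI 0 le_rfl]; exact ENNReal.ofReal_lt_top⟩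
  have hρf : IsFiniteMeasure ρ := ⟨by
    rw [hu ρ hIic.1, h0, hσI 0 le_rfl]; exact ENNReal.ofReal_lt_top⟩
  have heq : ρ = σ := by
    refine Measure.ext_of_Iic _ _ fun a => ?_
    rw [← compl_Ioi, measure_compl measurableSet_Ioi (measure_ne_top _ _),
      measure_compl measurableSet_Ioi (measure_ne_top _ _), hall a, hu ρ hIic.1, hu σ hIic.2, h0]
  intro f hf
  have hi : ∫⁻ z, f z * ENNReal.ofReal (Real.exp (-(L.Phi q - 1) * z)) ∂ρ =
      ∫⁻ z, f z * ENNReal.ofReal (Real.exp (-(L.Phi q - 1) * z)) ∂σ := by rw [heq]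
  rw [hρ, hσ, lintegral_smul_measure, smul_eq_mul,
    lintegral_withDensity_eq_lintegral_mul _ (by fun_prop) (by fun_prop)] at hi
  unfold Vm at hi
  rw [restrict_withDensity measurableSet_Ioi,
    lintegral_withDensity_eq_lintegral_mul _ (by fun_prop) (by fun_prop)] at hi
  convert hi using 1
  · refine lintegral_congr fun z => ?_
    simp only [Pi.mul_apply]
    rw [mul_left_comm, ← ENNReal.ofReal_mul (Real.exp_pos _).le, ← Real.exp_add]
    simp [← add_mul]
  · congr 1
    refine lintegral_congr fun z => ?_
    simp only [Pi.mul_apply]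
    rw [mul_left_comm, ← ENNReal.ofReal_mul (Real.exp_pos _).le, ← Real.exp_add]
    congr 3; ring

lemma Um_const {q c : ℝ} (hq : 0 < q) (hc : 0 ≤ c) (h : ∀ f : ℝ → ℝ≥0∞, Measurable f →
    ∫⁻ z in Ioi 0, f z ∂(Um L q) =
      ENNReal.ofReal c * ∫⁻ z in Ioi (0:ℝ), f z * ENNReal.ofReal (Real.exp (-L.Phi q * z))) :
    c = (deriv L.psi (L.Phi q))⁻¹ := by
  have hP := Phi_pos L hq
  have hfinU := Um_fin L hq
  have hd := psi_deriv_pos L hP (by rw [psi_Phi L hq]; exact hq)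
  have hD := (psi_diff L hP).hasDerivAt
  have h1 : Tendsto (slope L.psi (L.Phi q)) (𝓝[<] (L.Phi q)) (𝓝 (deriv L.psi (L.Phi q))) :=
    (hasDerivAt_iff_tendsto_slope.1 hD).mono_left (nhdsWithin_mono _ fun x hx => ne_of_lt hx)
  have h2 := h1.inv₀ hd.ne'
  have hb : ∀ l ∈ Ioo 0 (L.Phi q), c ≤ (slope L.psi (L.Phi q) l)⁻¹ ∧
      (slope L.psi (L.Phi q) l)⁻¹ ≤ c + (L.Phi q - l) * (1 / q) := by
    intro l hl
    have hlt := psi_lt_of_Phi L hq hl.1.le hl.2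
    have hlap := lap_Um L hl.1.le hlt
    have hpl : 0 < L.Phi q - l := by linarith [hl.2]
    have hI := h (fun z => ENNReal.ofReal (Real.exp (l * z))) (by fun_prop)
    have e1 : ∫⁻ z in Ioi (0:ℝ), ENNReal.ofReal (Real.exp (l * z)) *
        ENNReal.ofReal (Real.exp (-L.Phi q * z)) = ENNReal.ofReal (1 / (L.Phi q - l)) := by
      have := lint_exp hpl 0
      simp only [mul_zero, Real.exp_zero] at this
      rw [← this]
      refine lintegral_congr fun z => ?_
      rw [← ENNReal.ofReal_mul (Real.exp_pos _).le, ← Real.exp_add]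
      congr 2; ring
    rw [e1, ← ENNReal.ofReal_mul hc] at hI
    have hsplit : ∫⁻ z in Iic 0, ENNReal.ofReal (Real.exp (l * z)) ∂(Um L q) +
        ∫⁻ z in Ioi 0, ENNReal.ofReal (Real.exp (l * z)) ∂(Um L q) = lap (Um L q) l := by
      have := lintegral_add_compl (μ := Um L q) (fun z => ENNReal.ofReal (Real.exp (l * z)))
        (measurableSet_Iic (a := (0:ℝ)))
      rwa [compl_Iic] at this
    have hA : ∫⁻ z in Iic 0, ENNReal.ofReal (Real.exp (l * z)) ∂(Um L q) ≤ ENNReal.ofReal (1 / q) := by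
      calc _ ≤ ∫⁻ z in Iic 0, 1 ∂(Um L q) := by
            refine setLIntegral_mono measurable_const fun z hz => ?_
            rw [← ENNReal.ofReal_one]
            apply ENNReal.ofReal_le_ofReal
            rw [Real.exp_le_one_iff]
            have hz' : z ≤ 0 := hz
            nlinarith [hl.1]
        _ ≤ _ := by
            rw [setLIntegral_one, ← Um_univ L hq]
            exact measure_mono (subset_univ _)
    have hs : (slope L.psi (L.Phi q) l)⁻¹ = (L.Phi q - l) * (1 / (q - L.psi l)) := by
      rw [slope_def_field, psi_Phi L hq, inv_div, ← neg_div_neg_eq, neg_sub, neg_sub, mul_one_div]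
    have k1 : c * (1 / (L.Phi q - l)) ≤ 1 / (q - L.psi l) := by
      rw [← ENNReal.ofReal_le_ofReal_iff (one_div_nonneg.2 (by linarith)), ← hlap, ← hsplit, hI]
      exact le_add_self
    have k2 : 1 / (q - L.psi l) ≤ 1 / q + c * (1 / (L.Phi q - l)) := by
      rw [← ENNReal.ofReal_le_ofReal_iff (by positivity), ← hlap, ← hsplit, hI,
        ENNReal.ofReal_add (by positivity) (by positivity)]
      gcongr
    rw [hs]
    constructor
    · calc c = (L.Phi q - l) * (c * (1 / (L.Phi q - l))) := by field_simp
        _ ≤ _ := by gcongr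
    · calc _ ≤ (L.Phi q - l) * (1 / q + c * (1 / (L.Phi q - l))) := by gcongr
        _ = _ := by field_simp; ring
  have hmem : ∀ᶠ l in 𝓝[<] (L.Phi q), l ∈ Ioo 0 (L.Phi q) := Ioo_mem_nhdsLT hP
  have h3 : Tendsto (fun l => c + (L.Phi q - l) * (1 / q)) (𝓝[<] (L.Phi q)) (𝓝 c) := by
    have : Tendsto (fun l => c + (L.Phi q - l) * (1 / q)) (𝓝[<] (L.Phi q))
        (𝓝 (c + (L.Phi q - L.Phi q) * (1 / q))) :=
      (Continuous.tendsto (by fun_prop) _).mono_left nhdsWithin_le_nhds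
    simpa using this
  refine tendsto_nhds_unique (tendsto_of_tendsto_of_tendsto_of_le_of_le' tendsto_const_nhds h3
    ?_ ?_) h2
  · filter_upwards [hmem] with l hl using (hb l hl).1
  · filter_upwards [hmem] with l hl using (hb l hl).2

lemma Um_formula {q : ℝ} (hq : 0 < q) {f : ℝ → ℝ≥0∞} (hf : Measurable f) :
    ∫⁻ z in Ioi 0, f z ∂(Um L q) = ENNReal.ofReal (deriv L.psi (L.Phi q))⁻¹ *
      ∫⁻ z in Ioi (0:ℝ), f z * ENNReal.ofReal (Real.exp (-L.Phi q * z)) := by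
  obtain ⟨c, hc, h⟩ := Um_density L hq
  rw [← Um_const L hq hc h]
  exact h f hf

end SNAux
namespace SNAux

open scoped ENNReal Topology
open ProbabilityTheory

variable (L : SNLevy)

lemma change_var {θ : ℝ} (hθ : 0 < θ) {k : ℝ → ℝ≥0∞} (hk : Measurable k) :
    ∫⁻ q in Ioi θ, ∫⁻ z in Ioi 0, k z ∂(Um L q) =
      ∫⁻ z in Ioi (0:ℝ), k z * ENNReal.ofReal (Real.exp (-z * L.Phi θ) / z) := by
  have hP := Phi_pos L hθ
  have hinj : InjOn L.psi (Ioi (L.Phi θ)) := by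
    intro a ha b hb hab
    have h1 := psi_gt_of_Phi L hθ ha
    rw [← Phi_of_psi L (hθ.trans h1) (hP.trans ha) rfl, hab]
    have h2 := psi_gt_of_Phi L hθ hb
    exact Phi_of_psi L (hθ.trans h2) (hP.trans hb) rfl
  have himg : L.psi '' Ioi (L.Phi θ) = Ioi θ := by
    ext q
    constructor
    · rintro ⟨l, hl, rfl⟩
      exact psi_gt_of_Phi L hθ hl
    · intro hq
      exact ⟨L.Phi q, Phi_lt L hθ hq, psi_Phi L (hθ.trans hq)⟩
  have e1 : ∫⁻ q in Ioi θ, ∫⁻ z in Ioi 0, k z ∂(Um L q) = ∫⁻ q in Ioi θ,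
      ENNReal.ofReal (deriv L.psi (L.Phi q))⁻¹ *
      ∫⁻ z in Ioi (0:ℝ), k z * ENNReal.ofReal (Real.exp (-L.Phi q * z)) :=
    setLIntegral_congr_fun measurableSet_Ioi fun q hq => Um_formula L (hθ.trans hq) hk
  rw [e1, ← himg, lintegral_image_eq_lintegral_abs_deriv_mul measurableSet_Ioi
    (fun l hl => (psi_diff L (hP.trans hl)).hasDerivAt.hasDerivWithinAt) hinj]
  have e2 : ∀ l ∈ Ioi (L.Phi θ), ENNReal.ofReal |deriv L.psi l| *
      (ENNReal.ofReal (deriv L.psi (L.Phi (L.psi l)))⁻¹ *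
      ∫⁻ z in Ioi (0:ℝ), k z * ENNReal.ofReal (Real.exp (-L.Phi (L.psi l) * z))) =
      ∫⁻ z in Ioi (0:ℝ), k z * ENNReal.ofReal (Real.exp (-z * l)) := by
    intro l hl
    have h1 := hθ.trans (psi_gt_of_Phi L hθ hl)
    have hd := psi_deriv_pos L (hP.trans hl) h1
    rw [Phi_of_psi L h1 (hP.trans hl) rfl, abs_of_pos hd, ← mul_assoc, ← ENNReal.ofReal_mul hd.le,
      mul_inv_cancel₀ hd.ne', ENNReal.ofReal_one, one_mul]
    refine lintegral_congr fun z => ?_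
    congr 3; ring
  rw [setLIntegral_congr_fun measurableSet_Ioi e2, lintegral_lintegral_swap (by
    apply Measurable.aemeasurable
    unfold Function.uncurry
    fun_prop)]
  refine setLIntegral_congr_fun measurableSet_Ioi fun z hz => ?_
  rw [lintegral_const_mul _ (by fun_prop), lint_exp hz]

lemma main_lint {u θ : ℝ} (x : ℝ) (hu : 0 ≤ u) (hθ : u < θ) :
    ∫⁻ t in Ioi (0:ℝ), ENNReal.ofReal (Real.exp (-θ * t)) * (ENNReal.ofReal (1 / t) *
      ∫⁻ ω, (Ioi 0).indicator (fun z => ENNReal.ofReal (L.W u (z + x) * z)) (Xt L (t, ω)) ∂(L.P 0 0))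
      = ENNReal.ofReal (Real.exp (L.Phi θ * x)) *
        ∫⁻ z in Ioi x, ENNReal.ofReal (Real.exp (-(L.Phi θ) * z) * L.W u z) := by
  have hθ0 : 0 < θ := hu.trans_lt hθ
  have hW := W_meas L hu
  have := L.prob 0 0
  set k : ℝ → ℝ≥0∞ := fun z => ENNReal.ofReal (L.W u (z + x) * z) with hk
  have hkm : Measurable k := by
    rw [hk]; exact ((hW.comp (measurable_add_const x)).mul measurable_id).ennreal_ofReal
  have hkm' : Measurable ((Ioi 0).indicator k) := hkm.indicator measurableSet_Ioi
  set F : ℝ → ℝ≥0∞ := fun t => ∫⁻ ω, (Ioi 0).indicator k (Xt L (t, ω)) ∂(L.P 0 0) with hF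
  have hFm : Measurable F := (hkm'.comp (Xt_meas L)).lintegral_prod_right'
  calc _ = ∫⁻ t in Ioi (0:ℝ), ∫⁻ q in Ioi θ, ENNReal.ofReal (Real.exp (-q * t)) * F t := by
        refine setLIntegral_congr_fun measurableSet_Ioi fun t ht => ?_
        have ht' : 0 < t := ht
        rw [lintegral_mul_const _ (by fun_prop), ← mul_assoc, ← ENNReal.ofReal_mul (Real.exp_pos _).le]
        congr 1
        have := lint_exp ht' θ
        rw [mul_one_div, show -θ * t = -t * θ by ring, ← this]
        refine lintegral_congr fun q => ?_
        congr 2; ring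
    _ = ∫⁻ q in Ioi θ, ∫⁻ t in Ioi (0:ℝ), ENNReal.ofReal (Real.exp (-q * t)) * F t := by
        rw [lintegral_lintegral_swap]
        apply Measurable.aemeasurable
        unfold Function.uncurry
        fun_prop
    _ = ∫⁻ q in Ioi θ, ∫⁻ z in Ioi 0, k z ∂(Um L q) := by
        refine lintegral_congr fun q => ?_
        exact ((lintegral_indicator measurableSet_Ioi k).symm.trans (lint_Um L q hkm')).symm
    _ = ∫⁻ z in Ioi (0:ℝ), k z * ENNReal.ofReal (Real.exp (-z * L.Phi θ) / z) :=
        change_var L hθ0 hkm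
    _ = ∫⁻ z in Ioi (0:ℝ), ENNReal.ofReal (Real.exp (L.Phi θ * x)) *
          ENNReal.ofReal (Real.exp (-(L.Phi θ) * (z + x)) * L.W u (z + x)) := by
        refine setLIntegral_congr_fun measurableSet_Ioi fun z hz => ?_
        have hz' : 0 < z := hz
        simp only [hk]
        rw [← ENNReal.ofReal_mul (mul_nonneg (L.W_nonneg _ _) hz'.le),
          ← ENNReal.ofReal_mul (Real.exp_pos _).le, ← mul_assoc, ← Real.exp_add]
        congr 1
        rw [show L.Phi θ * x + -L.Phi θ * (z + x) = -z * L.Phi θ by ring]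
        field_simp
    _ = _ := by
        rw [lintegral_const_mul _ (by
          exact ((by fun_prop : Measurable fun z => Real.exp (-(L.Phi θ) * (z + x))).mul
            (hW.comp (measurable_add_const x))).ennreal_ofReal)]
        congr 1
        have mp := measurePreserving_add_right (volume : Measure ℝ) x
        have := mp.setLIntegral_comp_preimage (s := Ioi x) measurableSet_Ioi
          (f := fun z => ENNReal.ofReal (Real.exp (-(L.Phi θ) * z) * L.W u z)) (by
          exact ((by fun_prop : Measurable fun z => Real.exp (-(L.Phi θ) * z)).mul hW).ennreal_ofReal)
        rw [← this]
        congr 2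
        ext z
        simp

lemma rhs_fin {u θ : ℝ} (x : ℝ) (hu : 0 ≤ u) (hθ : u < θ) :
    ∫⁻ z in Ioi x, ENNReal.ofReal (Real.exp (-(L.Phi θ) * z) * L.W u z) ≠ ∞ := by
  have hθ0 : 0 < θ := hu.trans_lt hθ
  have h1 := lap_wm L hu (Phi_lt' L hu hθ) (by rw [psi_Phi L hθ0]; exact hθ)
  unfold lap wm at h1
  rw [lintegral_withDensity_eq_lintegral_mul _ (W_meas L hu).ennreal_ofReal (by fun_prop)] at h1
  refine ((setLIntegral_le_lintegral _ _).trans_lt ?_).ne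
  rw [← lintegral_add_compl _ (measurableSet_Ioi (a := (0:ℝ))), compl_Ioi,
    ← setLIntegral_congr (Iio_ae_eq_Iic (a := (0:ℝ)) (μ := volume))]
  rw [setLIntegral_congr_fun (g := fun _ => (0:ℝ≥0∞)) (s := Iio (0:ℝ)) measurableSet_Iio
    (fun z hz => by simp [L.W_neg u z hz])]
  rw [lintegral_zero, add_zero]
  refine lt_of_eq_of_lt ?_ (h1.trans_lt ENNReal.ofReal_lt_top)
  refine lintegral_congr fun z => ?_
  simp only [Pi.mul_apply]
  rw [ENNReal.ofReal_mul (Real.exp_pos _).le, mul_comm]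

lemma main_eq (u θ x : ℝ) (hu : 0 ≤ u) (hθ : u < θ) :
    (∫ t in Ioi (0:ℝ), Real.exp (-θ * t) * L.Om 0 u x t)
        = Real.exp (L.Phi θ * x) * ∫ z in Ioi x, Real.exp (-(L.Phi θ) * z) * L.W u z := by
  have hθ0 : 0 < θ := hu.trans_lt hθ
  have hW := W_meas L hu
  have := L.prob 0 0
  have hm := main_lint L x hu hθ
  have hf := rhs_fin L x hu hθ
  set k : ℝ → ℝ≥0∞ := fun z => ENNReal.ofReal (L.W u (z + x) * z) with hk
  have hkm : Measurable k := by
    rw [hk]; exact ((hW.comp (measurable_add_const x)).mul measurable_id).ennreal_ofReal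
  have hkm' : Measurable ((Ioi 0).indicator k) := hkm.indicator measurableSet_Ioi
  set F : ℝ → ℝ≥0∞ := fun t => ∫⁻ ω, (Ioi 0).indicator k (Xt L (t, ω)) ∂(L.P 0 0) with hF
  have hFm : Measurable F := (hkm'.comp (Xt_meas L)).lintegral_prod_right'
  have hOm : ∀ t ∈ Ioi (0:ℝ), Real.exp (-θ * t) * L.Om 0 u x t =
      (ENNReal.ofReal (Real.exp (-θ * t)) * (ENNReal.ofReal (1 / t) * F t)).toReal := by
    intro t ht
    have ht' : 0 < t := ht
    rw [ENNReal.toReal_mul, ENNReal.toReal_ofReal (Real.exp_pos _).le]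
    congr 1
    unfold SNLevy.Om
    have hmeas : Measurable fun z => L.W u (z + x - 0) * (z / t) :=
      (hW.comp (by fun_prop)).mul (by fun_prop)
    rw [integral_eq_lintegral_of_nonneg_ae ?_ hmeas.aestronglyMeasurable]
    · congr 1
      rw [hF]
      simp only
      rw [← lint_law L hkm' ht', ← lintegral_const_mul _ hkm', ← lintegral_indicator measurableSet_Ici]
      refine lintegral_congr fun z => ?_
      by_cases hz : 0 < z
      · rw [indicator_of_mem (show z ∈ Ici (0:ℝ) from hz.le), indicator_of_mem (show z ∈ Ioi (0:ℝ) from hz),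
          ← ENNReal.ofReal_mul (by positivity), sub_zero]
        congr 1; ring
      · rw [indicator_of_notMem (show z ∉ Ioi (0:ℝ) from hz), mul_zero]
        by_cases hz0 : z = 0
        · subst hz0; simp
        · rw [indicator_of_notMem]
          intro h
          have h' : 0 ≤ z := h
          exact hz (lt_of_le_of_ne h' (Ne.symm hz0))
    · refine (ae_restrict_iff' measurableSet_Ici).2 (ae_of_all _ fun z hz => ?_)
      exact mul_nonneg (L.W_nonneg _ _) (div_nonneg hz ht'.le)
  have hmeasT : Measurable fun t => ENNReal.ofReal (Real.exp (-θ * t)) * (ENNReal.ofReal (1 / t) * F t) := by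
    fun_prop
  rw [setIntegral_congr_fun measurableSet_Ioi hOm, integral_toReal hmeasT.aemeasurable, hm,
    ENNReal.toReal_mul, ENNReal.toReal_ofReal (Real.exp_pos _).le]
  · congr 1
    rw [integral_eq_lintegral_of_nonneg_ae
      (ae_of_all _ fun z => mul_nonneg (Real.exp_pos _).le (L.W_nonneg _ _))]
    exact ((by fun_prop : Measurable fun z => Real.exp (-(L.Phi θ) * z)).mul hW).aestronglyMeasurable
  · refine ae_lt_top hmeasT ?_
    rw [hm]
    exact ENNReal.mul_ne_top ENNReal.ofReal_ne_top hf

end SNAux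

/-- **Resolvent of `Ω^{(u)}`.** For every `u ≥ 0`, `θ > u` and `x ∈ ℝ`:
`∫_0^∞ e^{-θt} Ω^{(u)}(x,t) dt = e^{Φ(θ)x} ∫_x^∞ e^{-Φ(θ)z} W^{(u)}(z) dz`;
in particular, for `x < 0` this equals `e^{Φ(θ)x}/(θ - u)`. -/
theorem Omega_laplace_transform (L : SNLevy) (u θ x : ℝ)
    (hu : 0 ≤ u) (hθ : u < θ) :
    (∫ t in Ioi (0:ℝ), Real.exp (-θ * t) * L.Om 0 u x t)
        = Real.exp (L.Phi θ * x) * ∫ z in Ioi x, Real.exp (-(L.Phi θ) * z) * L.W u z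
      ∧ (x < 0 →
          (∫ t in Ioi (0:ℝ), Real.exp (-θ * t) * L.Om 0 u x t)
            = Real.exp (L.Phi θ * x) / (θ - u)) := by
  refine ⟨SNAux.main_eq L u θ x hu hθ, fun hx => ?_⟩
  rw [SNAux.main_eq L u θ x hu hθ]
  have hθ0 : 0 < θ := hu.trans_lt hθ
  have h := L.W_LT u hu (L.Phi θ) (SNAux.Phi_lt' L hu hθ)
  rw [SNAux.psi_Phi L hθ0] at h
  have h2 : ∫ z in Ioi x, Real.exp (-(L.Phi θ) * z) * L.W u z
      = ∫ z in Ici (0:ℝ), Real.exp (-(L.Phi θ) * z) * L.W u z := by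
    refine (setIntegral_eq_of_subset_of_forall_sdiff_eq_zero measurableSet_Ioi
      (fun z hz => ?_) (fun z hz => ?_))
    · have hz' : (0:ℝ) ≤ z := hz
      exact lt_of_lt_of_le hx hz'
    · have hz' : z < 0 := not_le.1 hz.2
      rw [L.W_neg u z hz', mul_zero]
  rw [h2, integral_Ici_eq_integral_Ioi, h, mul_one_div]
end
end
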